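/- Let h ≥ 2 be an integer, let ℓ be a prime ideal of O_K, and let S_{h,ℓ}(x) denote the set of h-free ideals of O_K with norm at most x that are coprime to ℓ. Then |S_{h,ℓ}(x)| = ((N(ℓ)^h − N(ℓ)^{h−1})/(N(ℓ)^h − 1)) · (κ/ζ_K(h)) · x + O_h(R_{S_h}(x)), where the implied constant depends only on h and K (uniformly in ℓ), and R_{S_h}(x) = x^{1−2/(n_K+1)} if 1/h < 1 − 2/(n_K+1); R_{S_h}(x) = x^{1−2/(n_K+1)} log x if 1/h = 1 − 2/(n_K+1); R_{S_h}(x) = x^{1/h} if 1/h > 1 − 2/(n_K+1). -/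

import Mathlib

open Filter Topology
open scoped BigOperators

noncomputable section

variable (K : Type) [Field K] [NumberField K]

/-- `m` is an `h`-free ideal: no prime ideal divides `m` to order `h` or more. -/
def IsHFree (h : ℕ) (m : Ideal (NumberField.RingOfIntegers K)) : Prop :=
  m ≠ 0 ∧ ∀ p : Ideal (NumberField.RingOfIntegers K), p.IsPrime → ¬ p ^ h ∣ m

/-- The residue `κ` of the Dedekind zeta function of `K` at `s = 1`. -/
def kappa : ℝ :=
  (2 ^ NumberField.InfinitePlace.nrRealPlaces K *
      (2 * Real.pi) ^ NumberField.InfinitePlace.nrComplexPlaces K *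
      (NumberField.classNumber K) * NumberField.Units.regulator K) /
    ((NumberField.Units.torsionOrder K) * Real.sqrt |(NumberField.discr K : ℝ)|)

/-- The Dedekind zeta function of `K` at a real argument, as a sum over nonzero ideals. -/
def zetaKR (s : ℝ) : ℝ :=
  ∑' m : {m : Ideal (NumberField.RingOfIntegers K) // m ≠ 0},
    ((Ideal.absNorm m.1 : ℝ)) ^ (-s)

/-- The error term `R_{S_h}` for the distribution of `h`-free ideals. -/
def RSh (h : ℕ) (x : ℝ) : ℝ :=
  if (1 : ℝ)/h < 1 - 2/((Module.finrank ℚ K : ℝ) + 1) then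
    x ^ (1 - 2/((Module.finrank ℚ K : ℝ) + 1))
  else if (1 : ℝ)/h = 1 - 2/((Module.finrank ℚ K : ℝ) + 1) then
    x ^ (1 - 2/((Module.finrank ℚ K : ℝ) + 1)) * Real.log x
  else x ^ ((1 : ℝ)/h)

namespace Landau
open scoped ContDiff

/-- Families of functions on `(-1,1)` with uniformly bounded derivatives of all orders. -/
def UB {ι : Type*} (F : ι → ℝ → ℂ) : Prop :=
  (∀ i, ContDiffOn ℝ ∞ (F i) (Set.Ioo (-1) 1)) ∧
    ∀ k : ℕ, ∃ C : ℝ, ∀ i, ∀ s ∈ Set.Ioo (-1 : ℝ) 1, ‖iteratedDeriv k (F i) s‖ ≤ C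

lemma UB.cda {ι : Type*} {F : ι → ℝ → ℂ} (h : UB F) (i : ι) {s : ℝ} (hs : s ∈ Set.Ioo (-1 : ℝ) 1) :
    ContDiffAt ℝ ∞ (F i) s := (h.1 i).contDiffAt (isOpen_Ioo.mem_nhds hs)

lemma UB.reindex {ι κ : Type*} {F : ι → ℝ → ℂ} (h : UB F) (g : κ → ι) : UB (fun j => F (g j)) :=
  ⟨fun _ => h.1 _, fun k => (h.2 k).imp fun _ hC _ => hC _⟩

lemma mul_bound {ι : Type*} {F G : ι → ℝ → ℂ} 
    (hF : ∀ i, ContDiffOn ℝ ∞ (F i) (Set.Ioo (-1) 1)) (hG : ∀ i, ContDiffOn ℝ ∞ (G i) (Set.Ioo (-1) 1))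
    (k : ℕ) (bF : ∀ j ≤ k, ∃ C : ℝ, ∀ i, ∀ s ∈ Set.Ioo (-1 : ℝ) 1, ‖iteratedDeriv j (F i) s‖ ≤ C)
    (bG : ∀ j ≤ k, ∃ C : ℝ, ∀ i, ∀ s ∈ Set.Ioo (-1 : ℝ) 1, ‖iteratedDeriv j (G i) s‖ ≤ C) :
    ∃ C : ℝ, ∀ i, ∀ s ∈ Set.Ioo (-1 : ℝ) 1, ‖iteratedDeriv k (fun s => F i s * G i s) s‖ ≤ C := by
  choose! cF hcF using bF
  choose! cG hcG using bG
  refine ⟨∑ j ∈ Finset.range (k+1), (k.choose j : ℝ) * (cF j * cG (k-j)), fun i s hs => ?_⟩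
  have h1 : ContDiffAt ℝ k (F i) s :=
    ((hF i).contDiffAt (isOpen_Ioo.mem_nhds hs)).of_le (by exact_mod_cast le_top)
  have h2 : ContDiffAt ℝ k (G i) s :=
    ((hG i).contDiffAt (isOpen_Ioo.mem_nhds hs)).of_le (by exact_mod_cast le_top)
  rw [iteratedDeriv_fun_mul h1 h2]
  refine (norm_sum_le _ _).trans (Finset.sum_le_sum fun j hj => ?_)
  have hj' : j ≤ k := by simpa [Nat.lt_succ_iff] using hj
  rw [mul_assoc, norm_mul, norm_mul]
  simp only [Complex.norm_natCast]
  gcongr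
  · exact (norm_nonneg _).trans (hcF j hj' i s hs)
  · exact hcF j hj' i s hs
  · exact hcG (k-j) (Nat.sub_le _ _) i s hs

lemma UB.mul {ι : Type*} {F G : ι → ℝ → ℂ} (hF : UB F) (hG : UB G) :
    UB (fun i s => F i s * G i s) :=
  ⟨fun i => (hF.1 i).mul (hG.1 i), fun k => mul_bound hF.1 hG.1 k (fun j _ => hF.2 j) (fun j _ => hG.2 j)⟩

lemma iteratedDeriv_congr_on {F G : ℝ → ℂ} {U : Set ℝ} (hU : IsOpen U) (h : ∀ s ∈ U, F s = G s) (k : ℕ) {s : ℝ}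
    (hs : s ∈ U) : iteratedDeriv k F s = iteratedDeriv k G s := by
  have : F =ᶠ[𝓝 s] G := by filter_upwards [hU.mem_nhds hs] with t ht using h t ht
  exact this.iteratedDeriv_eq k

lemma UB.congr {ι : Type*} {F G : ι → ℝ → ℂ} (hF : UB F) (h : ∀ i, ∀ s ∈ Set.Ioo (-1 : ℝ) 1, G i s = F i s) :
    UB G :=
  ⟨fun i => (hF.1 i).congr (h i), fun k => (hF.2 k).imp fun C hC i s hs => by
    rw [iteratedDeriv_congr_on isOpen_Ioo (h i) k hs]; exact hC i s hs⟩

lemma UB.const {ι : Type*} (c : ℂ) : UB (fun (_ : ι) (_ : ℝ) => c) := by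
  refine ⟨fun i => contDiffOn_const, fun k => ⟨‖c‖, fun i s _ => ?_⟩⟩
  rw [iteratedDeriv_const]
  split_ifs <;> simp

lemma UB.neg {ι : Type*} {F : ι → ℝ → ℂ} (hF : UB F) : UB (fun i s => - F i s) :=
  ((UB.const (-1)).mul hF).congr (by simp)

lemma UB.deriv {ι : Type*} {F : ι → ℝ → ℂ} (hF : UB F) : UB (fun i => deriv (F i)) := by
  refine ⟨fun i => ?_, fun k => ?_⟩
  · exact ((contDiffOn_infty_iff_deriv_of_isOpen isOpen_Ioo).1 (hF.1 i)).2
  · obtain ⟨C, hC⟩ := hF.2 (k+1)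
    refine ⟨C, fun i s hs => ?_⟩
    rw [← iteratedDeriv_succ']
    exact hC i s hs

lemma UB.pow {ι : Type*} {F : ι → ℝ → ℂ} (hF : UB F) (M : ℕ) : UB (fun i s => F i s ^ M) := by
  induction M with
  | zero => simpa using UB.const 1
  | succ M ih => simpa [pow_succ] using ih.mul hF

lemma UB.inv {ι : Type*} {F : ι → ℝ → ℂ} (hF : UB F) {c : ℝ} (hc : 0 < c)
    (h : ∀ i, ∀ s ∈ Set.Ioo (-1 : ℝ) 1, c ≤ ‖F i s‖) : UB (fun i s => (F i s)⁻¹) := by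
  have hne : ∀ i, ∀ s ∈ Set.Ioo (-1 : ℝ) 1, F i s ≠ 0 := fun i s hs h0 => by
    have := h i s hs; rw [h0, norm_zero] at this; linarith
  have hcd : ∀ i, ContDiffOn ℝ ∞ (fun s => (F i s)⁻¹) (Set.Ioo (-1) 1) := fun i => 
    (hF.1 i).inv (hne i)
  refine ⟨hcd, fun k => ?_⟩
  induction k using Nat.strong_induction_on with
  | _ k ih =>
    cases k with
    | zero =>
      refine ⟨c⁻¹, fun i s hs => ?_⟩
      rw [iteratedDeriv_zero, norm_inv]
      exact inv_anti₀ hc (h i s hs)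
    | succ k =>
      have key : ∀ i, ∀ s ∈ Set.Ioo (-1 : ℝ) 1, _root_.deriv (fun s => (F i s)⁻¹) s =
          ((F i s)⁻¹ * (F i s)⁻¹) * (- _root_.deriv (F i) s) := by
        intro i s hs
        have hd : DifferentiableAt ℝ (F i) s := (hF.cda i hs).differentiableAt (by simp)
        rw [(hd.hasDerivAt.fun_inv (hne i s hs)).deriv]
        have := hne i s hs
        field_simp
      have h2 := mul_bound (fun i => (hcd i).mul (hcd i)) (hF.deriv.neg.1) k
        (fun j hj => mul_bound hcd hcd j (fun l hl => ih l (by omega)) (fun l hl => ih l (by omega)))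
        (fun j _ => hF.deriv.neg.2 j)
      obtain ⟨C, hC⟩ := h2
      refine ⟨C, fun i s hs => ?_⟩
      rw [iteratedDeriv_succ', iteratedDeriv_congr_on isOpen_Ioo (key i) k hs]
      exact hC i s hs

/-- Non-stationary phase in one variable, uniformly over a family. -/
theorem osc1d {ι : Type*} {b : ι → ℝ → ℂ} {Θ : ι → ℝ → ℂ} (hb : UB b) (hΘ : UB (fun i => deriv (Θ i)))
    (hΘd : ∀ i, ∀ s ∈ Set.Ioo (-1 : ℝ) 1, DifferentiableAt ℝ (Θ i) s)
    (hre : ∀ i s, (Θ i s).im = 0) 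
    (hsupp : ∀ i s, s ∉ Set.Icc (-1/2 : ℝ) (1/2) → b i s = 0) {c : ℝ} (hc : 0 < c)
    (hlow : ∀ i, ∀ s ∈ Set.Ioo (-1 : ℝ) 1, c ≤ ‖deriv (Θ i) s‖) (N : ℕ) :
    ∃ C : ℝ, 0 ≤ C ∧ ∀ i, ∀ t : ℝ, 0 < t →
      ‖∫ s in (-3/4 : ℝ)..(3/4), b i s * Complex.exp (Complex.I * t * Θ i s)‖ ≤ C / t ^ N := by
  have hsub : ∀ s ∈ Set.Icc (-3/4 : ℝ) (3/4), s ∈ Set.Ioo (-1 : ℝ) 1 := by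
    intro s hs; constructor <;> linarith [hs.1, hs.2]
  induction N generalizing b with
  | zero =>
    obtain ⟨C, hC⟩ := hb.2 0
    refine ⟨|C| * (3/2), by positivity, fun i t ht => ?_⟩
    have := intervalIntegral.norm_integral_le_of_norm_le_const (a := (-3/4 : ℝ)) (b := 3/4) (C := |C|)
      (f := fun s => b i s * Complex.exp (Complex.I * t * Θ i s)) ?_
    · refine this.trans (le_of_eq ?_)
      rw [pow_zero, div_one]; norm_num
    · intro s hs
      rw [Set.uIoc_of_le (by norm_num)] at hs
      have hs' := hsub s ⟨hs.1.le, hs.2⟩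
      rw [norm_mul, Complex.norm_exp]
      have : (Complex.I * t * Θ i s).re = 0 := by simp [hre]
      rw [this, Real.exp_zero, mul_one]
      simpa using (hC i s hs').trans (le_abs_self _)
  | succ N ih =>
    have hinv := hΘ.inv hc hlow
    have hne : ∀ i, ∀ s ∈ Set.Ioo (-1 : ℝ) 1, deriv (Θ i) s ≠ 0 := fun i s hs h0 => by
      have := hlow i s hs; rw [h0, norm_zero] at this; linarith
    have hg := hb.mul hinv
    obtain ⟨C, hC0, hC⟩ := ih (b := fun i => deriv (fun s => b i s * (deriv (Θ i) s)⁻¹)) hg.deriv (by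
      intro i s hs
      have : (fun s => b i s * (deriv (Θ i) s)⁻¹) =ᶠ[𝓝 s] fun _ => 0 := by
        filter_upwards [isClosed_Icc.isOpen_compl.mem_nhds hs] with t ht
        rw [hsupp i t ht, zero_mul]
      rw [this.deriv_eq]; simp)
    refine ⟨C, hC0, fun i t ht => ?_⟩
    set g : ℝ → ℂ := fun s => b i s * (deriv (Θ i) s)⁻¹ with hgdef
    have hder : ∀ s ∈ Set.Ioo (-1 : ℝ) 1, HasDerivAt (fun s => g s * Complex.exp (Complex.I * t * Θ i s))
        (deriv g s * Complex.exp (Complex.I * t * Θ i s) +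
          Complex.I * t * (b i s * Complex.exp (Complex.I * t * Θ i s))) s := by
      intro s hs
      have h1 : HasDerivAt g (deriv g s) s := ((hg.cda i hs).differentiableAt (by simp)).hasDerivAt
      have h2 := (((hΘd i s hs).hasDerivAt.const_mul (Complex.I * t))).cexp
      refine (h1.fun_mul h2).congr_deriv ?_
      simp only [hgdef]
      have := hne i s hs
      field_simp
    have hcontg : ContinuousOn (deriv g) (Set.Icc (-3/4) (3/4)) := 
      ((hg.deriv.1 i).continuousOn).mono hsub
    have hcontb : ContinuousOn (b i) (Set.Icc (-3/4) (3/4)) := ((hb.1 i).continuousOn).mono hsub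
    have hcontT : ContinuousOn (fun s => Complex.exp (Complex.I * t * Θ i s)) (Set.Icc (-3/4) (3/4)) := by
      intro s hs
      exact ((continuousAt_const.mul (hΘd i s (hsub s hs)).continuousAt).cexp).continuousWithinAt
    have i1 : IntervalIntegrable (fun s => deriv g s * Complex.exp (Complex.I * t * Θ i s))
        MeasureTheory.volume (-3/4) (3/4) :=
      (ContinuousOn.mul hcontg hcontT).intervalIntegrable_of_Icc (by norm_num)
    have i2 : IntervalIntegrable (fun s => Complex.I * t * (b i s * Complex.exp (Complex.I * t * Θ i s)))
        MeasureTheory.volume (-3/4) (3/4) :=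
      (continuousOn_const.mul (ContinuousOn.mul hcontb hcontT)).intervalIntegrable_of_Icc (by norm_num)
    have hFTC := intervalIntegral.integral_eq_sub_of_hasDerivAt (a := (-3/4 : ℝ)) (b := 3/4)
      (fun s hs => hder s (hsub s (by rwa [Set.uIcc_of_le (by norm_num)] at hs))) (i1.add i2)
    have e1 : g (3/4) = 0 := by
      rw [hgdef]; simp only; rw [hsupp i _ (by norm_num), zero_mul]
    have e2 : g (-3/4) = 0 := by
      rw [hgdef]; simp only; rw [hsupp i _ (by norm_num), zero_mul]
    rw [e1, e2, zero_mul, zero_mul, sub_zero, intervalIntegral.integral_add i1 i2,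
      intervalIntegral.integral_const_mul] at hFTC
    have hn : ‖Complex.I * (t:ℂ) * ∫ s in (-3/4 : ℝ)..(3/4), b i s * Complex.exp (Complex.I * t * Θ i s)‖ ≤ C / t ^ N := by
      rw [eq_neg_of_add_eq_zero_right hFTC, norm_neg]
      exact hC i t ht
    rw [norm_mul, norm_mul, Complex.norm_I, one_mul, Complex.norm_real, Real.norm_of_nonneg ht.le] at hn
    rw [pow_succ, ← div_div, le_div_iff₀ ht, mul_comm]
    exact hn

end Landau

namespace Landau
open scoped ContDiff

variable {R C : Type} [Fintype R] [Fintype C]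

abbrev VV (R C : Type) := (R → ℝ) × (C → ℂ)

def vexp (z : VV R C) : VV R C := (fun w => Real.exp (z.1 w), fun w => Complex.exp (z.2 w))

def pair (ξ y : VV R C) : ℝ := ∑ w, ξ.1 w * y.1 w + ∑ w, (ξ.2 w * y.2 w).re

def dimV (R C : Type) [Fintype R] [Fintype C] : ℕ := Fintype.card R + 2 * Fintype.card C

def pairL (ξ : VV R C) : VV R C →ₗ[ℝ] ℝ where
  toFun := pair ξ
  map_add' x y := by
    simp only [pair, Prod.fst_add, Prod.snd_add, Pi.add_apply, mul_add, Finset.sum_add_distrib, Complex.add_re]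
    ring
  map_smul' c x := by
    simp only [pair, Prod.smul_fst, Prod.smul_snd, Pi.smul_apply, smul_eq_mul, RingHom.id_apply, mul_add,
      Finset.mul_sum, Complex.real_smul]
    congr 1
    · exact Finset.sum_congr rfl fun i _ => by ring
    · refine Finset.sum_congr rfl fun i _ => ?_
      simp
      ring

lemma pair_comm (ξ y : VV R C) : pair ξ y = pair y ξ := by
  simp [pair, mul_comm]

lemma pair_add (ξ x y : VV R C) : pair ξ (x + y) = pair ξ x + pair ξ y := (pairL ξ).map_add x y
lemma pair_sub (ξ x y : VV R C) : pair ξ (x - y) = pair ξ x - pair ξ y := (pairL ξ).map_sub x y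
lemma pair_smul (ξ : VV R C) (c : ℝ) (x : VV R C) : pair ξ (c • x) = c * pair ξ x := (pairL ξ).map_smul c x
lemma add_pair (ξ x y : VV R C) : pair (x + y) ξ = pair x ξ + pair y ξ := by
  rw [pair_comm, pair_add, pair_comm x, pair_comm y]
lemma smul_pair (ξ : VV R C) (c : ℝ) (x : VV R C) : pair (c • x) ξ = c * pair x ξ := by
  rw [pair_comm, pair_smul, pair_comm x]
lemma pair_mul (ξ x y : VV R C) : pair ξ (x * y) = pair (ξ * x) y := by
  simp [pair, mul_assoc]

lemma abs_pair_le (ξ y : VV R C) : |pair ξ y| ≤ dimV R C * (‖ξ‖ * ‖y‖) := by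
  unfold pair dimV
  have h1 : |∑ w, ξ.1 w * y.1 w| ≤ Fintype.card R * (‖ξ‖ * ‖y‖) := by
    refine (Finset.abs_sum_le_sum_abs _ _).trans ?_
    refine (Finset.sum_le_card_nsmul _ _ (‖ξ‖ * ‖y‖) fun w _ => ?_).trans (by simp)
    rw [abs_mul]
    gcongr
    · exact (norm_le_pi_norm ξ.1 w).trans (norm_fst_le ξ)
    · exact (norm_le_pi_norm y.1 w).trans (norm_fst_le y)
  have h2 : |∑ w, (ξ.2 w * y.2 w).re| ≤ Fintype.card C * (‖ξ‖ * ‖y‖) := by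
    refine (Finset.abs_sum_le_sum_abs _ _).trans ?_
    refine (Finset.sum_le_card_nsmul _ _ (‖ξ‖ * ‖y‖) fun w _ => ?_).trans (by simp)
    refine (Complex.abs_re_le_norm _).trans ?_
    rw [norm_mul]
    gcongr
    · exact (norm_le_pi_norm ξ.2 w).trans (norm_snd_le ξ)
    · exact (norm_le_pi_norm y.2 w).trans (norm_snd_le y)
  have h3 := abs_add_le (∑ w, ξ.1 w * y.1 w) (∑ w, (ξ.2 w * y.2 w).re)
  have : 0 ≤ (Fintype.card C : ℝ) * (‖ξ‖ * ‖y‖) := by positivity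
  push_cast
  nlinarith

lemma vexp_add (p q : VV R C) : vexp (p + q) = vexp p * vexp q := by
  ext w <;> simp [vexp, Real.exp_add, Complex.exp_add]

lemma vexp_zero : vexp (0 : VV R C) = 1 := by
  ext w <;> simp [vexp]

lemma continuous_vexp : Continuous (vexp : VV R C → VV R C) := by
  unfold vexp
  fun_prop

lemma norm_le_of_coords {x : VV R C} {r : ℝ} (hr : 0 ≤ r) (h1 : ∀ w, |x.1 w| ≤ r) (h2 : ∀ w, ‖x.2 w‖ ≤ r) :
    ‖x‖ ≤ r := by
  rw [Prod.norm_def]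
  exact max_le ((pi_norm_le_iff_of_nonneg hr).2 h1) ((pi_norm_le_iff_of_nonneg hr).2 h2)

lemma coord1_le (x : VV R C) (w : R) : |x.1 w| ≤ ‖x‖ := (norm_le_pi_norm x.1 w).trans (norm_fst_le x)
lemma coord2_le (x : VV R C) (w : C) : ‖x.2 w‖ ≤ ‖x‖ := (norm_le_pi_norm x.2 w).trans (norm_snd_le x)

lemma norm_vexp_le (p : VV R C) : ‖vexp p‖ ≤ Real.exp ‖p‖ := by
  refine norm_le_of_coords (by positivity) (fun w => ?_) (fun w => ?_)
  · simp only [vexp]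
    rw [abs_of_pos (Real.exp_pos _), Real.exp_le_exp]
    exact (le_abs_self _).trans (coord1_le p w)
  · simp only [vexp]
    rw [Complex.norm_exp, Real.exp_le_exp]
    exact (Complex.re_le_norm _).trans (coord2_le p w)

lemma cexp_taylor {a v : ℂ} {r : ℝ} (hr : r ≤ 1) (ha : ‖a‖ ≤ r) (hav : ‖a + v‖ ≤ r) :
    ‖Complex.exp (a + v) - Complex.exp a - v‖ ≤ 2 * r * ‖v‖ := by
  have hconv : Convex ℝ (Metric.closedBall (0:ℂ) r) := convex_closedBall 0 r
  have := hconv.norm_image_sub_le_of_norm_hasDerivWithin_le (f := fun w => Complex.exp w - w)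
    (f' := fun w => Complex.exp w - 1) (C := 2 * r) (x := a) (y := a + v)
    (fun w _ => ((Complex.hasDerivAt_exp w).sub (hasDerivAt_id w)).hasDerivWithinAt) (fun w hw => ?_)
    (by simpa using ha) (by simpa using hav)
  · have e : Complex.exp (a + v) - Complex.exp a - v = (Complex.exp (a + v) - (a+v)) - (Complex.exp a - a) := by ring
    rw [e]; simpa using this
  · have hw' : ‖w‖ ≤ r := by simpa using hw
    refine (Complex.norm_exp_sub_one_le (hw'.trans hr)).trans (by linarith)

lemma vexp_taylor {a v : VV R C} {r : ℝ} (hr : r ≤ 1) (ha : ‖a‖ ≤ r) (hav : ‖a + v‖ ≤ r) :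
    ‖vexp (a + v) - vexp a - v‖ ≤ 2 * r * ‖v‖ := by
  have hr0 : 0 ≤ r := (norm_nonneg _).trans ha
  refine norm_le_of_coords (by positivity) (fun w => ?_) (fun w => ?_)
  · have := cexp_taylor (a := (a.1 w : ℂ)) (v := (v.1 w : ℂ)) hr
      (by rw [Complex.norm_real]; exact (coord1_le a w).trans ha)
      (by rw [← Complex.ofReal_add, Complex.norm_real]; exact (coord1_le (a+v) w).trans hav)
    rw [← Complex.ofReal_add, ← Complex.ofReal_exp, ← Complex.ofReal_exp, ← Complex.ofReal_sub, ← Complex.ofReal_sub,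
      Complex.norm_real, Complex.norm_real] at this
    refine this.trans ?_
    gcongr
    exact coord1_le v w
  · refine (cexp_taylor (a := a.2 w) (v := v.2 w) hr ((coord2_le a w).trans ha) ((coord2_le (a+v) w).trans hav)).trans ?_
    gcongr
    exact coord2_le v w

/-- phase family -/
def Phi (ξ w e : VV R C) (s : ℝ) : ℂ := (pair ξ (w * vexp (s • e)) : ℝ)

lemma hasDerivAt_vexp_line (e : VV R C) (s : ℝ) :
    HasDerivAt (fun s : ℝ => vexp (s • e)) (e * vexp (s • e)) s := by
  unfold vexp
  refine HasDerivAt.prodMk ?_ ?_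
  · rw [hasDerivAt_pi]
    intro w
    have := ((hasDerivAt_id s).mul_const (e.1 w)).exp
    simpa [mul_comm] using this
  · rw [hasDerivAt_pi]
    intro w
    have h : HasDerivAt (fun s : ℝ => ((s : ℂ) * e.2 w)) (1 * e.2 w) s :=
      (Complex.ofRealCLM.hasDerivAt).mul_const (e.2 w)
    have := h.cexp
    simpa [mul_comm] using this

lemma hasDerivAt_Phi (ξ w e : VV R C) (s : ℝ) : HasDerivAt (Phi ξ w e) (Phi ξ (e * w) e s) s := by
  unfold Phi
  have h1 := ((pairL (ξ * w)).toContinuousLinearMap.hasFDerivAt.comp_hasDerivAt s (hasDerivAt_vexp_line e s))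
  have h2 := h1.ofReal_comp
  have e1 : (fun s : ℝ => ((pair ξ (w * vexp (s • e)) : ℝ) : ℂ)) =
    fun s : ℝ => ((((pairL (ξ * w)).toContinuousLinearMap ∘ fun s : ℝ => vexp (s • e)) s : ℝ) : ℂ) := by
    funext s
    rw [pair_mul]; rfl
  rw [e1]
  refine h2.congr_deriv ?_
  rw [show e * w * vexp (s • e) = w * (e * vexp (s • e)) by ring, pair_mul]
  rfl

lemma deriv_Phi (ξ w e : VV R C) : deriv (Phi ξ w e) = Phi ξ (e * w) e :=
  funext fun s => (hasDerivAt_Phi ξ w e s).deriv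

lemma iteratedDeriv_Phi (ξ w e : VV R C) (k : ℕ) : iteratedDeriv k (Phi ξ w e) = Phi ξ (e ^ k * w) e := by
  induction k generalizing w with
  | zero => simp
  | succ k ih => rw [iteratedDeriv_succ', deriv_Phi, ih, pow_succ, mul_assoc]

lemma contDiff_Phi (ξ w e : VV R C) : ContDiff ℝ ∞ (Phi ξ w e) := by
  rw [contDiff_iff_iteratedDeriv]
  constructor
  · intro m _
    rw [iteratedDeriv_Phi]
    exact continuous_iff_continuousAt.2 fun s => (hasDerivAt_Phi ξ _ e s).continuousAt
  · intro m _
    rw [iteratedDeriv_Phi]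
    exact fun s => (hasDerivAt_Phi ξ _ e s).differentiableAt

lemma norm_Phi_le (ξ w e : VV R C) {s : ℝ} (hs : |s| ≤ 1) (he : ‖e‖ ≤ 1) (hξ : ‖ξ‖ ≤ 1) :
    ‖Phi ξ w e s‖ ≤ dimV R C * (‖w‖ * Real.exp 1) := by
  unfold Phi
  rw [Complex.norm_real]
  refine (abs_pair_le _ _).trans ?_
  refine mul_le_mul_of_nonneg_left ?_ (by positivity)
  calc ‖ξ‖ * ‖w * vexp (s • e)‖ ≤ 1 * (‖w‖ * Real.exp 1) := by
        gcongr
        refine (norm_mul_le _ _).trans ?_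
        gcongr
        refine (norm_vexp_le _).trans ?_
        rw [Real.exp_le_exp, norm_smul, Real.norm_eq_abs]
        nlinarith [norm_nonneg e, abs_nonneg s]
    _ = _ := one_mul _

lemma UB_Phi {ι : Type*} (ξ w e : ι → VV R C) (B : ℝ) (hξ : ∀ i, ‖ξ i‖ ≤ 1) (he : ∀ i, ‖e i‖ ≤ 1)
    (hw : ∀ i, ‖w i‖ ≤ B) : UB (fun i => Phi (ξ i) (w i) (e i)) := by
  refine ⟨fun i => (contDiff_Phi _ _ _).contDiffOn, fun k => ⟨dimV R C * (B * Real.exp 1), fun i s hs => ?_⟩⟩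
  rw [iteratedDeriv_Phi]
  refine (norm_Phi_le _ _ _ (abs_le.2 ⟨hs.1.le, hs.2.le⟩) (he i) (hξ i)).trans ?_
  gcongr
  refine (norm_mul_le _ _).trans ?_
  have h1 : ‖e i ^ k‖ ≤ 1 := by
    refine norm_le_of_coords zero_le_one (fun w => ?_) (fun w => ?_)
    · simp only [Prod.pow_fst, Pi.pow_apply, abs_pow]
      exact pow_le_one₀ (abs_nonneg _) ((coord1_le _ w).trans (he i))
    · simp only [Prod.pow_snd, Pi.pow_apply, norm_pow]
      exact pow_le_one₀ (norm_nonneg _) ((coord2_le _ w).trans (he i))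
  nlinarith [norm_nonneg (w i), hw i, norm_nonneg (e i ^ k)]

lemma line_bound {W : Type} [NormedAddCommGroup W] [NormedSpace ℝ W] (k : ℕ) :
    ∀ {F : Type} [NormedAddCommGroup F] [NormedSpace ℝ F] (a : W → F) (_ : ContDiff ℝ ∞ a)
    (_ : HasCompactSupport a), ∃ C : ℝ, ∀ p e : W, ‖e‖ ≤ 1 → ∀ s : ℝ,
    ‖iteratedDeriv k (fun s : ℝ => a (p + s • e)) s‖ ≤ C := by
  induction k with
  | zero =>
    intro F _ _ a ha hc
    obtain ⟨C, hC⟩ := hc.exists_bound_of_continuous ha.continuous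
    exact ⟨C, fun p e _ s => by simpa using hC _⟩
  | succ k ih =>
    intro F _ _ a ha hc
    have ha' : ContDiff ℝ ∞ (fderiv ℝ a) := ha.fderiv_right (by simp)
    obtain ⟨C, hC⟩ := ih (fderiv ℝ a) ha' (hc.fderiv ℝ)
    refine ⟨C, fun p e he s => ?_⟩
    have hline : ∀ s : ℝ, HasDerivAt (fun s : ℝ => p + s • e) e s := fun s => by
      simpa using ((hasDerivAt_id s).smul_const e).const_add p
    have h1 : deriv (fun s : ℝ => a (p + s • e)) = fun s => (fderiv ℝ a (p + s • e)) e := by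
      funext s
      exact (((ha.differentiable (by simp)) _).hasFDerivAt.comp_hasDerivAt s (hline s)).deriv
    rw [iteratedDeriv_succ', h1]
    have hcd : ContDiff ℝ ∞ (fun s : ℝ => fderiv ℝ a (p + s • e)) := by fun_prop
    have h2 : iteratedDeriv k (fun s : ℝ => (fderiv ℝ a (p + s • e)) e) s
        = (iteratedDeriv k (fun s : ℝ => fderiv ℝ a (p + s • e)) s) e := by
      simp only [iteratedDeriv]
      have := (ContinuousLinearMap.apply ℝ F e).iteratedFDeriv_comp_left (i := k) (x := s) (n := ∞)
        (hcd.contDiffAt) (by exact_mod_cast le_top)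
      have h3 := congrArg (fun f => f (fun _ => (1:ℝ))) this
      simpa [Function.comp_def] using h3
    rw [h2]
    refine (ContinuousLinearMap.le_opNorm _ _).trans ?_
    have := hC p e he s
    nlinarith [norm_nonneg e, norm_nonneg (iteratedDeriv k (fun s : ℝ => fderiv ℝ a (p + s • e)) s)]

lemma UB_line {ι : Type*} {W : Type} [NormedAddCommGroup W] [NormedSpace ℝ W] {a : W → ℂ} (ha : ContDiff ℝ ∞ a)
    (hc : HasCompactSupport a) (p e : ι → W) (he : ∀ i, ‖e i‖ ≤ 1) : UB (fun i s => a (p i + s • e i)) := by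
  refine ⟨fun i => ?_, fun k => ?_⟩
  · have : ContDiff ℝ ∞ (fun s : ℝ => a (p i + s • e i)) := by fun_prop
    exact this.contDiffOn
  · obtain ⟨C, hC⟩ := line_bound k a ha hc
    exact ⟨C, fun i s _ => hC _ _ (he i) s⟩

end Landau

namespace Landau
open scoped ContDiff
open MeasureTheory

lemma exists_kappa : ∃ k : ℝ → ℂ, ContDiff ℝ ∞ k ∧ HasCompactSupport k ∧ (∀ s, s ∉ Set.Icc (-1/2 : ℝ) (1/2) → k s = 0) ∧
    ∫ s, k s = 1 := by
  let f : ContDiffBump (0:ℝ) := ⟨1/4, 1/2, by norm_num, by norm_num⟩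
  have hsupp : ∀ s, s ∉ Set.Icc (-1/2 : ℝ) (1/2) → f.normed volume s = 0 := by
    intro s hs
    by_contra h
    have : s ∈ Function.support (f.normed volume) := h
    rw [f.support_normed_eq] at this
    apply hs
    rw [Real.ball_eq_Ioo] at this
    obtain ⟨h1, h2⟩ := this
    simp only [f] at h1 h2
    constructor <;> linarith
  refine ⟨fun s => ((f.normed volume s : ℝ) : ℂ), Complex.ofRealCLM.contDiff.comp f.contDiff_normed, ?_, ?_, ?_⟩
  · exact HasCompactSupport.intro (isCompact_Icc (a := (-1/2:ℝ)) (b := 1/2)) (fun s hs => by simp [hsupp s hs])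
  · intro s hs
    simp [hsupp s hs]
  · rw [integral_complex_ofReal, f.integral_normed]; simp

lemma averaging {W : Type} [NormedAddCommGroup W] [NormedSpace ℝ W] [FiniteDimensional ℝ W] [MeasurableSpace W]
    [BorelSpace W] (μ : Measure W) [μ.IsAddHaarMeasure] {k : ℝ → ℂ} (hk : Continuous k)
    (hks : ∀ s, s ∉ Set.Icc (-1/2 : ℝ) (1/2) → k s = 0) (hk1 : ∫ s, k s = 1) {F : W → ℂ} (hF : Continuous F)
    {ρ : ℝ} (hFs : ∀ p, ρ < ‖p‖ → F p = 0) (e : W) :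
    ∫ p, F p ∂μ = ∫ q, (∫ s in (-3/4:ℝ)..(3/4), k s * F (q + s • e)) ∂μ := by
  have hin : ∀ q, (∫ s in (-3/4:ℝ)..(3/4), k s * F (q + s • e)) = ∫ s, k s * F (q + s • e) := by
    intro q
    refine intervalIntegral.integral_eq_integral_of_support_subset ?_
    intro s hs
    by_contra h
    apply hs
    have : k s = 0 := hks s (fun h' => h ⟨by linarith [h'.1], by linarith [h'.2]⟩)
    simp [this]
  simp_rw [hin]
  rw [integral_integral_swap_of_hasCompactSupport]
  · have : ∀ s : ℝ, ∫ q, k s * F (q + s • e) ∂μ = k s * ∫ p, F p ∂μ := by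
      intro s
      rw [integral_const_mul, integral_add_right_eq_self (fun q => F q)]
    simp_rw [this]
    rw [integral_mul_const, hk1, one_mul]
  · simp only [Function.uncurry_def]; fun_prop
  · refine HasCompactSupport.intro ((isCompact_closedBall (0:W) (ρ + ‖e‖)).prod (isCompact_Icc (a := (-1/2:ℝ)) (b := 1/2))) ?_
    rintro ⟨q, s⟩ hqs
    simp only [Function.uncurry]
    by_cases hs : s ∈ Set.Icc (-1/2 : ℝ) (1/2)
    · have hq : ¬ ‖q‖ ≤ ρ + ‖e‖ := fun h => hqs ⟨by simpa using h, hs⟩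
      rw [hFs, mul_zero]
      push Not at hq
      have h1 : ‖q‖ ≤ ‖q + s • e‖ + ‖s • e‖ := by
        have := norm_sub_le (q + s • e) (s • e)
        simpa using this
      rw [norm_smul, Real.norm_eq_abs] at h1
      have : |s| ≤ 1 := abs_le.2 ⟨by linarith [hs.1], by linarith [hs.2]⟩
      nlinarith [norm_nonneg e]
    · rw [hks s hs, zero_mul]

/-- bound of integral from averaged bound -/
lemma averaging_bound {W : Type} [NormedAddCommGroup W] [NormedSpace ℝ W] [FiniteDimensional ℝ W] [MeasurableSpace W]
    [BorelSpace W] (μ : Measure W) [μ.IsAddHaarMeasure] {k : ℝ → ℂ} (hk : Continuous k)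
    (hks : ∀ s, s ∉ Set.Icc (-1/2 : ℝ) (1/2) → k s = 0) (hk1 : ∫ s, k s = 1) {F : W → ℂ} (hF : Continuous F)
    {ρ : ℝ} (hFs : ∀ p, ρ < ‖p‖ → F p = 0) (e : W) (he : ‖e‖ ≤ ρ) {B : ℝ} 
    (hB : ∀ q, ‖q‖ ≤ 2 * ρ → ‖∫ s in (-3/4:ℝ)..(3/4), k s * F (q + s • e)‖ ≤ B) :
    ‖∫ p, F p ∂μ‖ ≤ B * μ.real (Metric.closedBall 0 (2 * ρ)) := by
  rw [averaging μ hk hks hk1 hF hFs e]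
  have hz : ∀ q, q ∉ Metric.closedBall (0:W) (2*ρ) → (∫ s in (-3/4:ℝ)..(3/4), k s * F (q + s • e)) = 0 := by
    intro q hq
    have hq' : 2 * ρ < ‖q‖ := by simpa using hq
    rw [intervalIntegral.integral_zero_ae]
    refine ae_of_all _ fun s _ => ?_
    by_cases hs : s ∈ Set.Icc (-1/2 : ℝ) (1/2)
    · rw [hFs, mul_zero]
      have h1 : ‖q‖ ≤ ‖q + s • e‖ + ‖s • e‖ := by
        have := norm_sub_le (q + s • e) (s • e)
        simpa using this
      rw [norm_smul, Real.norm_eq_abs] at h1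
      have : |s| ≤ 1 := abs_le.2 ⟨by linarith [hs.1], by linarith [hs.2]⟩
      nlinarith [norm_nonneg e]
    · rw [hks s hs, zero_mul]
  rw [← setIntegral_eq_integral_of_forall_compl_eq_zero hz]
  exact norm_setIntegral_le_of_norm_le_const (isCompact_closedBall _ _).measure_lt_top (fun q hq => hB q (by simpa using hq))

end Landau

namespace Landau
open scoped ContDiff
open MeasureTheory

variable {R C : Type} [Fintype R] [Fintype C]

def dV : VV R C := (fun _ => 1, fun _ => 2)

def trL : VV R C →ₗ[ℝ] ℝ := pairL dV

lemma trL_apply (z : VV R C) : trL z = ∑ w, z.1 w + 2 * ∑ w, (z.2 w).re := by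
  show pair dV z = _
  simp [pair, dV, Finset.mul_sum]

def EE (R C : Type) [Fintype R] [Fintype C] : Submodule ℝ (VV R C) := LinearMap.ker trL

lemma mem_EE {z : VV R C} : z ∈ EE R C ↔ pair dV z = 0 := Iff.rfl

lemma pair_dV_one : pair (dV : VV R C) 1 = dimV R C := by
  simp [pair, dV, dimV, mul_comm]

def vconj (z : VV R C) : VV R C := (z.1, fun w => (starRingEnd ℂ) (z.2 w))

lemma norm_vconj (z : VV R C) : ‖vconj z‖ = ‖z‖ := by
  simp [vconj, Prod.norm_def, Pi.norm_def]

lemma vconj_mem_EE {z : VV R C} (hz : z ∈ EE R C) : vconj z ∈ EE R C := by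
  rw [mem_EE] at *
  rw [← hz]
  simp [pair, vconj, dV]

lemma norm_sq_le_sum (z : VV R C) : ‖z‖ ^ 2 ≤ ∑ w, z.1 w ^ 2 + ∑ w, ‖z.2 w‖ ^ 2 := by
  have h0 : 0 ≤ ∑ w, z.1 w ^ 2 + ∑ w, ‖z.2 w‖ ^ 2 := by positivity
  rw [← Real.sqrt_le_sqrt_iff (by positivity), Real.sqrt_sq (norm_nonneg _)]
  refine norm_le_of_coords (Real.sqrt_nonneg _) (fun w => ?_) (fun w => ?_)
  · apply Real.abs_le_sqrt
    have := Finset.single_le_sum (f := fun w => z.1 w ^ 2) (fun i _ => sq_nonneg _) (Finset.mem_univ w)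
    have h2 : 0 ≤ ∑ w, ‖z.2 w‖ ^ 2 := by positivity
    linarith
  · apply Real.le_sqrt_of_sq_le
    have := Finset.single_le_sum (f := fun w => ‖z.2 w‖ ^ 2) (fun i _ => sq_nonneg _) (Finset.mem_univ w)
    have h2 : 0 ≤ ∑ w, z.1 w ^ 2 := by positivity
    linarith

lemma pair_dV_conj (v : VV R C) : ‖v‖ ^ 2 ≤ pair dV (vconj v * v) := by
  refine (norm_sq_le_sum v).trans ?_
  simp only [pair, dV, vconj, Prod.fst_mul, Prod.snd_mul, Pi.mul_apply, one_mul]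
  gcongr with w _ w _
  · exact (sq _).le
  · rw [← Complex.normSq_eq_conj_mul_self, ← Complex.normSq_eq_norm_sq]
    have : ((2:ℂ) * (Complex.normSq (v.2 w) : ℝ)).re = 2 * Complex.normSq (v.2 w) := by simp
    rw [this]
    have := Complex.normSq_nonneg (v.2 w)
    linarith

/-- normal component -/
def ccc (ξ : VV R C) : ℝ := pair ξ 1 / dimV R C
def zet (ξ : VV R C) : VV R C := ξ - ccc ξ • dV
def eps (R C : Type) [Fintype R] [Fintype C] : ℝ := 1 / (16 * dimV R C)

def e0 (ζ : VV R C) : VV R C := (ζ.1, fun w => (starRingEnd ℂ) (ζ.2 w) / 2)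

lemma norm_e0 (ζ : VV R C) : ‖e0 ζ‖ ≤ ‖ζ‖ := by
  refine norm_le_of_coords (norm_nonneg _) (fun w => coord1_le ζ w) (fun w => ?_)
  simp only [e0, norm_div, RCLike.norm_conj, RCLike.norm_ofNat]
  have := coord2_le ζ w
  have := norm_nonneg (ζ.2 w)
  linarith

lemma pair_zet_one (hn : dimV R C ≠ 0) (ξ : VV R C) : pair (zet ξ) 1 = 0 := by
  rw [pair_comm, zet, pair_sub, pair_smul, pair_comm 1 dV, pair_dV_one, ccc, pair_comm]
  have : (dimV R C : ℝ) ≠ 0 := by exact_mod_cast hn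
  field_simp
  simp

lemma e0_mem (hn : dimV R C ≠ 0) (ξ : VV R C) : e0 (zet ξ) ∈ EE R C := by
  rw [mem_EE, ← pair_zet_one hn ξ]
  simp only [pair, dV, e0]
  congr 1
  · simp
  · refine Finset.sum_congr rfl fun w _ => ?_
    rw [mul_div_cancel₀ _ (two_ne_zero)]
    simp

lemma pair_e0 (hn : dimV R C ≠ 0) (ξ : VV R C) : ‖zet ξ‖ ^ 2 / 2 ≤ pair ξ (e0 (zet ξ)) := by
  have h : ξ = zet ξ + ccc ξ • dV := by simp [zet]
  have h2 : pair ξ (e0 (zet ξ)) = pair (zet ξ) (e0 (zet ξ)) := by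
    have h5 := add_pair (e0 (zet ξ)) (zet ξ) (ccc ξ • dV)
    rw [← h] at h5
    rw [h5, smul_pair, mem_EE.1 (e0_mem hn ξ), mul_zero, add_zero]
  rw [h2]
  have h3 := norm_sq_le_sum (zet ξ)
  have h4 : (∑ w, (zet ξ).1 w ^ 2 + ∑ w, ‖(zet ξ).2 w‖ ^ 2) / 2 ≤ pair (zet ξ) (e0 (zet ξ)) := by
    simp only [pair, e0, add_div, Finset.sum_div]
    gcongr with w _ w _
    · nlinarith [sq_nonneg ((zet ξ).1 w)]
    · rw [← mul_div_assoc, Complex.mul_conj, Complex.normSq_eq_norm_sq]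
      have : (((‖(zet ξ).2 w‖ ^ 2 : ℝ) : ℂ) / 2).re = ‖(zet ξ).2 w‖ ^ 2 / 2 := by
        rw [show (2:ℂ) = ((2:ℝ):ℂ) by norm_num, ← Complex.ofReal_div, Complex.ofReal_re]
      rw [this]
  linarith

lemma vexp_sub_one {p : VV R C} {ρ : ℝ} (hρ : ρ ≤ 1/100) (hp : ‖p‖ ≤ 6 * ρ) : ‖vexp p - 1‖ ≤ 8 * ρ := by
  have h := vexp_taylor (a := (0 : VV R C)) (v := p) (r := 6 * ρ) (by linarith) (by simp; linarith [norm_nonneg p]) (by simpa using hp)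
  rw [zero_add, vexp_zero] at h
  have h2 : ‖vexp p - 1‖ ≤ ‖vexp p - 1 - p‖ + ‖p‖ := by
    have := norm_add_le (vexp p - 1 - p) p
    simpa using this
  have := norm_nonneg p
  nlinarith

lemma abs_ccc {ξ : VV R C} (hξ : ‖ξ‖ = 1) (hz : ‖zet ξ‖ < eps R C) (hn : 1 ≤ dimV R C) : 15/32 ≤ |ccc ξ| := by
  have h : ξ = zet ξ + ccc ξ • dV := by simp [zet]
  have h1 : ‖ξ‖ ≤ ‖zet ξ‖ + ‖ccc ξ • (dV : VV R C)‖ := by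
    conv_lhs => rw [h]
    exact norm_add_le _ _
  have h2 : ‖(dV : VV R C)‖ ≤ 2 := norm_le_of_coords (by norm_num) (by simp [dV]) (by simp [dV])
  rw [hξ, norm_smul, Real.norm_eq_abs] at h1
  have h3 : eps R C ≤ 1/16 := by
    unfold eps
    have : (1:ℝ) ≤ dimV R C := by exact_mod_cast hn
    gcongr
    linarith
  have := abs_nonneg (ccc ξ)
  nlinarith

lemma phi_lower {ξ : VV R C} (hξ : ‖ξ‖ = 1) (hz : ‖zet ξ‖ < eps R C) (hn : 1 ≤ dimV R C) {ρ : ℝ} (hρ : ρ ≤ 1/100)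
    {p : VV R C} (hp : ‖p‖ ≤ 6 * ρ) : 1/4 ≤ |pair ξ (vexp p)| := by
  have h1 := abs_ccc hξ hz hn
  have hn' : (1:ℝ) ≤ dimV R C := by exact_mod_cast hn
  have e : pair ξ (vexp p) = dimV R C * ccc ξ + pair ξ (vexp p - 1) := by
    rw [pair_sub, ccc]; field_simp; ring
  have h2 := abs_pair_le ξ (vexp p - 1)
  rw [hξ, one_mul] at h2
  have h3 := vexp_sub_one hρ hp
  have h4 : |(dimV R C : ℝ) * ccc ξ| ≤ |pair ξ (vexp p)| + |pair ξ (vexp p - 1)| := by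
    have := abs_sub (pair ξ (vexp p)) (pair ξ (vexp p - 1))
    rwa [e, add_sub_cancel_right, ← e] at this
  rw [abs_mul, abs_of_pos (by linarith : (0:ℝ) < dimV R C)] at h4
  nlinarith

/-- nonnormal derivative lower bound -/
lemma deriv_nonnormal {ξ : VV R C} (hξ : ‖ξ‖ = 1) (hz : eps R C ≤ ‖zet ξ‖) (hn : 1 ≤ dimV R C) {ρ : ℝ} (hρ0 : 0 < ρ)
    (hρ : 1000 * (dimV R C : ℝ) ^ 2 * ρ ≤ 1)
    {p : VV R C} (hp : ‖p‖ ≤ 6 * ρ) : 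
    ρ * eps R C / 4 ≤ |pair ξ (((ρ / ‖zet ξ‖) • e0 (zet ξ)) * vexp p)| := by
  have hn' : (1:ℝ) ≤ dimV R C := by exact_mod_cast hn
  have heps : 0 < eps R C := by unfold eps; positivity
  have hzp : 0 < ‖zet ξ‖ := heps.trans_le hz
  set e := (ρ / ‖zet ξ‖) • e0 (zet ξ) with he
  have hne : ‖e‖ ≤ ρ := by
    rw [he, norm_smul, Real.norm_of_nonneg (by positivity)]
    calc ρ / ‖zet ξ‖ * ‖e0 (zet ξ)‖ ≤ ρ / ‖zet ξ‖ * ‖zet ξ‖ := by gcongr; exact norm_e0 _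
      _ = ρ := by field_simp
  have h1 : ρ * eps R C / 2 ≤ pair ξ e := by
    rw [he, pair_smul]
    have := pair_e0 (by omega) ξ
    calc ρ * eps R C / 2 ≤ ρ * ‖zet ξ‖ / 2 := by gcongr
      _ = ρ / ‖zet ξ‖ * (‖zet ξ‖^2 / 2) := by field_simp
      _ ≤ _ := by gcongr
  have hρ1 : ρ ≤ 1/100 := by nlinarith
  have h3 := vexp_sub_one hρ1 hp
  have h2 := abs_pair_le ξ (e * (vexp p - 1))
  rw [hξ, one_mul] at h2
  have h5 : ‖e * (vexp p - 1)‖ ≤ ρ * (8 * ρ) := (norm_mul_le _ _).trans (by gcongr)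
  have h6 : pair ξ (e * vexp p) = pair ξ e + pair ξ (e * (vexp p - 1)) := by
    rw [← pair_add]; ring_nf
  have h7 : (dimV R C : ℝ) * ‖e * (vexp p - 1)‖ ≤ dimV R C * (ρ * (8 * ρ)) := by gcongr
  have h8 : (dimV R C : ℝ) * (ρ * (8 * ρ)) ≤ ρ * eps R C / 4 := by
    unfold eps
    rw [mul_one_div, div_div, le_div_iff₀ (by positivity)]
    nlinarith
  rw [h6]
  have := neg_abs_le (pair ξ (e * (vexp p - 1)))
  exact le_trans (by linarith) (le_abs_self _)

/-- normal derivative lower bound -/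
lemma deriv_normal {ξ : VV R C} (hξ : ‖ξ‖ = 1) (hz : ‖zet ξ‖ < eps R C) (hn : 1 ≤ dimV R C) {ρ : ℝ} (hρ0 : 0 < ρ)
    (hρ : 1000 * (dimV R C : ℝ) ^ 2 * ρ ≤ 1) {p q v : VV R C} (hv : v ≠ 0)
    (hp : ‖p‖ ≤ 6 * ρ) (hq : ‖q‖ ≤ 6 * ρ) (hqv : ‖q + v‖ ≤ 6 * ρ) :
    ρ / 4 ≤ |pair ξ (((ρ / ‖v‖) • vconj v) * ((1 / ‖v‖) • (vexp (q + v) - vexp q)) * vexp p)| := by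
  have hn' : (1:ℝ) ≤ dimV R C := by exact_mod_cast hn
  have hvp : 0 < ‖v‖ := norm_pos_iff.2 hv
  set e := (ρ / ‖v‖) • vconj v with he
  have hne : ‖e‖ ≤ ρ := by
    rw [he, norm_smul, Real.norm_of_nonneg (by positivity), norm_vconj]
    field_simp; rfl
  have hρ1 : ρ ≤ 1/100 := by nlinarith
  have h3 := vexp_sub_one hρ1 hp
  have h4 := vexp_taylor (r := 6 * ρ) (by linarith) hq hqv
  set D := (1 / ‖v‖) • (vexp (q + v) - vexp q - v) with hD
  have hDn : ‖D‖ ≤ 12 * ρ := by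
    rw [hD, norm_smul, Real.norm_of_nonneg (by positivity)]
    calc 1 / ‖v‖ * ‖vexp (q + v) - vexp q - v‖ ≤ 1 / ‖v‖ * (2 * (6 * ρ) * ‖v‖) := by gcongr
      _ = 12 * ρ := by field_simp; ring
  set u := (1 / ‖v‖) • v with hu
  have hun : ‖u‖ ≤ 1 := by
    rw [hu, norm_smul, Real.norm_of_nonneg (by positivity)]
    field_simp; rfl
  have e1 : (1 / ‖v‖) • (vexp (q + v) - vexp q) = u + D := by
    rw [hu, hD, ← smul_add]; congr 1; abel
  have e2 : e * (u + D) * vexp p = e * u + (e * (u + D) * (vexp p - 1) + e * D) := by ring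
  have h5 : ‖e * (u + D) * (vexp p - 1) + e * D‖ ≤ ρ * (1 + 12 * ρ) * (8 * ρ) + ρ * (12 * ρ) := by
    refine (norm_add_le _ _).trans (add_le_add ?_ ?_)
    · refine (norm_mul_le _ _).trans ?_
      gcongr
      refine (norm_mul_le _ _).trans ?_
      gcongr
      exact (norm_add_le _ _).trans (by linarith)
    · exact (norm_mul_le _ _).trans (by gcongr)
  have h6 := abs_pair_le ξ (e * (u + D) * (vexp p - 1) + e * D)
  rw [hξ, one_mul] at h6
  have h7 : (dimV R C : ℝ) * ‖e * (u + D) * (vexp p - 1) + e * D‖ ≤ ρ / 16 := by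
    calc _ ≤ (dimV R C : ℝ) * (ρ * (1 + 12 * ρ) * (8 * ρ) + ρ * (12 * ρ)) := by gcongr
      _ ≤ (dimV R C : ℝ) * (ρ * (1 + 1) * (8 * ρ) + ρ * (12 * ρ)) := by gcongr; linarith
      _ ≤ _ := by nlinarith
  have h8 : ρ * |ccc ξ| ≤ |ccc ξ * pair dV (e * u)| := by
    rw [abs_mul, mul_comm]
    gcongr
    have : e * u = (ρ / ‖v‖ ^ 2) • (vconj v * v) := by
      rw [he, hu, smul_mul_smul_comm]; congr 1; field_simp
    rw [this, pair_smul]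
    have := pair_dV_conj v
    refine le_trans ?_ (le_abs_self _)
    calc ρ = ρ / ‖v‖^2 * ‖v‖^2 := by field_simp
      _ ≤ _ := by gcongr
  have h9 := abs_pair_le (zet ξ) (e * u)
  have h10 : (dimV R C : ℝ) * (‖zet ξ‖ * ‖e * u‖) ≤ ρ / 16 := by
    have : ‖e * u‖ ≤ ρ := (norm_mul_le _ _).trans (by nlinarith [norm_nonneg u, norm_nonneg e])
    calc (dimV R C : ℝ) * (‖zet ξ‖ * ‖e * u‖) ≤ dimV R C * (eps R C * ρ) := by
          have : 0 ≤ eps R C := by unfold eps; positivity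
          gcongr
      _ = ρ / 16 := by unfold eps; field_simp
  have e3 : pair ξ (e * u) = pair (zet ξ) (e * u) + ccc ξ * pair dV (e * u) := by
    have h : ξ = zet ξ + ccc ξ • dV := by simp [zet]
    conv_lhs => rw [h]
    rw [add_pair, smul_pair]
  have h11 := abs_ccc hξ hz hn
  rw [e1, e2, pair_add, e3]
  set A := ccc ξ * pair dV (e * u)
  set B := pair (zet ξ) (e * u)
  set G := pair ξ (e * (u + D) * (vexp p - 1) + e * D)
  have h12 : |A| ≤ |B + A + G| + |B| + |G| := by
    have e4 : A = (B + A + G) - B - G := by ring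
    calc |A| = |(B + A + G) - B - G| := by rw [← e4]
      _ ≤ |(B + A + G) - B| + |G| := abs_sub _ _
      _ ≤ _ := by gcongr; exact abs_sub _ _
  nlinarith

end Landau

namespace Landau
open scoped ContDiff
open MeasureTheory

variable {R C : Type} [Fintype R] [Fintype C]

lemma continuous_pair (ξ : VV R C) : Continuous (fun y => pair ξ y) := by
  unfold pair; fun_prop

lemma hcs_of_norm {W F : Type} [NormedAddCommGroup W] [ProperSpace W] [Zero F] {a : W → F} {ρ : ℝ}
    (has : ∀ p, ρ < ‖p‖ → a p = 0) : HasCompactSupport a :=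
  HasCompactSupport.intro (isCompact_closedBall 0 ρ) (fun p hp => has p (by simpa using hp))

lemma Phi_eq (ξ w e q : VV R C) (s : ℝ) : Phi ξ (w * vexp q) e s = (pair ξ (w * vexp (q + s • e)) : ℝ) := by
  rw [vexp_add, ← mul_assoc]; rfl

lemma Phi_eq' (ξ e q : VV R C) (s : ℝ) : Phi ξ (vexp q) e s = (pair ξ (vexp (q + s • e)) : ℝ) := by
  rw [vexp_add]; rfl

lemma UB_k {ι : Type*} {k : ℝ → ℂ} (hk : ContDiff ℝ ∞ k) (hkc : HasCompactSupport k) : UB (fun (_ : ι) s => k s) := by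
  have := UB_line (ι := ι) hk hkc (fun _ => 0) (fun _ => 1) (by simp)
  simpa using this

theorem surf_nonnormal (μ : Measure (EE R C)) [μ.IsAddHaarMeasure] (hn : 1 ≤ dimV R C) {ρ : ℝ} (hρ0 : 0 < ρ)
    (hρ : 1000 * (dimV R C : ℝ) ^ 2 * ρ ≤ 1) {a : VV R C → ℝ} (ha : ContDiff ℝ ∞ a) (has : ∀ p, ρ < ‖p‖ → a p = 0)
    (N : ℕ) : ∃ B : ℝ, 0 ≤ B ∧ ∀ ξ : VV R C, ‖ξ‖ = 1 → eps R C ≤ ‖zet ξ‖ → ∀ t : ℝ, 0 < t →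
      ‖∫ p : EE R C, (a p : ℂ) * Complex.exp (Complex.I * t * (pair ξ (vexp p) : ℝ)) ∂μ‖ ≤ B / t ^ N := by
  obtain ⟨k, hk, hkc, hks, hk1⟩ := exists_kappa
  have hn' : (1:ℝ) ≤ dimV R C := by exact_mod_cast hn
  have hρ1 : ρ ≤ 1/100 := by nlinarith
  have heps : 0 < eps R C := by unfold eps; positivity
  let ι := {i : VV R C × EE R C // ‖i.1‖ = 1 ∧ eps R C ≤ ‖zet i.1‖ ∧ ‖i.2‖ ≤ 2 * ρ}
  let e : VV R C → VV R C := fun ξ => (ρ / ‖zet ξ‖) • e0 (zet ξ)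
  have hem : ∀ ξ, e ξ ∈ EE R C := fun ξ => (EE R C).smul_mem _ (e0_mem (by omega) ξ)
  have hen : ∀ ξ, ‖e ξ‖ ≤ ρ := by
    intro ξ
    simp only [e]
    rw [norm_smul, Real.norm_of_nonneg (by positivity)]
    have h1 := norm_e0 (zet ξ)
    rcases (norm_nonneg (zet ξ)).eq_or_lt with h | h
    · rw [← h]; simp [hρ0.le]
    · rw [div_mul_eq_mul_div, div_le_iff₀ h]; gcongr
  let ac : VV R C → ℂ := fun p => (a p : ℂ)
  have hac : ContDiff ℝ ∞ ac := Complex.ofRealCLM.contDiff.comp ha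
  have hacc : HasCompactSupport ac := hcs_of_norm (ρ := ρ) (fun p hp => by simp [ac, has p hp])
  obtain ⟨B, hB0, hB⟩ := osc1d (ι := ι) (b := fun i s => k s * ac ((i.1.2 : VV R C) + s • e i.1.1))
    (Θ := fun i => Phi i.1.1 (vexp (i.1.2 : VV R C)) (e i.1.1))
    ((UB_k hk hkc).mul (UB_line hac hacc _ _ (fun i => (hen _).trans (by linarith))))
    (UB_Phi _ _ _ (Real.exp 1) (fun i => i.2.1.le) (fun i => (hen _).trans (by linarith)) (fun i => by
      refine (norm_vexp_le _).trans (Real.exp_le_exp.2 ?_)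
      exact i.2.2.2.trans (by linarith))).deriv
    (fun i s _ => (hasDerivAt_Phi _ _ _ _).differentiableAt)
    (fun i s => Complex.ofReal_im _) (fun i s hs => by simp only [hks s hs, zero_mul])
    (c := ρ * eps R C / 4) (by positivity) (fun i s hs => by
      rw [deriv_Phi, Phi_eq, Complex.norm_real]
      refine deriv_nonnormal i.2.1 i.2.2.1 hn hρ0 hρ ?_
      refine (norm_add_le _ _).trans ?_
      rw [norm_smul, Real.norm_eq_abs]
      have h1 := hen i.1.1
      have h2 : |s| ≤ 1 := abs_le.2 ⟨hs.1.le, hs.2.le⟩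
      have h3 : ‖(i.1.2 : VV R C)‖ ≤ 2 * ρ := i.2.2.2
      nlinarith [norm_nonneg (e i.1.1), abs_nonneg s]) N
  refine ⟨B * μ.real (Metric.closedBall 0 (2 * ρ)), by positivity, fun ξ hξ hz t ht => ?_⟩
  have hFc : Continuous (fun p : EE R C => (a p : ℂ) * Complex.exp (Complex.I * t * (pair ξ (vexp p) : ℝ))) := by
    have := hac.continuous
    have h1 := continuous_pair ξ
    have h2 := continuous_vexp (R := R) (C := C)
    have h3 : Continuous (fun p : EE R C => (a p : ℂ)) := this.comp continuous_subtype_val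
    have h4 : Continuous (fun p : EE R C => pair ξ (vexp (p : VV R C))) := h1.comp (h2.comp continuous_subtype_val)
    fun_prop
  have := averaging_bound μ hk.continuous hks hk1 hFc (ρ := ρ) (fun p hp => by
      rw [has p hp]; simp) ⟨e ξ, hem ξ⟩ (hen ξ) (B := B / t ^ N) (fun q hq => ?_)
  · refine this.trans (le_of_eq ?_); ring
  · have := hB ⟨(ξ, q), hξ, hz, hq⟩ t ht
    refine le_trans (le_of_eq ?_) this
    congr 1
    refine intervalIntegral.integral_congr fun s _ => ?_
    simp only [Submodule.coe_add, Submodule.coe_smul, Phi_eq', ac]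
    ring

lemma TT_star {W : Type} [NormedAddCommGroup W] [NormedSpace ℝ W] [FiniteDimensional ℝ W] [MeasurableSpace W]
    [BorelSpace W] (μ : Measure W) [μ.IsAddHaarMeasure] {F : W → ℂ} (hF : Continuous F)
    {ρ : ℝ} (hFs : ∀ p, ρ < ‖p‖ → F p = 0) :
    ‖∫ p, F p ∂μ‖ ^ 2 = ‖∫ v, (∫ q, F (q + v) * (starRingEnd ℂ) (F q) ∂μ) ∂μ‖ := by
  have h1 : ∫ v, (∫ q, F (q + v) * (starRingEnd ℂ) (F q) ∂μ) ∂μ = 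
     ∫ q, (∫ v, F (q + v) * (starRingEnd ℂ) (F q) ∂μ) ∂μ := by
    rw [integral_integral_swap_of_hasCompactSupport]
    · simp only [Function.uncurry_def]
      have : Continuous (starRingEnd ℂ) := Complex.continuous_conj
      fun_prop
    · refine HasCompactSupport.intro ((isCompact_closedBall (0:W) (2*ρ)).prod (isCompact_closedBall (0:W) ρ)) ?_
      rintro ⟨v, q⟩ hvq
      simp only [Function.uncurry]
      by_cases hq : ‖q‖ ≤ ρ
      · have hv : ¬ ‖v‖ ≤ 2 * ρ := fun h => hvq ⟨by simpa using h, by simpa using hq⟩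
        rw [hFs, zero_mul]
        push Not at hv
        have h1 : ‖v‖ ≤ ‖q + v‖ + ‖q‖ := by
          have := norm_sub_le (q + v) q
          simpa using this
        linarith
      · rw [hFs q (not_le.1 hq)]; simp
  have h2 : ∀ q, (∫ v, F (q + v) * (starRingEnd ℂ) (F q) ∂μ) = (∫ p, F p ∂μ) * (starRingEnd ℂ) (F q) := by
    intro q
    rw [integral_mul_const, integral_add_left_eq_self (fun v => F v)]
  rw [h1]
  simp_rw [h2]
  rw [integral_const_mul, integral_conj, norm_mul, RCLike.norm_conj, sq]

lemma finrank_EE (hn : 1 ≤ dimV R C) : Module.finrank ℝ (EE R C) + 1 = dimV R C := by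
  have h := LinearMap.finrank_range_add_finrank_ker (trL (R := R) (C := C))
  have hs : Function.Surjective (trL (R := R) (C := C)) := by
    refine LinearMap.surjective fun h0 => ?_
    have h1 : trL (1 : VV R C) = dimV R C := pair_dV_one
    rw [h0] at h1
    have h2 : (dimV R C : ℝ) = 0 := h1.symm
    have h3 : dimV R C = 0 := by exact_mod_cast h2
    omega
  rw [LinearMap.range_eq_top.2 hs, finrank_top] at h
  have hC : Module.finrank ℝ (C → ℂ) = 2 * Fintype.card C := by
    rw [Module.finrank_pi_fintype]; simp [mul_comm]
  simp [hC] at h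
  unfold EE dimV
  omega

lemma decay_integral (μ : Measure (EE R C)) [μ.IsAddHaarMeasure] (hn : 1 ≤ dimV R C) {t : ℝ} (ht : 0 < t) :
    Integrable (fun v : EE R C => (1 + t * ‖v‖) ^ (-(dimV R C : ℝ))) μ ∧ 
    ∫ v : EE R C, (1 + t * ‖v‖) ^ (-(dimV R C : ℝ)) ∂μ = (∫ v : EE R C, (1 + ‖v‖) ^ (-(dimV R C : ℝ)) ∂μ) / t ^ (dimV R C - 1) := by
  have hf := finrank_EE hn
  have h1 : Integrable (fun v : EE R C => (1 + ‖v‖) ^ (-(dimV R C : ℝ))) μ := by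
    refine integrable_one_add_norm ?_
    exact_mod_cast (by omega)
  have h2 := h1.comp_smul ht.ne'
  have h3 := Measure.integral_comp_smul μ (fun v : EE R C => (1 + ‖v‖) ^ (-(dimV R C : ℝ))) t
  simp only [norm_smul, Real.norm_of_nonneg ht.le] at h2 h3
  refine ⟨h2, ?_⟩
  rw [h3, abs_of_pos (by positivity), smul_eq_mul, show Module.finrank ℝ (EE R C) = dimV R C - 1 by omega]
  field_simp

end Landau

namespace Landau
open scoped ContDiff
open MeasureTheory

variable {R C : Type} [Fintype R] [Fintype C]

/-- surface integrand -/
def FF (a : VV R C → ℝ) (M : ℕ) (ξ : VV R C) (t : ℝ) (p : VV R C) : ℂ :=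
  (a p : ℂ) * ((pair ξ (vexp p) : ℝ) : ℂ)⁻¹ ^ M * Complex.exp (Complex.I * t * (pair ξ (vexp p) : ℝ))

lemma FF_continuous {ξ : VV R C} (hξ : ‖ξ‖ = 1) (hz : ‖zet ξ‖ < eps R C) (hn : 1 ≤ dimV R C) {ρ : ℝ} (hρ0 : 0 < ρ)
    (hρ : ρ ≤ 1/100) {a : VV R C → ℝ} (ha : Continuous a) (has : ∀ p, ρ < ‖p‖ → a p = 0) (M : ℕ) (t : ℝ) :
    Continuous (FF a M ξ t) := by
  rw [continuous_iff_continuousAt]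
  intro p
  have h1 : Continuous (fun p => pair ξ (vexp p)) := (continuous_pair ξ).comp continuous_vexp
  by_cases hp : ‖p‖ < 2 * ρ
  · have h2 := phi_lower hξ hz hn hρ (p := p) (by linarith)
    have hne : ((pair ξ (vexp p) : ℝ) : ℂ) ≠ 0 := by
      intro h0
      have : pair ξ (vexp p) = 0 := by exact_mod_cast h0
      rw [this] at h2; norm_num at h2
    unfold FF
    have h3 : Continuous (fun p => ((pair ξ (vexp p) : ℝ) : ℂ)) := Complex.continuous_ofReal.comp h1
    refine ContinuousAt.mul (ContinuousAt.mul (by fun_prop) ((h3.continuousAt.inv₀ hne).pow M)) ?_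
    exact Continuous.continuousAt (by fun_prop)
  · have : FF a M ξ t =ᶠ[𝓝 p] fun _ => 0 := by
      have ho : IsOpen {p : VV R C | ρ < ‖p‖} := isOpen_lt continuous_const continuous_norm
      filter_upwards [ho.mem_nhds (by show ρ < ‖p‖; linarith)] with x hx
      simp [FF, has x hx]
    exact this.continuousAt

lemma FF_bound {ξ : VV R C} (hξ : ‖ξ‖ = 1) (hz : ‖zet ξ‖ < eps R C) (hn : 1 ≤ dimV R C) {ρ : ℝ} (hρ0 : 0 < ρ)
    (hρ : ρ ≤ 1/100) {a : VV R C → ℝ} {A : ℝ} (hA : ∀ p, ‖a p‖ ≤ A) (has : ∀ p, ρ < ‖p‖ → a p = 0) (M : ℕ) (t : ℝ) (p) :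
    ‖FF a M ξ t p‖ ≤ A * 4 ^ M := by
  have hA0 : 0 ≤ A := (norm_nonneg _).trans (hA 0)
  by_cases hp : ρ < ‖p‖
  · simp [FF, has p hp]; positivity
  · have h2 := phi_lower hξ hz hn hρ (p := p) (by linarith)
    unfold FF
    rw [norm_mul, norm_mul, norm_pow, norm_inv, Complex.norm_real, Complex.norm_real,
      show Complex.I * t * (pair ξ (vexp p) : ℝ) = ((t * pair ξ (vexp p) : ℝ) : ℂ) * Complex.I by push_cast; ring,
      Complex.norm_exp_ofReal_mul_I, mul_one]
    gcongr
    · exact hA p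
    · rw [inv_le_comm₀ (by rw [Real.norm_eq_abs]; linarith) (by norm_num)]
      rw [Real.norm_eq_abs]; linarith

theorem surf_normal (μ : Measure (EE R C)) [μ.IsAddHaarMeasure] (hn : 1 ≤ dimV R C) {ρ : ℝ} (hρ0 : 0 < ρ)
    (hρ : 1000 * (dimV R C : ℝ) ^ 2 * ρ ≤ 1) {a : VV R C → ℝ} (ha : ContDiff ℝ ∞ a) (has : ∀ p, ρ < ‖p‖ → a p = 0)
    (M : ℕ) : ∃ B : ℝ, 0 ≤ B ∧ ∀ ξ : VV R C, ‖ξ‖ = 1 → ‖zet ξ‖ < eps R C → ∀ t : ℝ, 0 < t →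
      ‖∫ p : EE R C, FF a M ξ t p ∂μ‖ ^ 2 ≤ B / t ^ (dimV R C - 1) := by
  obtain ⟨k, hk, hkc, hks, hk1⟩ := exists_kappa
  have hn' : (1:ℝ) ≤ dimV R C := by exact_mod_cast hn
  have hρ1 : ρ ≤ 1/100 := by nlinarith
  have heps : 0 < eps R C := by unfold eps; positivity
  let ι := {i : VV R C × EE R C × EE R C // ‖i.1‖ = 1 ∧ ‖zet i.1‖ < eps R C ∧ i.2.1 ≠ 0 ∧ ‖i.2.1‖ ≤ 2 * ρ ∧ ‖i.2.2‖ ≤ 2 * ρ}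
  let e : VV R C → VV R C := fun v => (ρ / ‖v‖) • vconj v
  have hem : ∀ v, v ∈ EE R C → e v ∈ EE R C := fun v hv => (EE R C).smul_mem _ (vconj_mem_EE hv)
  have hen : ∀ v, ‖e v‖ ≤ ρ := by
    intro v
    simp only [e]
    rw [norm_smul, Real.norm_of_nonneg (by positivity), norm_vconj]
    rcases (norm_nonneg v).eq_or_lt with h | h
    · rw [← h]; simp [hρ0.le]
    · rw [div_mul_cancel₀ _ h.ne']
  let ac : VV R C → ℂ := fun p => (a p : ℂ)
  have hac : ContDiff ℝ ∞ ac := Complex.ofRealCLM.contDiff.comp ha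
  have hacc : HasCompactSupport ac := hcs_of_norm (ρ := ρ) (fun p hp => by simp [ac, has p hp])
  have hse : ∀ v : VV R C, ∀ s ∈ Set.Ioo (-1:ℝ) 1, ‖s • e v‖ ≤ ρ := by
    intro v s hs
    rw [norm_smul, Real.norm_eq_abs]
    have h1 := hen v
    have h2 : |s| ≤ 1 := abs_le.2 ⟨hs.1.le, hs.2.le⟩
    nlinarith [norm_nonneg (e v), abs_nonneg s]
  have hexpb : ∀ q : VV R C, ‖q‖ ≤ 6 * ρ → ‖vexp q‖ ≤ Real.exp 1 := fun q hq => by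
      refine (norm_vexp_le _).trans (Real.exp_le_exp.2 ?_)
      linarith
  have hq2 : ∀ i : ι, ‖(i.1.2.2 : VV R C)‖ ≤ 2 * ρ := fun i => i.2.2.2.2.2
  have hv2 : ∀ i : ι, ‖(i.1.2.1 : VV R C)‖ ≤ 2 * ρ := fun i => i.2.2.2.2.1
  have hvne : ∀ i : ι, (i.1.2.1 : VV R C) ≠ 0 := fun i => by simpa using i.2.2.2.1
  have hqv2 : ∀ i : ι, ‖(i.1.2.2 + i.1.2.1 : VV R C)‖ ≤ 4 * ρ := fun i => (norm_add_le _ _).trans (by linarith [hq2 i, hv2 i])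
  have ub1 : UB (fun (i : ι) s => (Phi i.1.1 (vexp (i.1.2.2 + i.1.2.1 : VV R C)) (e i.1.2.1) s)⁻¹ ^ M) := by
    refine (UB.inv (UB_Phi _ _ _ (Real.exp 1) (fun i => i.2.1.le) (fun i => (hen _).trans (by linarith)) (fun i => hexpb _ (by linarith [hqv2 i])))
      (c := 1/4) (by norm_num) (fun i s hs => ?_)).pow M
    rw [Phi_eq', Complex.norm_real]
    exact phi_lower i.2.1 i.2.2.1 hn hρ1 ((norm_add_le _ _).trans (by linarith [hqv2 i, hse i.1.2.1 s hs]))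
  have ub2 : UB (fun (i : ι) s => (Phi i.1.1 (vexp (i.1.2.2 : VV R C)) (e i.1.2.1) s)⁻¹ ^ M) := by
    refine (UB.inv (UB_Phi _ _ _ (Real.exp 1) (fun i => i.2.1.le) (fun i => (hen _).trans (by linarith)) (fun i => hexpb _ (by linarith [hq2 i])))
      (c := 1/4) (by norm_num) (fun i s hs => ?_)).pow M
    rw [Phi_eq', Complex.norm_real]
    exact phi_lower i.2.1 i.2.2.1 hn hρ1 ((norm_add_le _ _).trans (by linarith [hq2 i, hse i.1.2.1 s hs]))
  have ub3 : UB (fun (i : ι) s => ac ((i.1.2.2 + i.1.2.1 : VV R C) + s • e i.1.2.1)) :=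
    UB_line hac hacc _ _ (fun i => (hen _).trans (by linarith))
  have ub4 : UB (fun (i : ι) s => ac ((i.1.2.2 : VV R C) + s • e i.1.2.1)) :=
    UB_line hac hacc _ _ (fun i => (hen _).trans (by linarith))
  obtain ⟨B, hB0, hB⟩ := osc1d (ι := ι) 
    (Θ := fun i => Phi i.1.1 ((1 / ‖(i.1.2.1 : VV R C)‖) • (vexp (i.1.2.2 + i.1.2.1 : VV R C) - vexp (i.1.2.2 : VV R C))) (e i.1.2.1))
    ((UB_k hk hkc).mul ((ub3.mul ub1).mul (ub4.mul ub2)))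
    (UB_Phi _ _ _ 2 (fun i => i.2.1.le) (fun i => (hen _).trans (by linarith)) (fun i => by
      have h1 := vexp_taylor (r := 6 * ρ) (by linarith) (by linarith [hq2 i]) ((hqv2 i).trans (by linarith))
      have h2 : ‖vexp (i.1.2.2 + i.1.2.1 : VV R C) - vexp (i.1.2.2 : VV R C)‖ ≤ 2 * ‖(i.1.2.1 : VV R C)‖ := by
        have := norm_add_le (vexp (i.1.2.2 + i.1.2.1 : VV R C) - vexp (i.1.2.2 : VV R C) - (i.1.2.1 : VV R C)) (i.1.2.1 : VV R C)
        rw [sub_add_cancel] at this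
        nlinarith [norm_nonneg (i.1.2.1 : VV R C)]
      have h3 : 0 < ‖(i.1.2.1 : VV R C)‖ := norm_pos_iff.2 (hvne i)
      rw [norm_smul, Real.norm_of_nonneg (by positivity)]
      rw [one_div, inv_mul_le_iff₀ h3]
      linarith)).deriv
    (fun i s _ => (hasDerivAt_Phi _ _ _ _).differentiableAt)
    (fun i s => Complex.ofReal_im _) (fun i s hs => by simp only [hks s hs, zero_mul])
    (c := ρ / 4) (by positivity) (fun i s hs => by
      rw [deriv_Phi]
      unfold Phi
      rw [Complex.norm_real]
      exact deriv_normal i.2.1 i.2.2.1 hn hρ0 hρ (hvne i) ((hse _ s hs).trans (by linarith)) ((hq2 i).trans (by linarith)) ((hqv2 i).trans (by linarith))) 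
      (dimV R C)
  obtain ⟨A, hA⟩ := (hcs_of_norm (a := a) (ρ := ρ) has).exists_bound_of_continuous ha.continuous
  have hA0 : 0 ≤ A := (norm_nonneg _).trans (hA 0)
  set V2 := μ.real (Metric.closedBall 0 (2 * ρ)) with hV2
  set V1 := μ.real (Metric.closedBall 0 ρ) with hV1
  set C1 := 2 ^ dimV R C * (B * V2 + (A * 4 ^ M) ^ 2 * V1) with hC1
  have hC10 : 0 ≤ C1 := by positivity
  refine ⟨C1 * ∫ v : EE R C, (1 + ‖v‖) ^ (-(dimV R C : ℝ)) ∂μ, by positivity, fun ξ hξ hz t ht => ?_⟩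
  have hFc : Continuous (fun p : EE R C => FF a M ξ t p) :=
    (FF_continuous hξ hz hn hρ0 hρ1 ha.continuous has M t).comp continuous_subtype_val
  have hFs : ∀ p : EE R C, ρ < ‖p‖ → FF a M ξ t p = 0 := fun p hp => by simp [FF, has p hp]
  rw [TT_star μ hFc hFs]
  obtain ⟨hd1, hd2⟩ := decay_integral μ hn ht
  have hmain : ∀ v : EE R C, ‖∫ q : EE R C, FF a M ξ t ↑(q + v) * (starRingEnd ℂ) (FF a M ξ t q) ∂μ‖ ≤ 
      C1 * (1 + t * ‖v‖) ^ (-(dimV R C : ℝ)) := by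
    intro v
    have htriv : ‖∫ q : EE R C, FF a M ξ t ↑(q + v) * (starRingEnd ℂ) (FF a M ξ t q) ∂μ‖ ≤ (A * 4 ^ M) ^ 2 * V1 := by
      rw [← setIntegral_eq_integral_of_forall_compl_eq_zero (s := Metric.closedBall 0 ρ)]
      · refine norm_setIntegral_le_of_norm_le_const (isCompact_closedBall _ _).measure_lt_top (fun q hq => ?_)
        rw [norm_mul, RCLike.norm_conj, sq]
        gcongr <;> exact FF_bound hξ hz hn hρ0 hρ1 hA has M t _
      · intro q hq
        rw [hFs q (by simpa using hq)]; simp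
    have hpw : (1 + t * ‖v‖) ^ (-(dimV R C : ℝ)) = 1 / (1 + t * ‖v‖) ^ (dimV R C) := by
      rw [Real.rpow_neg (by positivity), Real.rpow_natCast, one_div]
    rw [hpw]
    by_cases hsm : t * ‖v‖ ≤ 1
    · refine htriv.trans ?_
      rw [mul_one_div, le_div_iff₀ (by positivity), hC1, mul_comm]
      gcongr
      · linarith
      · have : 0 ≤ B * V2 := by positivity
        linarith
    · push Not at hsm
      have hvp : 0 < ‖v‖ := by
        by_contra h
        have : ‖v‖ = 0 := le_antisymm (not_lt.1 h) (norm_nonneg _)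
        rw [this] at hsm; norm_num at hsm
      by_cases hv : ‖v‖ ≤ 2 * ρ
      · have hv0 : v ≠ 0 := norm_pos_iff.1 hvp
        have hFv : Continuous (fun q : EE R C => FF a M ξ t ↑(q + v) * (starRingEnd ℂ) (FF a M ξ t q)) := by
          have : Continuous (starRingEnd ℂ) := Complex.continuous_conj
          have h2 : Continuous (fun q : EE R C => FF a M ξ t ↑(q + v)) := hFc.comp (continuous_id.add continuous_const)
          fun_prop
        have h1 := averaging_bound μ hk.continuous hks hk1 hFv (ρ := ρ) (fun p hp => by
          rw [hFs p hp]; simp) ⟨e v, hem v v.2⟩ (hen v) (B := B / (t * ‖v‖) ^ dimV R C) (fun q hq => ?_)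
        · refine h1.trans ?_
          rw [hC1, mul_one_div, div_mul_eq_mul_div, div_le_div_iff₀ (by positivity) (by positivity)]
          have h3 : (1 + t * ‖v‖) ^ dimV R C ≤ 2 ^ dimV R C * (t * ‖v‖) ^ dimV R C := by
            rw [← mul_pow]; gcongr; linarith
          have h4 : 0 ≤ (A * 4 ^ M) ^ 2 * V1 := by positivity
          have h5 : 0 ≤ B * V2 := by positivity
          calc B * V2 * (1 + t * ‖v‖) ^ dimV R C ≤ B * V2 * (2 ^ dimV R C * (t * ‖v‖) ^ dimV R C) := by gcongr
            _ ≤ (B * V2 + (A * 4 ^ M) ^ 2 * V1) * (2 ^ dimV R C * (t * ‖v‖) ^ dimV R C) := by gcongr; linarith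
            _ = _ := by ring
        · have := hB ⟨(ξ, v, q), hξ, hz, hv0, hv, hq⟩ (t * ‖v‖) (by positivity)
          refine le_trans (le_of_eq ?_) this
          congr 1
          refine intervalIntegral.integral_congr fun s _ => ?_
          simp only [Submodule.coe_add, Submodule.coe_smul, Phi_eq', ac, FF, map_mul, map_pow, map_inv₀, Complex.conj_ofReal,
            ← Complex.exp_conj, Complex.conj_I]
          have hvc : ‖(v : VV R C)‖ = ‖v‖ := rfl
          have e1 : Phi ξ ((1 / ‖(v : VV R C)‖) • (vexp (q + v : VV R C) - vexp (q : VV R C))) (e v) s = 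
              ((1 / ‖v‖ * (pair ξ (vexp (q + s • e v + v)) - pair ξ (vexp (q + s • e v))) : ℝ) : ℂ) := by
            unfold Phi
            congr 1
            rw [smul_mul_assoc, pair_smul, sub_mul, ← vexp_add, ← vexp_add, pair_sub, hvc]
            rw [add_right_comm]
          rw [e1]
          have e2 : Complex.exp (Complex.I * ((t * ‖v‖ : ℝ) : ℂ) * ((1 / ‖v‖ * (pair ξ (vexp (q + s • e v + v)) - pair ξ (vexp (q + s • e v))) : ℝ) : ℂ)) = 
             Complex.exp (Complex.I * t * ((pair ξ (vexp (q + s • e v + v)) : ℝ) : ℂ)) * 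
             Complex.exp (-Complex.I * t * ((pair ξ (vexp (q + s • e v)) : ℝ) : ℂ)) := by
            rw [← Complex.exp_add]
            congr 1
            have : (‖v‖ : ℂ) ≠ 0 := by exact_mod_cast hvp.ne'
            push_cast
            field_simp
            ring
          rw [e2, show (q + v + s • e v : VV R C) = q + s • e v + v by abel]
          ring
      · have hz0 : ∀ q : EE R C, FF a M ξ t ↑(q + v) * (starRingEnd ℂ) (FF a M ξ t q) = 0 := by
          intro q
          by_cases hq : ρ < ‖q‖
          · rw [hFs q hq]; simp
          · rw [hFs (q + v), zero_mul]
            have h1 : ‖v‖ ≤ ‖q + v‖ + ‖q‖ := by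
              have := norm_sub_le (q + v) q
              simpa using this
            linarith
        simp_rw [hz0]
        rw [integral_zero, norm_zero]
        positivity
  refine (norm_integral_le_of_norm_le (hd1.const_mul C1) (ae_of_all _ hmain)).trans (le_of_eq ?_)
  rw [integral_const_mul, hd2]
  ring

end Landau

namespace Landau
open scoped ContDiff
open MeasureTheory

def Sc (x : ℝ) : ℂ := (Real.smoothTransition x : ℝ)

lemma Sc_contDiff : ContDiff ℝ ∞ Sc := Complex.ofRealCLM.contDiff.comp Real.smoothTransition.contDiff

def chi (α β δ r : ℝ) : ℝ := Real.smoothTransition ((r - α) / δ) - Real.smoothTransition ((r - β) / δ)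

def chic (α β δ r : ℝ) : ℂ := Sc ((r - α) / δ) - Sc ((r - β) / δ)

lemma chic_eq (α β δ r : ℝ) : chic α β δ r = (chi α β δ r : ℝ) := by simp [chic, chi, Sc]

lemma Sc_deriv_zero {i : ℕ} (hi : 1 ≤ i) {x : ℝ} (hx : x ∉ Set.Icc (0:ℝ) 1) : iteratedDeriv i Sc x = 0 := by
  have : ∃ c : ℂ, Sc =ᶠ[𝓝 x] fun _ => c := by
    by_cases h : x < 0
    · refine ⟨0, ?_⟩
      filter_upwards [Iio_mem_nhds h] with y hy
      simp [Sc, Real.smoothTransition.zero_of_nonpos (le_of_lt hy)]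
    · have h1 : 1 < x := by
        by_contra h2
        exact hx ⟨not_lt.1 h, not_lt.1 h2⟩
      refine ⟨1, ?_⟩
      filter_upwards [Ioi_mem_nhds h1] with y hy
      simp [Sc, Real.smoothTransition.one_of_one_le (le_of_lt hy)]
  obtain ⟨c, hc⟩ := this
  rw [hc.iteratedDeriv_eq, iteratedDeriv_const, if_neg (by omega)]

lemma Sc_norm_le (x : ℝ) : ‖Sc x‖ ≤ 1 := by
  unfold Sc
  rw [Complex.norm_real, Real.norm_of_nonneg (Real.smoothTransition.nonneg _)]
  exact Real.smoothTransition.le_one _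

lemma Sc_deriv_bound (i : ℕ) : ∃ K : ℝ, 0 ≤ K ∧ ∀ x, ‖iteratedDeriv i Sc x‖ ≤ K := by
  rcases Nat.eq_zero_or_pos i with rfl | hi
  · exact ⟨1, zero_le_one, fun x => by simpa using Sc_norm_le x⟩
  · have hc : Continuous (iteratedDeriv i Sc) := Sc_contDiff.continuous_iteratedDeriv i (by exact_mod_cast le_top)
    obtain ⟨K, hK⟩ := (HasCompactSupport.intro (isCompact_Icc (a := (0:ℝ)) (b := 1))
      (fun x hx => Sc_deriv_zero hi hx)).exists_bound_of_continuous hc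
    exact ⟨K, (norm_nonneg _).trans (hK 0), hK⟩

lemma iter_Sc_comp (α δ : ℝ) (i : ℕ) : iteratedDeriv i (fun r => Sc ((r - α) / δ)) = 
    fun r => ((δ : ℂ) ^ i)⁻¹ * iteratedDeriv i Sc ((r - α) / δ) := by
  induction i with
  | zero => simp
  | succ i ih =>
    rw [iteratedDeriv_succ, ih]
    funext r
    have h1 : HasDerivAt (fun r : ℝ => (r - α) / δ) (1 / δ) r := ((hasDerivAt_id r).sub_const α).div_const δ
    have h2 : HasDerivAt (iteratedDeriv i Sc) (iteratedDeriv (i+1) Sc ((r - α) / δ)) ((r - α) / δ) := by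
      rw [iteratedDeriv_succ]
      exact ((Sc_contDiff.differentiable_iteratedDeriv i (by exact_mod_cast ENat.natCast_lt_top i)) _).hasDerivAt
    have h3 := (h2.scomp r h1).const_mul ((δ : ℂ) ^ i)⁻¹
    have h4 := h3.deriv
    simp only [Function.comp_def] at h4
    rw [h4]
    simp only [Complex.real_smul, pow_succ]
    push_cast
    rw [mul_inv]
    ring

structure Adm (α β δ : ℝ) : Prop where
  ha : 1/4 ≤ α
  hab : α ≤ β
  hb : β + δ ≤ 2
  hd : 0 < δ
  hd1 : δ ≤ 1

lemma chic_contDiff (α β δ : ℝ) : ContDiff ℝ ∞ (chic α β δ) := by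
  have := Sc_contDiff
  unfold chic
  fun_prop

lemma chi_zero {α β δ : ℝ} (h : Adm α β δ) {r : ℝ} (hr : r ∉ Set.Icc α (β + δ)) : chi α β δ r = 0 := by
  have hd := h.hd
  have hab := h.hab
  by_cases h1 : r < α
  · unfold chi
    rw [Real.smoothTransition.zero_of_nonpos (div_nonpos_of_nonpos_of_nonneg (by linarith) hd.le), 
      Real.smoothTransition.zero_of_nonpos (div_nonpos_of_nonpos_of_nonneg (by linarith) hd.le), sub_zero]
  · have h2 : β + δ < r := by
      by_contra h2
      exact hr ⟨not_lt.1 h1, not_lt.1 h2⟩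
    unfold chi
    rw [Real.smoothTransition.one_of_one_le (by rw [le_div_iff₀ hd]; linarith), 
      Real.smoothTransition.one_of_one_le (by rw [le_div_iff₀ hd]; linarith), sub_self]

lemma chi_nonneg {α β δ : ℝ} (h : Adm α β δ) (r : ℝ) : 0 ≤ chi α β δ r := by
  unfold chi
  rw [sub_nonneg]
  have hd := h.hd
  have hab := h.hab
  apply Real.smoothTransition.monotone
  gcongr

lemma chi_le_one (α β δ : ℝ) (r : ℝ) : chi α β δ r ≤ 1 := by
  unfold chi
  have := Real.smoothTransition.le_one ((r - α) / δ)
  have := Real.smoothTransition.nonneg ((r - β) / δ)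
  linarith

def AA (α β δ : ℝ) : Set ℝ := Set.Icc α (α + δ) ∪ Set.Icc β (β + δ)

lemma iter_chic_bound (i : ℕ) : ∃ K : ℝ, 0 ≤ K ∧ ∀ α β δ, Adm α β δ → ∀ r, 
    ‖iteratedDeriv i (chic α β δ) r‖ ≤ K * ((Set.Icc (1/4:ℝ) 2).indicator 1 r + 
      if i = 0 then 0 else (AA α β δ).indicator 1 r / δ ^ i) := by
  rcases Nat.eq_zero_or_pos i with rfl | hi
  · refine ⟨1, zero_le_one, fun α β δ h r => ?_⟩
    simp only [iteratedDeriv_zero, if_true, add_zero, one_mul, chic_eq, Complex.norm_real]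
    by_cases hr : r ∈ Set.Icc (1/4:ℝ) 2
    · rw [Set.indicator_of_mem hr, Real.norm_of_nonneg (chi_nonneg h r)]
      exact chi_le_one _ _ _ _
    · rw [Set.indicator_of_notMem hr, chi_zero h, norm_zero]
      exact fun h' => hr ⟨h.ha.trans h'.1, h'.2.trans h.hb⟩
  · obtain ⟨K, hK0, hK⟩ := Sc_deriv_bound i
    refine ⟨2 * K, by positivity, fun α β δ h r => ?_⟩
    have hd := h.hd
    rw [if_neg (by omega)]
    have e : iteratedDeriv i (chic α β δ) r = ((δ : ℂ) ^ i)⁻¹ * iteratedDeriv i Sc ((r - α) / δ) - 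
        ((δ : ℂ) ^ i)⁻¹ * iteratedDeriv i Sc ((r - β) / δ) := by
      have h1 : ∀ α, ContDiffAt ℝ i (fun r => Sc ((r - α) / δ)) r := fun α => by
        have := Sc_contDiff.of_le (m := i) (by exact_mod_cast le_top)
        exact ContDiff.contDiffAt (by fun_prop)
      have := iteratedDeriv_fun_sub (h1 α) (h1 β)
      rw [iter_Sc_comp, iter_Sc_comp] at this
      exact this
    have hind : 0 ≤ (Set.Icc (1/4:ℝ) 2).indicator (1 : ℝ → ℝ) r := Set.indicator_nonneg (fun _ _ => zero_le_one) _
    by_cases hr : r ∈ AA α β δ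
    · rw [Set.indicator_of_mem hr, e]
      have hn : ∀ x, ‖((δ : ℂ) ^ i)⁻¹ * iteratedDeriv i Sc x‖ ≤ K / δ ^ i := fun x => by
        rw [norm_mul, norm_inv, norm_pow, Complex.norm_real, Real.norm_of_nonneg hd.le, div_eq_inv_mul]
        gcongr
        exact hK x
      refine (norm_sub_le _ _).trans ((add_le_add (hn _) (hn _)).trans ?_)
      rw [mul_add]
      have : 0 ≤ 2 * K * (Set.Icc (1/4:ℝ) 2).indicator (1 : ℝ → ℝ) r := by positivity
      simp only [Pi.one_apply]
      have e2 : 2 * K * (1 / δ ^ i) = K / δ ^ i + K / δ ^ i := by ring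
      linarith
    · have hz : ∀ x, r ∉ Set.Icc x (x + δ) → iteratedDeriv i Sc ((r - x) / δ) = 0 := fun x hx => by
        apply Sc_deriv_zero hi
        intro h'
        apply hx
        have h1 := h'.1
        have h2 := h'.2
        rw [le_div_iff₀ hd] at h1
        rw [div_le_iff₀ hd] at h2
        constructor <;> linarith
      rw [e, hz α (fun h' => hr (Or.inl h')), hz β (fun h' => hr (Or.inr h')), mul_zero, sub_zero, norm_zero]
      rw [Set.indicator_of_notMem hr]
      positivity

def GG (m : ℕ) (α β δ r : ℝ) : ℂ := (r : ℂ) ^ m * chic α β δ r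

lemma pow_contDiff (m : ℕ) : ContDiff ℝ ∞ (fun r : ℝ => (r : ℂ) ^ m) := by
  have : ContDiff ℝ ∞ (fun r : ℝ => (r : ℂ)) := Complex.ofRealCLM.contDiff
  fun_prop

lemma GG_contDiff (m : ℕ) (α β δ : ℝ) : ContDiff ℝ ∞ (GG m α β δ) := 
  (pow_contDiff m).mul (chic_contDiff _ _ _)

lemma GG_zero (m : ℕ) {α β δ : ℝ} (h : Adm α β δ) {r : ℝ} (hr : r ∉ Set.Icc (1/4:ℝ) 2) : GG m α β δ r = 0 := by
  unfold GG
  rw [chic_eq, chi_zero h, Complex.ofReal_zero, mul_zero]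
  exact fun h' => hr ⟨h.ha.trans h'.1, h'.2.trans h.hb⟩

lemma iter_GG_zero (m : ℕ) {α β δ : ℝ} (h : Adm α β δ) (M : ℕ) {r : ℝ} (hr : r ∉ Set.Icc (1/4:ℝ) 2) : 
    iteratedDeriv M (GG m α β δ) r = 0 := by
  have : GG m α β δ =ᶠ[𝓝 r] fun _ => 0 := by
    filter_upwards [isClosed_Icc.isOpen_compl.mem_nhds hr] with x hx using GG_zero m h hx
  rw [this.iteratedDeriv_eq, iteratedDeriv_const]
  simp

lemma GG_pointwise (m M : ℕ) : ∃ K : ℝ, 0 ≤ K ∧ ∀ α β δ, Adm α β δ → ∀ r, 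
    ‖iteratedDeriv M (GG m α β δ) r‖ ≤ K * ((Set.Icc (1/4:ℝ) 2).indicator 1 r + 
      if M = 0 then 0 else (AA α β δ).indicator 1 r / δ ^ M) := by
  choose K hK0 hK using iter_chic_bound
  have hP : ∀ i, ∃ P : ℝ, 0 ≤ P ∧ ∀ r ∈ Set.Icc (1/4:ℝ) 2, ‖iteratedDeriv i (fun r : ℝ => (r : ℂ) ^ m) r‖ ≤ P := by
    intro i
    have hc : Continuous (iteratedDeriv i (fun r : ℝ => (r : ℂ) ^ m)) := 
      (pow_contDiff m).continuous_iteratedDeriv i (by exact_mod_cast le_top)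
    obtain ⟨P, hP⟩ := (isCompact_Icc (a := (1/4:ℝ)) (b := 2)).exists_bound_of_continuousOn hc.continuousOn
    exact ⟨P, (norm_nonneg _).trans (hP 1 (by norm_num)), hP⟩
  choose P hP0 hP using hP
  refine ⟨∑ i ∈ Finset.range (M + 1), M.choose i * P i * K (M - i), Finset.sum_nonneg fun i _ => by
    have := hP0 i; have := hK0 (M-i); positivity, fun α β δ h r => ?_⟩
  have hd := h.hd
  by_cases hr : r ∈ Set.Icc (1/4:ℝ) 2
  · have e : iteratedDeriv M (GG m α β δ) r = ∑ i ∈ Finset.range (M + 1), 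
        M.choose i * iteratedDeriv i (fun r : ℝ => (r : ℂ) ^ m) r * iteratedDeriv (M - i) (chic α β δ) r := by
      unfold GG
      exact iteratedDeriv_fun_mul ((pow_contDiff m).of_le (by exact_mod_cast le_top)).contDiffAt
        ((chic_contDiff α β δ).of_le (by exact_mod_cast le_top)).contDiffAt
    rw [e, Finset.sum_mul]
    refine (norm_sum_le _ _).trans (Finset.sum_le_sum fun i hi => ?_)
    rw [norm_mul, norm_mul, Complex.norm_natCast]
    have h1 := hP i r hr
    have h2 := hK (M - i) α β δ h r
    have h3 : ((Set.Icc (1/4:ℝ) 2).indicator (1 : ℝ → ℝ) r + if M - i = 0 then 0 else (AA α β δ).indicator (1 : ℝ → ℝ) r / δ ^ (M-i)) ≤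
       ((Set.Icc (1/4:ℝ) 2).indicator (1 : ℝ → ℝ) r + if M = 0 then 0 else (AA α β δ).indicator (1 : ℝ → ℝ) r / δ ^ M) := by
      have hind : 0 ≤ (AA α β δ).indicator (1 : ℝ → ℝ) r := Set.indicator_nonneg (fun _ _ => zero_le_one) _
      refine add_le_add le_rfl ?_
      split_ifs with h5 h6 h6
      · rfl
      · positivity
      · omega
      · refine div_le_div_of_nonneg_left hind (by positivity) ?_
        exact pow_le_pow_of_le_one hd.le h.hd1 (Nat.sub_le M i)
    have hKK := hK0 (M - i)
    have hPP := hP0 i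
    have h4 := h2.trans (mul_le_mul_of_nonneg_left h3 hKK)
    set X := ((Set.Icc (1/4:ℝ) 2).indicator (1 : ℝ → ℝ) r + if M = 0 then 0 else (AA α β δ).indicator (1 : ℝ → ℝ) r / δ ^ M)
    calc (M.choose i : ℝ) * ‖iteratedDeriv i (fun r : ℝ => (r : ℂ) ^ m) r‖ * ‖iteratedDeriv (M - i) (chic α β δ) r‖ 
        ≤ M.choose i * P i * (K (M-i) * X) := by gcongr
      _ = _ := by ring
  · rw [iter_GG_zero m h M hr, norm_zero]
    refine mul_nonneg (Finset.sum_nonneg fun i _ => by have := hP0 i; have := hK0 (M-i); positivity) (add_nonneg (Set.indicator_nonneg (fun _ _ => zero_le_one) _) ?_)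
    split_ifs
    · rfl
    · exact div_nonneg (Set.indicator_nonneg (fun _ _ => zero_le_one) _) (by positivity)

lemma GG_L1 (m M : ℕ) : ∃ K : ℝ, 0 ≤ K ∧ ∀ α β δ, Adm α β δ → 
    ∫ r, ‖iteratedDeriv M (GG m α β δ) r‖ ≤ K / δ ^ (M - 1) := by
  obtain ⟨K, hK0, hK⟩ := GG_pointwise m M
  refine ⟨K * 4, by positivity, fun α β δ h => ?_⟩
  have hd := h.hd
  have hAm : MeasurableSet (AA α β δ) := measurableSet_Icc.union measurableSet_Icc
  have hAfin : volume (AA α β δ) < ⊤ := (isCompact_Icc.union isCompact_Icc).measure_lt_top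
  have hi1 : Integrable ((Set.Icc (1/4:ℝ) 2).indicator (1 : ℝ → ℝ)) := 
    (integrable_indicator_iff measurableSet_Icc).2 (integrableOn_const (by simp))
  have hi2 : Integrable ((AA α β δ).indicator (1 : ℝ → ℝ)) := 
    (integrable_indicator_iff hAm).2 (integrableOn_const hAfin.ne)
  have hA2 : ∫ r, (AA α β δ).indicator (1 : ℝ → ℝ) r ≤ 2 * δ := by
    rw [integral_indicator_one hAm]
    refine (measureReal_union_le _ _).trans ?_
    rw [Real.volume_real_Icc_of_le (by linarith), Real.volume_real_Icc_of_le (by linarith)]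
    linarith
  have hI : Integrable (fun r => K * ((Set.Icc (1/4:ℝ) 2).indicator (1 : ℝ → ℝ) r + 
      if M = 0 then 0 else (AA α β δ).indicator (1 : ℝ → ℝ) r / δ ^ M)) := by
    refine (hi1.add ?_).const_mul K
    split_ifs
    · exact integrable_zero _ _ _
    · exact hi2.div_const _
  refine (integral_mono_of_nonneg (ae_of_all _ fun _ => norm_nonneg _) hI (ae_of_all _ (hK α β δ h))).trans ?_
  rw [integral_const_mul, mul_div_assoc]
  gcongr
  rw [integral_add hi1]
  · rw [integral_indicator_one measurableSet_Icc, Real.volume_real_Icc_of_le (by norm_num)]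
    rcases Nat.eq_zero_or_pos M with rfl | hM
    · norm_num
    · simp only [if_neg hM.ne']
      rw [integral_div]
      obtain ⟨M', rfl⟩ : ∃ M', M = M' + 1 := ⟨M - 1, by omega⟩
      have h1 : (∫ r, (AA α β δ).indicator (1 : ℝ → ℝ) r) / δ ^ (M' + 1) ≤ 2 * δ / δ ^ (M' + 1) := by gcongr
      have h2 : 2 * δ / δ ^ (M' + 1) = 2 / δ ^ M' := by
        rw [pow_succ]; field_simp
      have h3 : 1 ≤ 1 / δ ^ M' := by
        rw [le_div_iff₀ (by positivity), one_mul]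
        exact pow_le_one₀ hd.le h.hd1
      have h4 : (4:ℝ) / δ ^ M' = 2 * (1 / δ ^ M') + 2 / δ ^ M' := by ring
      simp only [Nat.add_sub_cancel]
      linarith
  · split_ifs
    · exact integrable_zero _ _ _
    · exact hi2.div_const _

end Landau

namespace Landau
open scoped ContDiff
open MeasureTheory

variable {R C : Type} [Fintype R] [Fintype C]

lemma ibp_exp {G : ℝ → ℂ} (hG : ContDiff ℝ ∞ G) (hGc : HasCompactSupport G) {c : ℝ} (hc : c ≠ 0) (M : ℕ) :
    ∫ r : ℝ, G r * Complex.exp (Complex.I * r * c) = 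
      (Complex.I / c) ^ M * ∫ r : ℝ, iteratedDeriv M G r * Complex.exp (Complex.I * r * c) := by
  induction M generalizing G with
  | zero => simp
  | succ M ih =>
    have hG' : ContDiff ℝ ∞ (deriv G) := ((contDiff_infty_iff_deriv).1 hG).2
    rw [iteratedDeriv_succ', pow_succ', mul_assoc, ← ih hG' hGc.deriv]
    have hcc : (c : ℂ) ≠ 0 := by exact_mod_cast hc
    have hv : ∀ r : ℝ, HasDerivAt (fun r : ℝ => Complex.exp (Complex.I * r * c) * (-Complex.I / c)) 
        (Complex.exp (Complex.I * r * c)) r := by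
      intro r
      have h1 : HasDerivAt (fun r : ℝ => (Complex.I * r * c : ℂ)) (Complex.I * 1 * c) r := 
        (Complex.ofRealCLM.hasDerivAt.const_mul Complex.I).mul_const (c : ℂ)
      have h2 := (h1.cexp).mul_const (-Complex.I / c)
      refine h2.congr_deriv ?_
      field_simp
      ring_nf
      simp
    have hcont : Continuous (fun r : ℝ => Complex.exp (Complex.I * r * c)) := by fun_prop
    have h := integral_mul_deriv_eq_deriv_mul_of_integrable (u := G) (u' := deriv G) 
      (fun r _ => ((hG.differentiable (by simp)) r).hasDerivAt) (fun r _ => hv r)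
      ((hG.continuous.mul hcont).integrable_of_hasCompactSupport (hGc.mul_right))
      ((hG'.continuous.mul (hcont.mul continuous_const)).integrable_of_hasCompactSupport (hGc.deriv.mul_right))
      ((hG.continuous.mul (hcont.mul continuous_const)).integrable_of_hasCompactSupport (hGc.mul_right))
    rw [h, ← integral_neg, ← integral_const_mul]
    refine integral_congr_ae (ae_of_all _ fun r => ?_)
    simp only
    ring

lemma swap_pr (μ : Measure (EE R C)) [μ.IsAddHaarMeasure] {F0 : EE R C → ℂ} (hF : Continuous F0) {ρ : ℝ}
    (hFs : ∀ p, ρ < ‖p‖ → F0 p = 0) {D : ℝ → ℂ} (hD : Continuous D) (hDs : ∀ r, r ∉ Set.Icc (1/4:ℝ) 2 → D r = 0) 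
    (ξ : VV R C) (L : ℝ) :
    ∫ p : EE R C, (∫ r : ℝ, D r * (F0 p * Complex.exp (Complex.I * (r * L : ℝ) * (pair ξ (vexp p) : ℝ)))) ∂μ = 
    ∫ r : ℝ, D r * ∫ p : EE R C, F0 p * Complex.exp (Complex.I * (r * L : ℝ) * (pair ξ (vexp p) : ℝ)) ∂μ := by
  have h4 : Continuous (fun p : EE R C => pair ξ (vexp (p : VV R C))) := 
    (continuous_pair ξ).comp (continuous_vexp.comp continuous_subtype_val)
  rw [integral_integral_swap_of_hasCompactSupport]
  · simp_rw [integral_const_mul]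
  · simp only [Function.uncurry_def]
    exact (hD.comp continuous_snd).mul ((hF.comp continuous_fst).mul (Complex.continuous_exp.comp ((continuous_const.mul (Complex.continuous_ofReal.comp (continuous_snd.mul continuous_const))).mul (Complex.continuous_ofReal.comp (h4.comp continuous_fst)))))
  · refine HasCompactSupport.intro ((isCompact_closedBall (0:EE R C) ρ).prod (isCompact_Icc (a := (1/4:ℝ)) (b := 2))) ?_
    rintro ⟨p, r⟩ hpr
    simp only [Function.uncurry]
    by_cases hr : r ∈ Set.Icc (1/4:ℝ) 2
    · have hp : ¬ ‖p‖ ≤ ρ := fun h => hpr ⟨by simpa using h, hr⟩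
      rw [hFs p (not_le.1 hp)]; simp
    · rw [hDs r hr, zero_mul]

/-- the polar Fourier integral -/
def HH (μ : Measure (EE R C)) (a : VV R C → ℝ) (α β δ : ℝ) (ξ : VV R C) : ℂ :=
  ∫ p : EE R C, (∫ r : ℝ, (a p : ℂ) * (GG (dimV R C - 1) α β δ r * Complex.exp (Complex.I * r * (pair ξ (vexp p) : ℝ)))) ∂μ

lemma HH_formula (μ : Measure (EE R C)) [μ.IsAddHaarMeasure] {ρ : ℝ} {a : VV R C → ℝ} (has : ∀ p, ρ < ‖p‖ → a p = 0)
    (M : ℕ) {α β δ : ℝ} (h : Adm α β δ) {ξ ξ1 : VV R C} {L : ℝ} (hL : 0 < L) (hξ : ξ = L • ξ1)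
    (hFc : ∀ t, Continuous (FF a M ξ1 t)) (hM : M = 0 ∨ ∀ p, ‖p‖ ≤ ρ → pair ξ1 (vexp p) ≠ 0) :
    HH μ a α β δ ξ = (Complex.I / L) ^ M * ∫ r : ℝ, iteratedDeriv M (GG (dimV R C - 1) α β δ) r * 
      ∫ p : EE R C, FF a M ξ1 (r * L) p ∂μ := by
  have hGc : HasCompactSupport (GG (dimV R C - 1) α β δ) := HasCompactSupport.intro isCompact_Icc (fun r hr => GG_zero _ h hr)
  have hG := GG_contDiff (dimV R C - 1) α β δ
  have h0 : ∀ t (p : VV R C), FF a M ξ1 t p = FF a M ξ1 0 p * Complex.exp (Complex.I * (t : ℝ) * (pair ξ1 (vexp p) : ℝ)) := by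
    intro t p
    simp [FF]
  have e1 : ∀ p : EE R C, ∫ r : ℝ, (a p : ℂ) * (GG (dimV R C - 1) α β δ r * Complex.exp (Complex.I * r * (pair ξ (vexp p) : ℝ))) = 
      (Complex.I / L) ^ M * ∫ r : ℝ, iteratedDeriv M (GG (dimV R C - 1) α β δ) r * (FF a M ξ1 0 p * Complex.exp (Complex.I * (r * L : ℝ) * (pair ξ1 (vexp p) : ℝ))) := by
    intro p
    by_cases hp : ρ < ‖p‖
    · have : FF a M ξ1 0 p = 0 := by simp [FF, has p hp]
      simp [this, has p hp]
    · rw [integral_const_mul, hξ, smul_pair]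
      rcases hM with rfl | hM
      · simp only [pow_zero, one_mul, iteratedDeriv_zero]
        rw [← integral_const_mul]
        refine integral_congr_ae (ae_of_all _ fun r => ?_)
        simp only [FF]
        push_cast
        simp
        ring_nf
      · have hne := hM p (not_lt.1 hp)
        rw [ibp_exp hG hGc (mul_ne_zero hL.ne' hne) M, ← integral_const_mul, ← integral_const_mul, ← integral_const_mul]
        refine integral_congr_ae (ae_of_all _ fun r => ?_)
        simp only [FF]
        push_cast
        simp only [mul_zero, zero_mul, Complex.exp_zero, mul_one]
        rw [div_pow, div_pow, mul_pow, inv_pow]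
        have e3 : Complex.I * r * (L * (pair ξ1 (vexp (p : VV R C)) : ℂ)) = Complex.I * (r * L) * (pair ξ1 (vexp (p : VV R C)) : ℂ) := by ring
        rw [e3]
        field_simp
  unfold HH
  simp_rw [e1]
  rw [integral_const_mul, swap_pr μ (F0 := fun p : EE R C => FF a M ξ1 0 p) ((hFc 0).comp continuous_subtype_val) (ρ := ρ)
    (fun p hp => by simp [FF, has p hp]) (hG.continuous_iteratedDeriv M (by exact_mod_cast le_top)) (fun r hr => iter_GG_zero _ h M hr)]
  simp_rw [← h0]

lemma HH_bound (μ : Measure (EE R C)) [μ.IsAddHaarMeasure] {ρ : ℝ} {a : VV R C → ℝ} (has : ∀ p, ρ < ‖p‖ → a p = 0)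
    (M : ℕ) {α β δ : ℝ} (h : Adm α β δ) {ξ ξ1 : VV R C} {L : ℝ} (hL : 0 < L) (hξ : ξ = L • ξ1)
    (hFc : ∀ t, Continuous (FF a M ξ1 t)) (hM : M = 0 ∨ ∀ p, ‖p‖ ≤ ρ → pair ξ1 (vexp p) ≠ 0) {K B : ℝ} 
    (hK : ∫ r, ‖iteratedDeriv M (GG (dimV R C - 1) α β δ) r‖ ≤ K / δ ^ (M - 1)) 
    (hB0 : 0 ≤ B) (hB : ∀ r : ℝ, 1/4 ≤ r → ‖∫ p : EE R C, FF a M ξ1 (r * L) p ∂μ‖ ≤ B) :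
    ‖HH μ a α β δ ξ‖ ≤ (1 / L) ^ M * (K / δ ^ (M - 1) * B) := by
  rw [HH_formula μ has M h hL hξ hFc hM, norm_mul, norm_pow, norm_div, Complex.norm_I, Complex.norm_real, Real.norm_of_nonneg hL.le]
  gcongr
  have hGc : HasCompactSupport (iteratedDeriv M (GG (dimV R C - 1) α β δ)) := HasCompactSupport.intro isCompact_Icc (fun r hr => iter_GG_zero _ h M hr)
  have hG := (GG_contDiff (dimV R C - 1) α β δ).continuous_iteratedDeriv M (by exact_mod_cast le_top)
  refine (norm_integral_le_of_norm_le ((hG.integrable_of_hasCompactSupport hGc).norm.mul_const B) (ae_of_all _ fun r => ?_)).trans ?_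
  · rw [norm_mul]
    by_cases hr : r ∈ Set.Icc (1/4:ℝ) 2
    · gcongr
      exact hB r hr.1
    · rw [iter_GG_zero _ h M hr, norm_zero]; simp
  · rw [integral_mul_const]
    gcongr

theorem fourier_bound (μ : Measure (EE R C)) [μ.IsAddHaarMeasure] (hn : 1 ≤ dimV R C) {ρ : ℝ} (hρ0 : 0 < ρ)
    (hρ : 1000 * (dimV R C : ℝ) ^ 2 * ρ ≤ 1) {a : VV R C → ℝ} (ha : ContDiff ℝ ∞ a) (has : ∀ p, ρ < ‖p‖ → a p = 0)
    {c0 : ℝ} (hc0 : 0 < c0) : ∃ B : ℝ, 0 ≤ B ∧ ∀ α β δ, Adm α β δ → ∀ ξ : VV R C, c0 ≤ ‖ξ‖ → 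
      ‖HH μ a α β δ ξ‖ ≤ B * ‖ξ‖ ^ (-((dimV R C : ℝ) + 1) / 2) * min 1 (1 / (δ * ‖ξ‖) ^ (dimV R C)) := by
  have hn' : (1:ℝ) ≤ dimV R C := by exact_mod_cast hn
  have hρ1 : ρ ≤ 1/100 := by nlinarith
  set n := dimV R C with hndef
  choose B1 hB10 hB1 using fun M => surf_normal μ hn hρ0 hρ ha has M
  choose B2 hB20 hB2 using fun N => surf_nonnormal μ hn hρ0 hρ ha has N
  choose K hK0 hK using fun M => GG_L1 (n - 1) M
  -- normal constant
  let D : ℕ → ℝ := fun M => K M * Real.sqrt (B1 M * 4 ^ (n - 1))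
  let D2 : ℝ := K 0 * (B2 (2 * n) * 4 ^ (2 * n)) 
  let c1 : ℝ := min c0 1
  have hc1 : 0 < c1 := lt_min hc0 one_pos
  have hD0 : ∀ M, 0 ≤ D M := fun M => mul_nonneg (hK0 M) (Real.sqrt_nonneg _)
  have hD20 : 0 ≤ D2 := mul_nonneg (hK0 0) (mul_nonneg (hB20 _) (by positivity))
  refine ⟨D 1 + D (n + 1) + D2 / c1 ^ (2 * n), by have := hD0 1; have := hD0 (n+1); positivity, fun α β δ h ξ hξ => ?_⟩
  have hd := h.hd
  set L := ‖ξ‖ with hLdef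
  have hL : 0 < L := hc0.trans_le hξ
  have hLne : L ≠ 0 := hL.ne'
  set ξ1 := (1 / L) • ξ with hξ1
  have hξe : ξ = L • ξ1 := by rw [hξ1, smul_smul, mul_one_div_cancel hLne, one_smul]
  have hn1 : ‖ξ1‖ = 1 := by
    rw [hξ1, norm_smul, Real.norm_of_nonneg (by positivity), ← hLdef]; field_simp
  have hDn1 := hD0 1
  have hDn2 := hD0 (n+1)
  set P := L ^ (-((n : ℝ) + 1) / 2) with hP
  have hPpos : 0 < P := Real.rpow_pos_of_pos hL _
  have hPL : (1 / L) * Real.sqrt (1 / L ^ (n - 1)) = P := by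
    rw [Real.sqrt_eq_rpow, one_div, one_div, ← Real.rpow_natCast, ← Real.rpow_neg hL.le, ← Real.rpow_mul hL.le, 
      ← Real.rpow_neg_one, ← Real.rpow_add hL, hP]
    congr 1
    rw [Nat.cast_sub hn]
    push_cast; ring
  by_cases hz : ‖zet ξ1‖ < eps R C
  · have key : ∀ M, ‖HH μ a α β δ ξ‖ ≤ (1 / L) ^ M * (K M / δ ^ (M - 1) * (Real.sqrt (B1 M * 4 ^ (n - 1)) * Real.sqrt (1 / L ^ (n - 1)))) := by
      intro M
      refine HH_bound μ has M h hL hξe (fun t => FF_continuous hn1 hz hn hρ0 hρ1 ha.continuous has M t) (Or.inr fun p hp => ?_) (hK M α β δ h)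
        (by positivity) (fun r hr => ?_)
      · intro h0
        have := phi_lower hn1 hz hn hρ1 (p := p) (by linarith)
        rw [h0] at this; norm_num at this
      · rw [← Real.sqrt_mul (by have := hB10 M; positivity)]
        apply Real.le_sqrt_of_sq_le
        refine (hB1 M ξ1 hn1 hz (r * L) (by positivity)).trans ?_
        rw [mul_pow, mul_one_div, div_le_div_iff₀ (by positivity) (by positivity)]
        have h1 : 1 ≤ 4 ^ (n-1) * r ^ (n-1) := by
          rw [← mul_pow]
          exact one_le_pow₀ (by linarith)
        have := hB10 M
        calc B1 M * L ^ (n-1) = B1 M * 1 * L ^ (n-1) := by ring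
          _ ≤ B1 M * (4 ^ (n-1) * r ^ (n-1)) * L ^ (n-1) := by gcongr
          _ = _ := by ring
    have key1 : ‖HH μ a α β δ ξ‖ ≤ D 1 * P := by
      refine (key 1).trans (le_of_eq ?_)
      rw [← hPL]; simp only [D]; simp; ring
    have key2 : ‖HH μ a α β δ ξ‖ ≤ D (n+1) * P * (1 / (δ * L) ^ n) := by
      refine (key (n+1)).trans (le_of_eq ?_)
      rw [← hPL]; simp only [D, Nat.add_sub_cancel]
      rw [pow_succ, mul_pow, div_pow, one_pow]
      field_simp
    have hm : ‖HH μ a α β δ ξ‖ ≤ (D 1 + D (n+1)) * P * min 1 (1 / (δ * L) ^ n) := by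
      rcases min_choice 1 (1 / (δ * L) ^ n) with h1 | h1 <;> rw [h1]
      · refine key1.trans ?_
        rw [mul_one]; gcongr; linarith
      · refine key2.trans ?_
        gcongr; linarith
    refine hm.trans ?_
    have : 0 ≤ min 1 (1 / (δ * L) ^ n) := by positivity
    have h3 : 0 ≤ D2 / c1 ^ (2 * n) := by positivity
    refine mul_le_mul_of_nonneg_right (mul_le_mul_of_nonneg_right ?_ hPpos.le) this
    linarith
  · push Not at hz
    have hc : Continuous a := ha.continuous
    have hFcc : ∀ t, Continuous (FF a 0 ξ1 t) := by
      intro t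
      unfold FF
      have h1 : Continuous (fun p => pair ξ1 (vexp p)) := (continuous_pair ξ1).comp continuous_vexp
      simp only [pow_zero, mul_one]
      fun_prop
    have key : ‖HH μ a α β δ ξ‖ ≤ (1 / L) ^ 0 * (K 0 / δ ^ (0 - 1) * (B2 (2*n) * 4 ^ (2 * n) / L ^ (2 * n))) := by
      refine HH_bound μ has 0 h hL hξe hFcc (Or.inl rfl) (hK 0 α β δ h)
        (by have := hB20 (2*n); positivity) (fun r hr => ?_)
      have h1 := hB2 (2*n) ξ1 hn1 hz (r * L) (by positivity)
      simp only [FF, pow_zero, mul_one]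
      refine h1.trans ?_
      rw [mul_pow, div_le_div_iff₀ (by positivity) (by positivity)]
      have h1 : 1 ≤ 4 ^ (2*n) * r ^ (2*n) := by
          rw [← mul_pow]
          exact one_le_pow₀ (by linarith)
      have := hB20 (2*n)
      calc B2 (2*n) * L ^ (2*n) = B2 (2*n) * 1 * L ^ (2*n) := by ring
          _ ≤ B2 (2*n) * (4 ^ (2*n) * r ^ (2*n)) * L ^ (2*n) := by gcongr
          _ = _ := by ring
    have key2 : ‖HH μ a α β δ ξ‖ ≤ D2 / L ^ (2 * n) := by
      refine key.trans (le_of_eq ?_)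
      simp only [D2]; simp; ring
    -- compare
    have hLc : c1 ≤ L := (min_le_left _ _).trans hξ
    have hcomp : 1 / L ^ (2 * n) ≤ 1 / c1 ^ (2 * n) * (P * min 1 (1 / (δ * L) ^ n)) := by
      have hmin : min 1 (1 / L ^ n) ≤ min 1 (1 / (δ * L) ^ n) := by
        refine min_le_min le_rfl ?_
        gcongr
        nlinarith [h.hd1]
      refine le_trans ?_ (mul_le_mul_of_nonneg_left (mul_le_mul_of_nonneg_left hmin hPpos.le) (by positivity))
      by_cases h1 : 1 ≤ L
      · have h2 : 1 / L ^ n ≤ 1 := by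
          rw [div_le_one (by positivity)]; exact one_le_pow₀ h1
        rw [min_eq_right h2]
        have h3 : 1 ≤ 1 / c1 ^ (2 * n) := by
          rw [le_div_iff₀ (by positivity), one_mul]
          exact pow_le_one₀ hc1.le (min_le_right _ _)
        have h4 : 1 / L ^ n ≤ P := by
          rw [hP, one_div, ← Real.rpow_natCast, ← Real.rpow_neg hL.le]
          apply Real.rpow_le_rpow_of_exponent_le h1
          linarith
        calc 1 / L ^ (2 * n) = 1 * (1 / L ^ n * (1 / L ^ n)) := by rw [two_mul, pow_add]; field_simp
          _ ≤ _ := by gcongr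
      · push Not at h1
        have h2 : 1 ≤ 1 / L ^ n := by
          rw [le_div_iff₀ (by positivity), one_mul]; exact pow_le_one₀ hL.le h1.le
        rw [min_eq_left h2, mul_one]
        have h4 : 1 ≤ P := by
          rw [hP]
          apply Real.one_le_rpow_of_pos_of_le_one_of_nonpos hL h1.le
          linarith
        calc 1 / L ^ (2 * n) ≤ 1 / c1 ^ (2 * n) * 1 := by rw [mul_one]; gcongr
          _ ≤ _ := by gcongr
    refine key2.trans ?_
    have h5 : D2 / L ^ (2 * n) = D2 * (1 / L ^ (2 * n)) := by ring
    rw [h5]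
    refine (mul_le_mul_of_nonneg_left hcomp hD20).trans ?_
    have h6 : 0 ≤ min 1 (1 / (δ * L) ^ n) := by positivity
    calc D2 * (1 / c1 ^ (2 * n) * (P * min 1 (1 / (δ * L) ^ n))) = (D2 / c1 ^ (2 * n)) * P * min 1 (1 / (δ * L) ^ n) := by ring
      _ ≤ _ := by gcongr; linarith

end Landau

namespace Landau
open scoped ContDiff
open MeasureTheory

variable {R C : Type} [Fintype R] [Fintype C]

def mulC (c : ℂ) : ℂ →L[ℝ] ℂ := (ContinuousLinearMap.mul ℝ ℂ) c

def mulR (c : ℝ) : ℝ →L[ℝ] ℝ := (ContinuousLinearMap.mul ℝ ℝ) c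

def mulV (x : VV R C) : VV R C →L[ℝ] VV R C :=
  (ContinuousLinearMap.pi fun w => (mulR (x.1 w)).comp (ContinuousLinearMap.proj w)).prodMap
  (ContinuousLinearMap.pi fun w => (mulC (x.2 w)).comp (ContinuousLinearMap.proj w))

lemma mulV_apply (x y : VV R C) : mulV x y = x * y := by
  ext w <;> simp [mulV, mulC, mulR]

def nrmV (x : VV R C) : ℝ := (∏ w, |x.1 w|) * ∏ w, ‖x.2 w‖ ^ 2

lemma det_mulV (x : VV R C) : |(mulV x).det| = nrmV x := by
  have h : (mulV x).det = (∏ w, x.1 w) * ∏ w, ‖x.2 w‖ ^ 2 := by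
    have e : ((mulV x : VV R C →L[ℝ] VV R C) : VV R C →ₗ[ℝ] VV R C) = 
      LinearMap.prodMap (LinearMap.pi fun w => ((mulR (x.1 w)) : ℝ →ₗ[ℝ] ℝ).comp (LinearMap.proj w))
       (LinearMap.pi fun w => ((mulC (x.2 w)) : ℂ →ₗ[ℝ] ℂ).comp (LinearMap.proj w)) := rfl
    rw [ContinuousLinearMap.det, e, LinearMap.det_prodMap, LinearMap.det_pi, LinearMap.det_pi]
    congr 1
    · refine Finset.prod_congr rfl fun w _ => ?_
      have : ((mulR (x.1 w) : ℝ →L[ℝ] ℝ) : ℝ →ₗ[ℝ] ℝ) = LinearMap.mulLeft ℝ (x.1 w) := by ext; simp [mulR]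
      rw [this]; simp
    · refine Finset.prod_congr rfl fun w _ => ?_
      have : ((mulC (x.2 w) : ℂ →L[ℝ] ℂ) : ℂ →ₗ[ℝ] ℂ) = Algebra.lmul ℝ ℂ (x.2 w) := by ext <;> simp [mulC]
      rw [this, ← Algebra.norm_apply, Algebra.norm_complex_eq, ← Complex.normSq_eq_norm_sq]
      rfl
  rw [h, abs_mul, Finset.abs_prod, abs_of_nonneg (a := ∏ w, ‖x.2 w‖ ^ 2) (by positivity)]
  rfl

lemma hasFDerivAt_vexp (z : VV R C) : HasFDerivAt vexp (mulV (vexp z)) z := by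
  have h1 : HasFDerivAt (fun u : R → ℝ => fun w => Real.exp (u w)) 
      (ContinuousLinearMap.pi fun w => (mulR (Real.exp (z.1 w))).comp (ContinuousLinearMap.proj w)) z.1 := by
    refine hasFDerivAt_pi.2 fun w => ?_
    have : HasFDerivAt Real.exp (mulR (Real.exp (z.1 w))) (z.1 w) := by
      exact (Real.hasDerivAt_exp (z.1 w)).hasFDerivAt.congr_fderiv (by ext; simp [mulR])
    exact this.comp z.1 (ContinuousLinearMap.proj w : (R → ℝ) →L[ℝ] ℝ).hasFDerivAt
  have h2 : HasFDerivAt (fun u : C → ℂ => fun w => Complex.exp (u w)) 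
      (ContinuousLinearMap.pi fun w => (mulC (Complex.exp (z.2 w))).comp (ContinuousLinearMap.proj w)) z.2 := by
    refine hasFDerivAt_pi.2 fun w => ?_
    have : HasFDerivAt Complex.exp (mulC (Complex.exp (z.2 w))) (z.2 w) := by
      exact ((Complex.hasDerivAt_exp (z.2 w)).hasFDerivAt.restrictScalars ℝ).congr_fderiv (by ext <;> simp [mulC, mul_comm])
    exact this.comp z.2 (ContinuousLinearMap.proj w : (C → ℂ) →L[ℝ] ℂ).hasFDerivAt
  exact HasFDerivAt.prodMap z h1 h2

lemma nrmV_vexp (z : VV R C) : nrmV (vexp z) = Real.exp (trL z) := by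
  rw [trL_apply, nrmV, Real.exp_add, Real.exp_sum, Finset.mul_sum, Real.exp_sum]
  congr 1
  · exact Finset.prod_congr rfl fun w _ => by simp [vexp]
  · exact Finset.prod_congr rfl fun w _ => by rw [vexp, Complex.norm_exp, ← Real.exp_nat_mul]; simp

def strip (R C : Type) : Set (VV R C) := {z | ∀ w, |(z.2 w).im| < Real.pi}

def Om (R C : Type) : Set (VV R C) := {y | (∀ w, 0 < y.1 w) ∧ ∀ w, y.2 w ∈ Complex.slitPlane}

def logV (y : VV R C) : VV R C := (fun w => Real.log (y.1 w), fun w => Complex.log (y.2 w))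

lemma logV_vexp {z : VV R C} (hz : z ∈ strip R C) : logV (vexp z) = z := by
  ext w
  · simp [logV, vexp]
  · have := abs_lt.1 (hz w)
    simp only [logV, vexp]
    rw [Complex.log_exp this.1 this.2.le]

lemma vexp_logV {y : VV R C} (hy : y ∈ Om R C) : vexp (logV y) = y := by
  ext w
  · simp [logV, vexp, Real.exp_log (hy.1 w)]
  · simp [logV, vexp, Complex.exp_log (Complex.slitPlane_ne_zero (hy.2 w))]

lemma logV_strip {y : VV R C} (hy : y ∈ Om R C) : logV y ∈ strip R C := by
  intro w
  simp only [logV, Complex.log_im]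
  rw [abs_lt]
  exact ⟨Complex.neg_pi_lt_arg _, lt_of_le_of_ne (Complex.arg_le_pi _) (Complex.mem_slitPlane_iff_arg.1 (hy.2 w)).1⟩

lemma vexp_Om {z : VV R C} (hz : z ∈ strip R C) : vexp z ∈ Om R C := by
  refine ⟨fun w => Real.exp_pos _, fun w => ?_⟩
  have := abs_lt.1 (hz w)
  simp only [vexp]
  rw [Complex.mem_slitPlane_iff_arg]
  refine ⟨?_, Complex.exp_ne_zero _⟩
  rw [Complex.arg_exp, (toIocMod_eq_self Real.two_pi_pos).2]
  · exact this.2.ne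
  · constructor <;> linarith

lemma vexp_image : vexp '' (strip R C) = Om R C := by
  ext y
  constructor
  · rintro ⟨z, hz, rfl⟩
    exact vexp_Om hz
  · intro hy
    exact ⟨logV y, logV_strip hy, vexp_logV hy⟩

lemma vexp_injOn : Set.InjOn vexp (strip R C) := fun x hx y hy h => by
  rw [← logV_vexp hx, h, logV_vexp hy]

lemma isOpen_strip : IsOpen (strip R C) := by
  have : strip R C = ⋂ w, {z | |(z.2 w).im| < Real.pi} := by ext; simp [strip]
  rw [this]
  refine isOpen_iInter_of_finite fun w => ?_
  exact isOpen_lt (by fun_prop) continuous_const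

lemma isOpen_Om : IsOpen (Om R C) := by
  have : Om R C = (⋂ w, {z | 0 < z.1 w}) ∩ ⋂ w, {z | z.2 w ∈ Complex.slitPlane} := by ext; simp [Om]
  rw [this]
  refine (isOpen_iInter_of_finite fun w => ?_).inter (isOpen_iInter_of_finite fun w => ?_)
  · exact isOpen_lt continuous_const (by fun_prop)
  · exact Complex.isOpen_slitPlane.preimage (by fun_prop)

lemma continuousOn_logV : ContinuousOn (logV : VV R C → VV R C) (Om R C) := by
  refine ContinuousOn.prodMk (continuousOn_pi.2 fun w => ?_) (continuousOn_pi.2 fun w => ?_)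
  · exact ContinuousOn.log (by fun_prop) (fun y hy => (hy.1 w).ne')
  · exact ContinuousOn.clog (by fun_prop) (fun y hy => hy.2 w)

/-- projection to `EE` along `1` -/
def prE (z : VV R C) : VV R C := z - (trL z / dimV R C) • (1 : VV R C)

lemma trL_one : trL (1 : VV R C) = dimV R C := pair_dV_one

lemma prE_mem (hn : 1 ≤ dimV R C) (z : VV R C) : prE z ∈ EE R C := by
  have : (dimV R C : ℝ) ≠ 0 := by positivity
  show trL _ = 0
  rw [prE, map_sub, map_smul, trL_one, smul_eq_mul, div_mul_cancel₀ _ this, sub_self]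

lemma prE_add_smul (hn : 1 ≤ dimV R C) (z : VV R C) (t : ℝ) : prE (z + t • (1 : VV R C)) = prE z := by
  have : (dimV R C : ℝ) ≠ 0 := by positivity
  rw [prE, prE, map_add, map_smul, trL_one, smul_eq_mul, add_div, mul_div_cancel_right₀ _ this, add_smul]
  abel

lemma prE_of_mem {z : VV R C} (hz : z ∈ EE R C) : prE z = z := by
  have h : trL z = 0 := hz
  simp [prE, h]

def Psi (a : VV R C → ℝ) (y : VV R C) : ℝ := (Om R C).indicator (fun y => a (prE (logV y))) y

def f0 (a : VV R C → ℝ) (α β δ : ℝ) (y : VV R C) : ℝ := Psi a y * chi α β δ (nrmV y ^ (1 / (dimV R C : ℝ)))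

lemma nrmV_rpow_vexp (z : VV R C) : nrmV (vexp z) ^ (1 / (dimV R C : ℝ)) = Real.exp (trL z / dimV R C) := by
  rw [nrmV_vexp, ← Real.exp_mul, mul_one_div]

lemma continuous_trL : Continuous (trL : VV R C → ℝ) := continuous_pair dV

lemma continuous_prE : Continuous (prE : VV R C → VV R C) := by
  have := continuous_trL (R := R) (C := C)
  unfold prE
  fun_prop

def F1 (a : VV R C → ℝ) (α β δ : ℝ) (z : VV R C) : ℝ := a (prE z) * chi α β δ (Real.exp (trL z / dimV R C))

def Kc (R C : Type) [Fintype R] [Fintype C] (ρ : ℝ) : Set (VV R C) := 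
  {z | ‖prE z‖ ≤ ρ ∧ 1/4 ≤ Real.exp (trL z / dimV R C) ∧ Real.exp (trL z / dimV R C) ≤ 2}

lemma norm_oneV_le : ‖(1 : VV R C)‖ ≤ 1 := norm_le_of_coords zero_le_one (by simp) (by simp)

lemma isCompact_Kc (ρ : ℝ) : IsCompact (Kc R C ρ) := by
  have h1 := continuous_trL (R := R) (C := C)
  have h2 := continuous_prE (R := R) (C := C)
  refine Metric.isCompact_of_isClosed_isBounded ?_ ?_
  · have : Kc R C ρ = {z | ‖prE z‖ ≤ ρ} ∩ ({z | 1/4 ≤ Real.exp (trL z / dimV R C)} ∩ {z | Real.exp (trL z / dimV R C) ≤ 2}) := rfl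
    rw [this]
    exact (isClosed_le (by fun_prop) (by fun_prop)).inter ((isClosed_le (by fun_prop) (by fun_prop)).inter (isClosed_le (by fun_prop) (by fun_prop)))
  · refine (Metric.isBounded_closedBall (x := (0 : VV R C)) (r := ρ + 3)).subset ?_
    rintro z ⟨hz1, hz2, hz3⟩
    simp only [Metric.mem_closedBall, dist_zero_right]
    set t := trL z / dimV R C with ht
    have e : z = prE z + t • (1 : VV R C) := by rw [prE]; abel
    have h3 : t ≤ 3 := by
      have := Real.add_one_le_exp t
      linarith
    have h4 : -3 ≤ t := by
      have := Real.add_one_le_exp (-t)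
      rw [Real.exp_neg] at this
      have h5 : (Real.exp t)⁻¹ ≤ (1/4)⁻¹ := inv_anti₀ (by norm_num) hz2
      norm_num at h5
      linarith
    calc ‖z‖ = ‖prE z + t • (1 : VV R C)‖ := by rw [← e]
      _ ≤ ‖prE z‖ + ‖t • (1 : VV R C)‖ := norm_add_le _ _
      _ ≤ ρ + 3 * 1 := by
        rw [norm_smul]
        gcongr
        · rw [Real.norm_eq_abs, abs_le]; exact ⟨h4, h3⟩
        · exact norm_oneV_le
      _ = _ := by ring

lemma continuous_chi (α β δ : ℝ) : Continuous (chi α β δ) := by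
  have := Real.smoothTransition.continuous
  unfold chi
  fun_prop

lemma F1_continuous {a : VV R C → ℝ} (ha : Continuous a) (α β δ : ℝ) : Continuous (F1 a α β δ) := by
  have h1 := continuous_trL (R := R) (C := C)
  have h2 := continuous_prE (R := R) (C := C)
  have h3 := continuous_chi α β δ
  unfold F1
  fun_prop

lemma F1_zero {a : VV R C → ℝ} {ρ : ℝ} (has : ∀ p, ρ < ‖p‖ → a p = 0) {α β δ : ℝ} (h : Adm α β δ) {z : VV R C} 
    (hz : z ∉ Kc R C ρ) : F1 a α β δ z = 0 := by
  unfold F1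
  by_contra h0
  refine hz ⟨?_, ?_⟩
  · by_contra h1
    rw [has _ (not_le.1 h1), zero_mul] at h0
    exact h0 rfl
  · have : Real.exp (trL z / dimV R C) ∈ Set.Icc α (β + δ) := by
      by_contra h1
      rw [chi_zero h h1, mul_zero] at h0
      exact h0 rfl
    exact ⟨h.ha.trans this.1, this.2.trans h.hb⟩

lemma Kc_strip {ρ : ℝ} (hρ : ρ ≤ 1) : Kc R C ρ ⊆ strip R C := by
  intro z hz w
  have h1 : (z.2 w).im = ((prE z).2 w).im := by simp [prE]
  rw [h1]
  refine ((Complex.abs_im_le_norm _).trans (coord2_le (prE z) w)).trans_lt ?_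
  have := hz.1
  linarith [Real.pi_gt_three]

lemma f0_vexp (a : VV R C → ℝ) (α β δ : ℝ) {z : VV R C} (hz : z ∈ strip R C) : f0 a α β δ (vexp z) = F1 a α β δ z := by
  rw [f0, Psi, Set.indicator_of_mem (vexp_Om hz), nrmV_rpow_vexp, logV_vexp hz, F1]

lemma f0_eq (a : VV R C → ℝ) (α β δ : ℝ) {y : VV R C} (hy : y ∈ Om R C) : f0 a α β δ y = F1 a α β δ (logV y) := by
  rw [← f0_vexp a α β δ (logV_strip hy), vexp_logV hy]

lemma f0_off (a : VV R C → ℝ) (α β δ : ℝ) {y : VV R C} (hy : y ∉ Om R C) : f0 a α β δ y = 0 := by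
  rw [f0, Psi, Set.indicator_of_notMem hy, zero_mul]

lemma f0_zero {a : VV R C → ℝ} {ρ : ℝ} (has : ∀ p, ρ < ‖p‖ → a p = 0) {α β δ : ℝ} (h : Adm α β δ)
    {y : VV R C} (hy : y ∉ vexp '' (Kc R C ρ)) : f0 a α β δ y = 0 := by
  by_cases hO : y ∈ Om R C
  · rw [f0_eq _ _ _ _ hO]
    refine F1_zero has h fun hc => hy ⟨logV y, hc, vexp_logV hO⟩
  · exact f0_off _ _ _ _ hO

lemma f0_hcs {a : VV R C → ℝ} {ρ : ℝ} (has : ∀ p, ρ < ‖p‖ → a p = 0) {α β δ : ℝ} (h : Adm α β δ) : 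
    HasCompactSupport (f0 a α β δ) := 
  HasCompactSupport.intro ((isCompact_Kc ρ).image continuous_vexp) (fun _ hy => f0_zero has h hy)

lemma f0_continuous {a : VV R C → ℝ} (ha : Continuous a) {ρ : ℝ} (hρ : ρ ≤ 1) (has : ∀ p, ρ < ‖p‖ → a p = 0) 
    {α β δ : ℝ} (h : Adm α β δ) : Continuous (f0 a α β δ) := by
  rw [continuous_iff_continuousAt]
  intro y
  by_cases hO : y ∈ Om R C
  · have h1 : ContinuousOn (f0 a α β δ) (Om R C) := 
      ((F1_continuous ha α β δ).comp_continuousOn continuousOn_logV).congr (fun y hy => f0_eq a α β δ hy)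
    exact h1.continuousAt (isOpen_Om.mem_nhds hO)
  · have hc : IsClosed (vexp '' (Kc R C ρ)) := ((isCompact_Kc ρ).image continuous_vexp).isClosed
    have hy : y ∉ vexp '' (Kc R C ρ) := by
      rintro ⟨z, hz, rfl⟩
      exact hO (vexp_Om (Kc_strip hρ hz))
    have : f0 a α β δ =ᶠ[𝓝 y] fun _ => 0 := by
      filter_upwards [hc.isOpen_compl.mem_nhds hy] with x hx using f0_zero has h hx
    exact continuousAt_const.congr this.symm

def splitE (hn : 1 ≤ dimV R C) : (EE R C × ℝ) ≃ₗ[ℝ] VV R C where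
  toFun x := (x.1 : VV R C) + x.2 • (1 : VV R C)
  map_add' x y := by simp only [Prod.fst_add, Prod.snd_add, Submodule.coe_add, add_smul]; abel
  map_smul' c x := by simp [smul_smul]
  invFun z := (⟨prE z, prE_mem hn z⟩, trL z / dimV R C)
  left_inv x := by
    have : (dimV R C : ℝ) ≠ 0 := by positivity
    have h0 : trL (x.1 : VV R C) = 0 := x.1.2
    ext1
    · apply Subtype.ext
      simp only
      rw [prE_add_smul hn, prE_of_mem x.1.2]
    · simp only [map_add, map_smul, h0, trL_one, smul_eq_mul, zero_add]
      field_simp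
  right_inv z := by simp [prE]

lemma exp_subst (g : ℝ → ℂ) (hg : ∀ r, r ≤ 0 → g r = 0) : 
    ∫ t : ℝ, (Real.exp t : ℂ) * g (Real.exp t) = ∫ r : ℝ, g r := by
  have h := integral_image_eq_integral_abs_deriv_smul (s := Set.univ) (f := Real.exp) (f' := Real.exp) MeasurableSet.univ
    (fun x _ => (Real.hasDerivAt_exp x).hasDerivWithinAt) (Real.exp_injective.injOn) g
  rw [Set.image_univ, Real.range_exp, setIntegral_eq_integral_of_forall_compl_eq_zero (s := Set.Ioi (0:ℝ)) (fun x hx => hg x (not_lt.1 hx)), setIntegral_univ] at h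
  rw [h]
  refine integral_congr_ae (ae_of_all _ fun t => ?_)
  simp [abs_of_pos (Real.exp_pos t)]

instance instHaarVV : (volume : Measure (VV R C)).IsAddHaarMeasure := Measure.prod.instIsAddHaarMeasure _ _

theorem fourier_eq (μ : Measure (EE R C)) [μ.IsAddHaarMeasure] (hn : 1 ≤ dimV R C) : ∃ c : ℝ, 0 ≤ c ∧ 
    ∀ (a : VV R C → ℝ) (ρ : ℝ), ρ ≤ 1 → Continuous a → (∀ p, ρ < ‖p‖ → a p = 0) → ∀ α β δ, Adm α β δ → ∀ ξ : VV R C, 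
    ∫ y, (f0 a α β δ y : ℂ) * Complex.exp (Complex.I * (pair ξ y : ℝ)) = c * HH μ a α β δ ξ := by
  let Φ := (splitE hn).toContinuousLinearEquiv
  let ν : Measure (VV R C) := (μ.prod volume).map Φ
  haveI : (μ.prod (volume : Measure ℝ)).IsAddHaarMeasure := Measure.prod.instIsAddHaarMeasure _ _
  haveI : ν.IsAddHaarMeasure := ContinuousLinearEquiv.isAddHaarMeasure_map Φ (μ.prod volume)
  let c : NNReal := Measure.addHaarScalarFactor (volume : Measure (VV R C)) ν
  have hc : (volume : Measure (VV R C)) = c • ν := Measure.isAddLeftInvariant_eq_smul _ _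
  refine ⟨c, c.2, fun a ρ hρ ha has α β δ h ξ => ?_⟩
  let W : VV R C → ℂ := fun z => (Real.exp (trL z) : ℂ) * ((F1 a α β δ z : ℂ) * Complex.exp (Complex.I * (pair ξ (vexp z) : ℝ)))
  have hW0 : ∀ z, z ∉ Kc R C ρ → W z = 0 := fun z hz => by simp [W, F1_zero has h hz]
  have hWc : Continuous W := by
    have h1 := F1_continuous ha α β δ
    have h2 := continuous_trL (R := R) (C := C)
    have h3 : Continuous (fun z => pair ξ (vexp z)) := (continuous_pair ξ).comp continuous_vexp
    simp only [W]
    fun_prop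
  have hWs : HasCompactSupport W := HasCompactSupport.intro (isCompact_Kc ρ) hW0
  have e1 : ∫ y, (f0 a α β δ y : ℂ) * Complex.exp (Complex.I * (pair ξ y : ℝ)) = ∫ z, W z := by
    rw [← setIntegral_eq_integral_of_forall_compl_eq_zero (s := Om R C) (fun y hy => by rw [f0_off _ _ _ _ hy]; simp), ← vexp_image,
      integral_image_eq_integral_abs_det_fderiv_smul volume isOpen_strip.measurableSet 
        (fun z _ => (hasFDerivAt_vexp z).hasFDerivWithinAt) vexp_injOn,
      ← setIntegral_eq_integral_of_forall_compl_eq_zero (s := strip R C) (f := W) (fun z hz => hW0 z fun hk => hz (Kc_strip hρ hk))]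
    refine setIntegral_congr_fun isOpen_strip.measurableSet fun z hz => ?_
    simp only [W]
    rw [det_mulV, nrmV_vexp, f0_vexp _ _ _ _ hz]
    simp
  rw [e1, hc, integral_smul_nnreal_measure]
  have e2 : ∫ z, W z ∂ν = HH μ a α β δ ξ := by
    have h1 : ∫ z, W z ∂ν = ∫ x, W (Φ x) ∂(μ.prod volume) := 
      (Φ.toHomeomorph.measurableEmbedding).integral_map W
    have hI : Integrable (fun x => W (Φ x)) (μ.prod volume) := ((hWc.comp Φ.continuous).integrable_of_hasCompactSupport (hWs.comp_homeomorph Φ.toHomeomorph))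
    rw [h1, integral_prod _ hI]
    refine integral_congr_ae (ae_of_all _ fun p => ?_)
    simp only
    rw [integral_const_mul, ← exp_subst (fun r => GG (dimV R C - 1) α β δ r * Complex.exp (Complex.I * r * (pair ξ (vexp p) : ℝ))) 
      (fun r hr => by rw [GG_zero _ h (fun hc => by have := h.ha; linarith [hc.1]), zero_mul]), ← integral_const_mul]
    refine integral_congr_ae (ae_of_all _ fun t => ?_)
    have hd : (dimV R C : ℝ) ≠ 0 := by positivity
    have hΦ : Φ (p, t) = (p : VV R C) + t • (1 : VV R C) := rfl
    have h0 : trL (p : VV R C) = 0 := p.2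
    have ht : trL ((p : VV R C) + t • (1 : VV R C)) = t * dimV R C := by
      rw [map_add, map_smul, h0, trL_one, smul_eq_mul, zero_add]
    have hv : vexp (t • (1 : VV R C)) = Real.exp t • (1 : VV R C) := by
      ext w <;> simp [vexp]
    simp only [W, F1, hΦ]
    rw [ht, mul_div_cancel_right₀ _ hd, prE_add_smul hn, prE_of_mem p.2, vexp_add, hv, mul_smul_comm, mul_one, pair_smul]
    simp only [GG, chic_eq]
    have e3 : (Real.exp (t * dimV R C) : ℂ) = (Real.exp t : ℂ) * (Real.exp t : ℂ) ^ (dimV R C - 1) := by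
      rw [← pow_succ', Nat.sub_add_cancel hn]
      norm_cast
      rw [mul_comm, Real.exp_nat_mul]
    rw [e3]
    push_cast
    ring_nf
  rw [e2]
  simp [NNReal.smul_def]

end Landau

namespace Landau
open scoped ContDiff
open MeasureTheory

variable {ι : Type} [Fintype ι]

def iv (k : ι → ℤ) : ι → ℝ := fun i => (k i : ℝ)

lemma iv_add (k l : ι → ℤ) : iv (k + l) = iv k + iv l := by ext; simp [iv]

lemma finite_iv (M : ℝ) : {k : ι → ℤ | ‖iv k‖ ≤ M}.Finite := by
  classical
  refine (Set.finite_Icc (fun _ : ι => -⌈M⌉) (fun _ => ⌈M⌉)).subset ?_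
  intro k hk
  have h : ∀ i, |(k i : ℝ)| ≤ M := fun i => (norm_le_pi_norm (iv k) i).trans hk
  refine ⟨fun i => ?_, fun i => ?_⟩
  · have := (abs_le.1 (h i)).1
    have h2 := Int.le_ceil M
    have : (-⌈M⌉ : ℝ) ≤ k i := by linarith
    exact_mod_cast this
  · have := (abs_le.1 (h i)).2
    have h2 := Int.le_ceil M
    have : (k i : ℝ) ≤ ⌈M⌉ := by linarith
    exact_mod_cast this

def perd (g : (ι → ℝ) → ℂ) (x : ι → ℝ) : ℂ := ∑ᶠ k : ι → ℤ, g (x + iv k)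

lemma perd_cont {g : (ι → ℝ) → ℂ} (hg : Continuous g) {B : ℝ} (hB : ∀ x, B < ‖x‖ → g x = 0) : Continuous (perd g) := by
  refine continuous_finsum (fun k => by fun_prop) ?_
  intro x
  refine ⟨Metric.ball x 1, Metric.ball_mem_nhds x one_pos, (finite_iv (B + ‖x‖ + 1)).subset ?_⟩
  rintro k ⟨y, hy1, hy2⟩
  have h1 : ‖y + iv k‖ ≤ B := by
    by_contra h
    exact hy1 (hB _ (not_le.1 h))
  have h2 : ‖y - x‖ < 1 := by simpa [dist_eq_norm] using hy2
  have h3 : iv k = (y + iv k) - (y - x) - x := by abel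
  show ‖iv k‖ ≤ _
  rw [h3]
  have := norm_sub_le ((y + iv k) - (y - x)) x
  have := norm_sub_le (y + iv k) (y - x)
  linarith

lemma perd_add (g : (ι → ℝ) → ℂ) (x : ι → ℝ) (l : ι → ℤ) : perd g (x + iv l) = perd g x := by
  unfold perd
  rw [← finsum_comp_equiv (Equiv.addLeft l) (f := fun k => g (x + iv k))]
  refine finsum_congr fun k => ?_
  simp [iv_add, add_assoc]

lemma quot_pi : IsOpenQuotientMap (fun (x : ι → ℝ) => (fun i => (x i : UnitAddCircle) : UnitAddTorus ι)) := 
  IsOpenQuotientMap.piMap (fun _ => QuotientAddGroup.isOpenQuotientMap_mk)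

lemma perd_descend {g : (ι → ℝ) → ℂ} (hg : Continuous g) {B : ℝ} (hB : ∀ x, B < ‖x‖ → g x = 0) : 
    ∃ f : C(UnitAddTorus ι, ℂ), ∀ x : ι → ℝ, f (fun i => (x i : UnitAddCircle)) = perd g x := by
  have hq := (quot_pi (ι := ι)).isQuotientMap
  let F : C(ι → ℝ, ℂ) := ⟨perd g, perd_cont hg hB⟩
  let q : C(ι → ℝ, UnitAddTorus ι) := ⟨_, hq.continuous⟩
  have hq' : IsQuotientMap q := hq
  have hf : Function.FactorsThrough F q := by
    intro x y hxy
    have h1 : ∀ i, ∃ k : ℤ, x i = y i + k := by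
      intro i
      have := congrFun hxy i
      have h2 : ((x i : ℝ) : UnitAddCircle) = y i := this
      rw [← sub_eq_zero, ← AddCircle.coe_sub, AddCircle.coe_eq_zero_iff] at h2
      obtain ⟨k, hk⟩ := h2
      refine ⟨k, ?_⟩
      simp at hk
      linarith
    choose k hk using h1
    have : x = y + iv k := by ext i; simp [iv, hk]
    show perd g x = perd g y
    rw [this, perd_add]
  refine ⟨hq'.lift F hf, fun x => ?_⟩
  have := DFunLike.congr_fun (hq'.lift_comp F hf) x
  exact this

def cube (k : ι → ℤ) : Set (ι → ℝ) := {x | ∀ i, x i ∈ Set.Ioc ((k i : ℝ)) (k i + 1)}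

lemma cube_meas (k : ι → ℤ) : MeasurableSet (cube k) := by
  have : cube k = Set.pi Set.univ (fun i => Set.Ioc ((k i : ℝ)) (k i + 1)) := by ext; simp [cube]
  rw [this]
  exact MeasurableSet.univ_pi fun i => measurableSet_Ioc

lemma integral_cubes {F : (ι → ℝ) → ℂ} (hF : Integrable F) : 
    HasSum (fun k : ι → ℤ => ∫ x in cube 0, F (x + iv k)) (∫ x, F x) := by
  have h1 : ∀ k : ι → ℤ, ∫ x in cube 0, F (x + iv k) = ∫ x in cube k, F x := by
    intro k
    have h := (measurePreserving_add_right (volume : Measure (ι → ℝ)) (iv k)).setIntegral_preimage_emb 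
      (measurableEmbedding_addRight (iv k)) F (cube k)
    rw [← h]
    congr 2
    ext x
    simp only [cube, iv, Set.mem_setOf_eq, Set.mem_preimage, Pi.add_apply, Pi.zero_apply, Set.mem_Ioc, Int.cast_zero]
    refine forall_congr' fun i => and_congr ?_ ?_ <;> constructor <;> intro h <;> linarith
  simp_rw [h1]
  have hU : (⋃ k : ι → ℤ, cube k) = Set.univ := by
    ext x
    simp only [Set.mem_iUnion, Set.mem_univ, iff_true]
    refine ⟨fun i => ⌈x i⌉ - 1, fun i => ⟨?_, ?_⟩⟩
    · push_cast; linarith [Int.ceil_lt_add_one (x i)]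
    · push_cast; linarith [Int.le_ceil (x i)]
  have hd : Pairwise (Function.onFun Disjoint (cube : (ι → ℤ) → Set (ι → ℝ))) := by
    intro k l hkl
    rw [Function.onFun, Set.disjoint_left]
    intro x hk hl
    apply hkl
    ext i
    have a1 := hk i
    have a2 := hl i
    have b1 : (k i : ℝ) < l i + 1 := a1.1.trans_le a2.2
    have b2 : (l i : ℝ) < k i + 1 := a2.1.trans_le a1.2
    have b1' : k i < l i + 1 := by exact_mod_cast b1
    have b2' : l i < k i + 1 := by exact_mod_cast b2
    omega
  have := hasSum_integral_iUnion (f := F) (μ := volume) (fun k => cube_meas k) hd (by rw [hU]; exact hF.integrableOn)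
  rwa [hU, setIntegral_univ] at this

def ghat (g : (ι → ℝ) → ℂ) (k : ι → ℤ) : ℂ := ∫ x : ι → ℝ, Complex.exp (Complex.I * (-(2 * Real.pi * ∑ i, k i * x i) : ℝ)) * g x

lemma mF_apply (n : ι → ℤ) (x : ι → ℝ) : UnitAddTorus.mFourier (-n) (fun i => (x i : UnitAddCircle)) = 
    Complex.exp (Complex.I * (-(2 * Real.pi * ∑ i, n i * x i) : ℝ)) := by
  simp only [UnitAddTorus.mFourier, ContinuousMap.coe_mk, Pi.neg_apply]
  simp_rw [fourier_coe_apply]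
  rw [← Complex.exp_sum]
  congr 1
  push_cast
  rw [Finset.mul_sum, ← Finset.sum_neg_distrib, Finset.mul_sum]
  refine Finset.sum_congr rfl fun i _ => ?_
  simp
  ring

theorem poisson {g : (ι → ℝ) → ℂ} (hg : Continuous g) (hs : HasCompactSupport g) (hsum : Summable (ghat g)) : 
    HasSum (ghat g) (∑ᶠ k : ι → ℤ, g (iv k)) := by
  classical
  obtain ⟨B, hB⟩ : ∃ B, ∀ x, B < ‖x‖ → g x = 0 := by
    obtain ⟨B, hB⟩ := hs.isCompact.isBounded.exists_norm_le
    refine ⟨B, fun x hx => ?_⟩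
    by_contra h
    exact absurd (hB x (subset_tsupport _ h)) (not_le.2 hx)
  obtain ⟨f, hf⟩ := perd_descend hg hB
  have hcoef : UnitAddTorus.mFourierCoeff f = ghat g := by
    ext n
    rw [UnitAddTorus.mFourierCoeff_eq_integral f n (fun _ => 0)]
    have hset : {x : ι → ℝ | ∀ i, x i ∈ Set.Ioc ((fun _ => 0 : ι → ℝ) i) ((fun _ => 0 : ι → ℝ) i + 1)} = cube 0 := by
      ext x; simp [cube]
    rw [hset]
    let E : (ι → ℝ) → ℂ := fun x => Complex.exp (Complex.I * (-(2 * Real.pi * ∑ i, n i * x i) : ℝ))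
    have hE : Continuous E := by simp only [E]; fun_prop
    have hEp : ∀ x k, E (x + iv k) = E x := by
      intro x k
      simp only [E]
      rw [← mF_apply, ← mF_apply]
      congr 1
      ext i
      simp [iv]
    have hFc : Continuous (fun x => E x * g x) := hE.mul hg
    have hFs : HasCompactSupport (fun x => E x * g x) := hs.mul_left
    have hI : Integrable (fun x => E x * g x) volume := hFc.integrable_of_hasCompactSupport hFs
    let A := (finite_iv (ι := ι) (B + 1)).toFinset
    have hA : ∀ x ∈ cube (0 : ι → ℤ), ∀ k, k ∉ A → g (x + iv k) = 0 := by
      intro x hx k hk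
      apply hB
      have h1 : ‖x‖ ≤ 1 := by
        refine (pi_norm_le_iff_of_nonneg zero_le_one).2 fun i => ?_
        have := hx i
        simp at this
        rw [Real.norm_eq_abs, abs_le]; constructor <;> linarith [this.1, this.2]
      have h2 : B + 1 < ‖iv k‖ := by
        simpa [A] using hk
      have h3 : iv k = (x + iv k) - x := by abel
      have := norm_sub_le (x + iv k) x
      rw [← h3] at this
      linarith
    have h1 : ∫ x in cube 0, UnitAddTorus.mFourier (-n) (fun i => (x i : UnitAddCircle)) • f (fun i => (x i : UnitAddCircle)) = 
        ∫ x in cube 0, ∑ k ∈ A, E (x + iv k) * g (x + iv k) := by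
      refine setIntegral_congr_fun (cube_meas 0) fun x hx => ?_
      rw [hf, mF_apply, smul_eq_mul, perd, finsum_eq_sum_of_support_subset (s := A), Finset.mul_sum]
      · refine Finset.sum_congr rfl fun k _ => ?_
        rw [hEp]
      · intro k hk
        by_contra h
        exact hk (hA x hx k (by simpa using h))
    rw [h1, integral_finset_sum]
    · have h2 := integral_cubes hI
      have h3 : HasSum (fun k : ι → ℤ => ∫ x in cube 0, E (x + iv k) * g (x + iv k)) (∑ k ∈ A, ∫ x in cube 0, E (x + iv k) * g (x + iv k)) := by
        refine hasSum_sum_of_ne_finset_zero fun k hk => ?_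
        refine (setIntegral_congr_fun (cube_meas 0) fun x hx => ?_).trans (integral_zero _ _)
        simp [hA x hx k hk]
      exact h3.unique h2
    · intro k _
      exact (hI.comp_add_right (iv k)).integrableOn
  have h := UnitAddTorus.hasSum_mFourier_series_apply_of_summable (f := f) (by rw [hcoef]; exact hsum) 0
  rw [hcoef] at h
  have h0 : f 0 = ∑ᶠ k : ι → ℤ, g (iv k) := by
    have := hf 0
    simp only [perd, zero_add] at this
    rw [← this]; rfl
  rw [h0] at h
  convert h using 2 with k
  have : UnitAddTorus.mFourier k (0 : UnitAddTorus ι) = 1 := by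
    simp [UnitAddTorus.mFourier]
  simp [this]

end Landau

namespace Landau
open scoped ContDiff
open MeasureTheory

variable {ι : Type} [Fintype ι]

lemma integral_cubes_real {F : (ι → ℝ) → ℝ} (hF : Integrable F) : 
    HasSum (fun k : ι → ℤ => ∫ x in cube 0, F (x + iv k)) (∫ x, F x) := by
  have h := integral_cubes (F := fun x => (F x : ℂ)) hF.ofReal
  have h2 := Complex.hasSum_re h
  convert h2 using 1
  · ext k
    rw [integral_complex_ofReal, Complex.ofReal_re]
  · rw [integral_complex_ofReal, Complex.ofReal_re]

def phi1 (n : ℕ) (y : ℝ) : ℝ := y ^ (-((n : ℝ) + 1) / 2) * min 1 (1 / y ^ n)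

lemma phi1_nonneg (n : ℕ) {y : ℝ} (hy : 0 ≤ y) : 0 ≤ phi1 n y := by unfold phi1; positivity

lemma phi1_anti (n : ℕ) {y z : ℝ} (hy : 0 < y) (h : y ≤ z) : phi1 n z ≤ phi1 n y := by
  unfold phi1
  have hz := hy.trans_le h
  refine mul_le_mul ?_ ?_ (by positivity) (by positivity)
  · exact Real.rpow_le_rpow_of_nonpos hy h (by have : (0:ℝ) ≤ n := by positivity
                                               linarith)
  · exact min_le_min le_rfl (by gcongr)

lemma phi1_integrable {n : ℕ} (hn : 2 ≤ n) (hc : Fintype.card ι = n) : Integrable (fun x : ι → ℝ => phi1 n ‖x‖) := by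
  have hn' : (2:ℝ) ≤ n := by exact_mod_cast hn
  haveI : Nonempty ι := Fintype.card_pos_iff.1 (by omega)
  rw [integrable_fun_norm_addHaar (volume : Measure (ι → ℝ)) (f := phi1 n)]
  have hd : Module.finrank ℝ (ι → ℝ) = n := by simp [hc]
  rw [hd, ← Set.Ioc_union_Ioi_eq_Ioi (zero_le_one (α := ℝ))]
  have hmeas : Measurable (fun y : ℝ => y ^ (n-1) • phi1 n y) := by
    unfold phi1
    fun_prop
  refine IntegrableOn.union ?_ ?_
  · have h1 : IntegrableOn (fun y : ℝ => y ^ (((n:ℝ) - 3) / 2)) (Set.Ioc 0 1) := by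
      rw [← intervalIntegrable_iff_integrableOn_Ioc_of_le zero_le_one]
      exact intervalIntegral.intervalIntegrable_rpow' (by linarith)
    refine Integrable.mono' h1 hmeas.aestronglyMeasurable ?_
    filter_upwards [ae_restrict_mem measurableSet_Ioc] with y hy
    have hy0 := hy.1
    rw [smul_eq_mul, Real.norm_of_nonneg (mul_nonneg (by positivity) (phi1_nonneg n hy0.le)), phi1]
    calc y ^ (n-1) * (y ^ (-((n : ℝ) + 1) / 2) * min 1 (1 / y ^ n)) ≤ y ^ (n-1) * (y ^ (-((n : ℝ) + 1) / 2) * 1) := by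
          gcongr; exact min_le_left _ _
      _ = _ := by
        rw [mul_one, ← Real.rpow_natCast, ← Real.rpow_add hy0, Nat.cast_sub (by omega)]
        congr 1; push_cast; ring
  · have h1 : IntegrableOn (fun y : ℝ => y ^ (-((n:ℝ) + 3) / 2)) (Set.Ioi 1) := 
      integrableOn_Ioi_rpow_of_lt (by linarith) one_pos
    refine Integrable.mono' h1 hmeas.aestronglyMeasurable ?_
    filter_upwards [ae_restrict_mem measurableSet_Ioi] with y hy
    have hy0 : 0 < y := zero_lt_one.trans hy
    rw [smul_eq_mul, Real.norm_of_nonneg (mul_nonneg (by positivity) (phi1_nonneg n hy0.le)), phi1]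
    calc y ^ (n-1) * (y ^ (-((n : ℝ) + 1) / 2) * min 1 (1 / y ^ n)) ≤ y ^ (n-1) * (y ^ (-((n : ℝ) + 1) / 2) * (1 / y ^ n)) := by
          gcongr; exact min_le_right _ _
      _ = _ := by
        rw [one_div, ← Real.rpow_natCast, ← Real.rpow_natCast y n, ← Real.rpow_neg hy0.le, ← Real.rpow_add hy0, ← Real.rpow_add hy0, Nat.cast_sub (by omega)]
        congr 1; push_cast; ring

lemma one_le_norm_iv {k : ι → ℤ} (hk : k ≠ 0) : 1 ≤ ‖iv k‖ := by
  obtain ⟨i, hi⟩ := Function.ne_iff.1 hk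
  refine le_trans ?_ (norm_le_pi_norm (iv k) i)
  simp only [iv, Real.norm_eq_abs]
  exact_mod_cast Int.one_le_abs hi

lemma vol_cube : volume (cube (0 : ι → ℤ)) = 1 := by
  have : cube (0 : ι → ℤ) = Set.pi Set.univ (fun i => Set.Ioc (0 : ℝ) 1) := by ext; simp [cube]
  rw [this, volume_pi_pi]
  simp

lemma lat_sum {n : ℕ} (hn : 2 ≤ n) (hc : Fintype.card ι = n) : ∃ B : ℝ, 0 ≤ B ∧ ∀ l : ℝ, 0 < l → 
    Summable (fun k : ι → ℤ => if k = 0 then 0 else phi1 n (l * ‖iv k‖)) ∧ 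
    ∑' k : ι → ℤ, (if k = 0 then 0 else phi1 n (l * ‖iv k‖)) ≤ B / l ^ n := by
  haveI : Nonempty ι := Fintype.card_pos_iff.1 (by omega)
  have hI := phi1_integrable hn hc
  have hI0 : 0 ≤ ∫ x : ι → ℝ, phi1 n ‖x‖ := integral_nonneg fun x => phi1_nonneg n (norm_nonneg _)
  refine ⟨2 ^ n * ∫ x : ι → ℝ, phi1 n ‖x‖, by positivity, fun l hl => ?_⟩
  have hl2 : 0 < l / 2 := by positivity
  let F : (ι → ℝ) → ℝ := fun x => phi1 n ‖(l / 2) • x‖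
  have hF : Integrable F := hI.comp_smul hl2.ne'
  have hFi : ∫ x, F x = 2 ^ n * (∫ x : ι → ℝ, phi1 n ‖x‖) / l ^ n := by
    have := Measure.integral_comp_smul (volume : Measure (ι → ℝ)) (fun x => phi1 n ‖x‖) (l / 2)
    have hd : Module.finrank ℝ (ι → ℝ) = n := by simp [hc]
    rw [hd] at this
    simp only [F]
    rw [this, abs_of_pos (by positivity), smul_eq_mul, div_pow]
    field_simp
  have hS := integral_cubes_real hF
  have hF0 : ∀ x, 0 ≤ F x := fun x => phi1_nonneg n (norm_nonneg _)
  have hle : ∀ k : ι → ℤ, (if k = 0 then 0 else phi1 n (l * ‖iv k‖)) ≤ ∫ x in cube 0, F (x + iv k) := by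
    intro k
    split_ifs with hk
    · exact integral_nonneg fun x => hF0 _
    · have h1 : phi1 n (l * ‖iv k‖) = ∫ x in cube (0 : ι → ℤ), phi1 n (l * ‖iv k‖) := by
        rw [setIntegral_const, Measure.real, vol_cube]; simp
      rw [h1]
      refine setIntegral_mono_on_ae ?_ (hF.comp_add_right (iv k)).integrableOn (cube_meas 0) ?_
      · exact integrableOn_const (by rw [vol_cube]; simp)
      · have : ∀ᵐ x : ι → ℝ, x ≠ - iv k := compl_mem_ae_iff.2 (measure_singleton _)
        filter_upwards [this] with x hx hx1
        have hx2 : ‖x‖ ≤ 1 := by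
          refine (pi_norm_le_iff_of_nonneg zero_le_one).2 fun i => ?_
          have := hx1 i
          simp at this
          rw [Real.norm_eq_abs, abs_le]; constructor <;> linarith [this.1, this.2]
        simp only [F]
        rw [norm_smul, Real.norm_of_nonneg hl2.le]
        have h3 : 0 < ‖x + iv k‖ := norm_pos_iff.2 fun h => hx (eq_neg_of_add_eq_zero_left h)
        have h4 := norm_add_le x (iv k)
        have h5 := one_le_norm_iv hk
        refine phi1_anti n (by positivity) ?_
        nlinarith
  have h0 : ∀ k : ι → ℤ, 0 ≤ (if k = 0 then 0 else phi1 n (l * ‖iv k‖)) := by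
    intro k
    split_ifs
    · exact le_rfl
    · exact phi1_nonneg n (by positivity)
  have hs := Summable.of_nonneg_of_le h0 hle hS.summable
  refine ⟨hs, ?_⟩
  rw [← hFi, ← hS.tsum_eq]
  exact hs.tsum_le_tsum hle hS.summable

variable {R C : Type} [Fintype R] [Fintype C]

/-- every real functional is a pairing -/
lemma pair_surj (f : VV R C →ₗ[ℝ] ℝ) : ∃ ξ : VV R C, ∀ v, f v = pair ξ v := by
  have hinj : Function.Injective (LinearMap.mk₂ ℝ (pair (R := R) (C := C)) (fun x y z => add_pair z x y) (fun c x y => smul_pair y c x)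
      (fun x y z => pair_add x y z) (fun c x y => pair_smul x c y)) := by
    rw [← LinearMap.ker_eq_bot, LinearMap.ker_eq_bot']
    intro m hm
    have h1 : pair m (vconj m) = 0 := by
      have := LinearMap.congr_fun hm (vconj m)
      simpa using this
    have h2 : ‖m‖ ^ 2 ≤ pair m (vconj m) := by
      refine (norm_sq_le_sum m).trans (le_of_eq ?_)
      simp only [pair, vconj]
      congr 1
      · exact Finset.sum_congr rfl fun w _ => sq _
      · refine Finset.sum_congr rfl fun w _ => ?_
        rw [Complex.mul_conj, Complex.normSq_eq_norm_sq]; simp [← Complex.ofReal_pow]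
    rw [h1] at h2
    have : ‖m‖ = 0 := by nlinarith [norm_nonneg m]
    exact norm_eq_zero.1 this
  have hs := (LinearMap.injective_iff_surjective_of_finrank_eq_finrank (Subspace.dual_finrank_eq).symm).1 hinj
  obtain ⟨ξ, h⟩ := hs f
  exact ⟨ξ, fun v => by rw [← h]; rfl⟩

lemma norm_mulV_le (x y : VV R C) : ‖x * y‖ ≤ ‖x‖ * ‖y‖ := by
  refine norm_le_of_coords (by positivity) (fun w => ?_) (fun w => ?_)
  · rw [Prod.fst_mul, Pi.mul_apply, abs_mul]
    exact mul_le_mul (coord1_le x w) (coord1_le y w) (abs_nonneg _) (norm_nonneg _)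
  · rw [Prod.snd_mul, Pi.mul_apply, norm_mul]
    exact mul_le_mul (coord2_le x w) (coord2_le y w) (norm_nonneg _) (norm_nonneg _)

lemma mul_inv_of_nrm {b : VV R C} (hb : nrmV b ≠ 0) : b * b⁻¹ = 1 := by
  unfold nrmV at hb
  have h1 := Finset.prod_ne_zero_iff.1 (left_ne_zero_of_mul hb)
  have h2 := Finset.prod_ne_zero_iff.1 (right_ne_zero_of_mul hb)
  ext w
  · have := h1 w (Finset.mem_univ _)
    simp [abs_ne_zero.1 this]
  · have := h2 w (Finset.mem_univ _)
    have h3 : b.2 w ≠ 0 := by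
      intro h
      rw [h] at this; simp at this
    simp [h3]

end Landau

namespace Landau
open scoped ContDiff
open MeasureTheory

variable {ι : Type} [Fintype ι]
variable {R C : Type} [Fintype R] [Fintype C]

lemma finrank_VV : Module.finrank ℝ (VV R C) = dimV R C := by
  simp [VV, dimV, Module.finrank_prod, Module.finrank_pi_fintype, mul_comm]

lemma continuous_pair_right (ξ : VV R C) : Continuous (fun y => pair ξ y) := continuous_pair ξ

lemma ghat_formula (A : (ι → ℝ) ≃L[ℝ] VV R C) : ∃ cA : ℝ, 0 ≤ cA ∧ ∀ (T : ℝ) (_ : 0 < T) (b : VV R C) (_ : nrmV b = 1) 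
    (F : VV R C → ℂ) (_ : Continuous F) (η : VV R C) (k : ι → ℤ) (_ : ∀ x, pair η (A x) = -(2 * Real.pi * ∑ i, k i * x i)),
    ghat (fun x => F (T⁻¹ • (b * A x))) k = cA * T ^ (dimV R C) * ∫ y, F y * Complex.exp (Complex.I * (pair (T • (η * b⁻¹)) y : ℝ)) := by
  haveI : ((volume : Measure (ι → ℝ)).map A).IsAddHaarMeasure := ContinuousLinearEquiv.isAddHaarMeasure_map A volume
  obtain ⟨s, hs⟩ : ∃ s : NNReal, (volume : Measure (ι → ℝ)).map A = s • (volume : Measure (VV R C)) := 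
    ⟨_, Measure.isAddLeftInvariant_eq_smul _ _⟩
  refine ⟨s, s.2, fun T hT b hb F hF η k hη => ?_⟩
  have hb' : b * b⁻¹ = 1 := mul_inv_of_nrm (by rw [hb]; exact one_ne_zero)
  let H2 : VV R C → ℂ := fun y => F y * Complex.exp (Complex.I * (pair (T • (η * b⁻¹)) y : ℝ))
  have hH2 : Continuous H2 := by
    have := continuous_pair_right (T • (η * b⁻¹))
    fun_prop
  have e1 : ∀ x : ι → ℝ, Complex.exp (Complex.I * (-(2 * Real.pi * ∑ i, k i * x i) : ℝ)) * F (T⁻¹ • (b * A x)) = H2 (T⁻¹ • mulV b (A x)) := by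
    intro x
    simp only [H2]
    rw [mulV_apply, ← hη, mul_comm, smul_pair, pair_smul, ← pair_mul, ← mul_assoc b⁻¹, mul_comm b⁻¹, hb', one_mul, mul_inv_cancel_left₀ hT.ne']
  have hdet : |(mulV b).det| = 1 := by rw [det_mulV, hb]
  have hm : (volume : Measure (VV R C)).map (mulV b) = volume := by
    have h0 : LinearMap.det ((mulV b : VV R C →L[ℝ] VV R C) : VV R C →ₗ[ℝ] VV R C) ≠ 0 := by
      intro h
      have : (mulV b).det = 0 := h
      rw [this] at hdet; simp at hdet
    have := Measure.map_linearMap_addHaar_eq_smul_addHaar (volume : Measure (VV R C)) h0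
    rw [abs_inv] at this
    have h2 : |LinearMap.det ((mulV b : VV R C →L[ℝ] VV R C) : VV R C →ₗ[ℝ] VV R C)| = 1 := hdet
    rw [h2] at this
    simpa using this
  have key : ∀ G : VV R C → ℂ, Continuous G → ∫ x : ι → ℝ, G (T⁻¹ • mulV b (A x)) = s * T ^ (dimV R C) * ∫ y, G y := by
    intro G hG
    have c1 : Continuous (fun y : VV R C => G (T⁻¹ • y)) := by fun_prop
    have c2 : Continuous (fun y : VV R C => G (T⁻¹ • mulV b y)) := c1.comp (mulV b).continuous
    have i1 : ∫ x : ι → ℝ, G (T⁻¹ • mulV b (A x)) = ∫ y, G (T⁻¹ • mulV b y) ∂((volume : Measure (ι → ℝ)).map A) := 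
      (integral_map A.continuous.aemeasurable c2.aestronglyMeasurable).symm
    rw [i1, hs, integral_smul_nnreal_measure]
    have i2 : ∫ y, G (T⁻¹ • mulV b y) = ∫ y, G (T⁻¹ • y) := by
      have := integral_map (μ := (volume : Measure (VV R C))) (mulV b).continuous.aemeasurable (f := fun y => G (T⁻¹ • y)) c1.aestronglyMeasurable
      rw [hm] at this
      exact this.symm
    rw [i2, Measure.integral_comp_smul, finrank_VV, inv_pow, inv_inv, abs_of_pos (by positivity), NNReal.smul_def]
    simp only [Complex.real_smul, Complex.ofReal_pow]
    rw [mul_assoc]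
  unfold ghat
  rw [integral_congr_ae (Eventually.of_forall e1), key H2 hH2]

theorem lattice_main (A : (ι → ℝ) ≃L[ℝ] VV R C) (hn : 2 ≤ dimV R C) {ρ : ℝ} (hρ0 : 0 < ρ) 
    (hρ : 1000 * (dimV R C : ℝ) ^ 2 * ρ ≤ 1) {a : VV R C → ℝ} (ha : ContDiff ℝ ∞ a) (has : ∀ p, ρ < ‖p‖ → a p = 0)
    (Bb : ℝ) : ∃ cM B : ℝ, 0 ≤ B ∧ ∀ α β δ, Adm α β δ → ∀ T : ℝ, 1 ≤ T → ∀ b : VV R C, nrmV b = 1 → ‖b‖ ≤ Bb → 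
      |∑ᶠ k : ι → ℤ, f0 a α β δ (T⁻¹ • (b * A (iv k))) - cM * T ^ (dimV R C) * ∫ r : ℝ, r ^ (dimV R C - 1) * chi α β δ r| 
        ≤ B * δ ^ (-((dimV R C : ℝ) - 1) / 2) := by
  set n := dimV R C with hndef
  have hn' : (2:ℝ) ≤ n := by exact_mod_cast hn
  have hρ1 : ρ ≤ 1 := by nlinarith
  let μ : Measure (EE R C) := Measure.addHaar
  have hcard : Fintype.card ι = n := by
    rw [hndef, ← finrank_VV, ← A.toLinearEquiv.finrank_eq]; simp
  obtain ⟨cA, hcA, hgf⟩ := ghat_formula A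
  obtain ⟨cF, hcF, hfe⟩ := fourier_eq μ (show 1 ≤ dimV R C by omega)
  obtain ⟨Bs, hBs, hlat⟩ := lat_sum hn hcard
  -- the dual vectors
  have hη : ∀ k : ι → ℤ, ∃ η : VV R C, ∀ x, pair η (A x) = -(2 * Real.pi * ∑ i, k i * x i) := by
    intro k
    let f : (ι → ℝ) →ₗ[ℝ] ℝ := (-(2 * Real.pi)) • ∑ i, (k i : ℝ) • LinearMap.proj i
    obtain ⟨η, h⟩ := pair_surj (f.comp (A.symm : VV R C →L[ℝ] (ι → ℝ)).toLinearMap)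
    refine ⟨η, fun x => ?_⟩
    rw [← h]
    simp [f]
  choose η hη using hη
  set NA := ‖(A : (ι → ℝ) →L[ℝ] VV R C)‖ + 1 with hNA
  have hNA0 : 0 < NA := by positivity
  have hηlow : ∀ k, ‖iv k‖ ≤ n * NA * ‖η k‖ := by
    intro k
    by_cases hk : k = 0
    · subst hk
      have : iv (0 : ι → ℤ) = 0 := by ext; simp [iv]
      rw [this, norm_zero]; positivity
    have h1 := abs_pair_le (η k) (A (iv k))
    rw [hη, abs_neg, ← hndef] at h1
    have h2 : ‖iv k‖ ^ 2 ≤ ∑ i, (k i : ℝ) * iv k i := by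
      haveI : Nonempty ι := Fintype.card_pos_iff.1 (by omega)
      obtain ⟨i, hi⟩ := Finite.exists_max (fun i => ‖iv k i‖)
      have h3 : ‖iv k‖ ≤ ‖iv k i‖ := (pi_norm_le_iff_of_nonempty _).2 hi
      calc ‖iv k‖ ^ 2 ≤ ‖iv k i‖ ^ 2 := by gcongr
        _ = (k i : ℝ) * iv k i := by simp [iv, sq]
        _ ≤ _ := Finset.single_le_sum (f := fun i => (k i : ℝ) * iv k i) (fun j _ => by simp only [iv]; exact mul_self_nonneg _) (Finset.mem_univ i)
    have h4 : ‖A (iv k)‖ ≤ NA * ‖iv k‖ := ((A : (ι → ℝ) →L[ℝ] VV R C).le_opNorm _).trans (by gcongr; linarith)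
    have h5 := one_le_norm_iv hk
    rw [abs_mul, abs_of_pos (by positivity : 0 < 2 * Real.pi), abs_of_nonneg ((sq_nonneg _).trans h2)] at h1
    have h6 : ‖iv k‖ ^ 2 ≤ n * (‖η k‖ * (NA * ‖iv k‖)) := by
      have := Real.pi_gt_three
      calc ‖iv k‖ ^ 2 ≤ 2 * Real.pi * ‖iv k‖ ^ 2 := by nlinarith [sq_nonneg ‖iv k‖]
        _ ≤ 2 * Real.pi * ∑ i, (k i : ℝ) * iv k i := by gcongr
        _ ≤ _ := h1
        _ ≤ _ := by gcongr
    have h7 : ‖iv k‖ * ‖iv k‖ ≤ (n * NA * ‖η k‖) * ‖iv k‖ := by nlinarith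
    exact le_of_mul_le_mul_right h7 (by linarith)
  set B1 := max Bb 1 with hB1
  have hB10 : 0 < B1 := lt_max_of_lt_right one_pos
  set c1 := (n * NA * B1)⁻¹ with hc1
  have hc10 : 0 < c1 := by positivity
  obtain ⟨BF, hBF, hfb⟩ := fourier_bound μ (show 1 ≤ dimV R C by omega) hρ0 hρ ha has hc10
  refine ⟨cA * cF * ∫ p, a p ∂μ, cA * cF * BF * Bs / c1 ^ n, by positivity, fun α β δ hadm T hT b hb hbB => ?_⟩
  have hT0 : 0 < T := by linarith
  have hd := hadm.hd
  have hbb : b * b⁻¹ = 1 := mul_inv_of_nrm (by rw [hb]; exact one_ne_zero)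
  let g : (ι → ℝ) → ℂ := fun x => (f0 a α β δ (T⁻¹ • (b * A x)) : ℂ)
  have hf0c : Continuous (f0 a α β δ) := f0_continuous ha.continuous hρ1 has hadm
  have hgc : Continuous g := by
    have : Continuous fun x => f0 a α β δ (T⁻¹ • (b * A x)) := 
      hf0c.comp (by have := A.continuous; fun_prop)
    fun_prop
  have hgs : HasCompactSupport g := by
    have h1 : HasCompactSupport (fun y => (f0 a α β δ y : ℂ)) := (f0_hcs has hadm).comp_left Complex.ofReal_zero
    let e : (ι → ℝ) ≃ₜ VV R C := 
      { toFun := fun x => T⁻¹ • (b * A x)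
        invFun := fun y => A.symm (b⁻¹ * (T • y))
        left_inv := fun x => by
          simp only [smul_smul, mul_inv_cancel₀ hT0.ne', one_smul]
          rw [← mul_assoc, mul_comm b⁻¹, hbb, one_mul, A.symm_apply_apply]
        right_inv := fun y => by simp [← mul_assoc, hbb, smul_smul, hT0.ne']
        continuous_toFun := by have := A.continuous; fun_prop
        continuous_invFun := A.symm.continuous.comp (by fun_prop) }
    exact h1.comp_homeomorph e
  have hgh : ∀ k, ghat g k = cA * T ^ n * (cF * HH μ a α β δ (T • (η k * b⁻¹))) := by
    intro k
    rw [← hfe a ρ hρ1 ha.continuous has α β δ hadm]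
    exact hgf T hT0 b hb (fun y => (f0 a α β δ y : ℂ)) (by fun_prop) (η k) k (hη k)
  have hlow : ∀ k, c1 * T * ‖iv k‖ ≤ ‖T • (η k * b⁻¹)‖ := by
    intro k
    rw [norm_smul, Real.norm_of_nonneg hT0.le]
    have h1 : ‖η k‖ ≤ ‖η k * b⁻¹‖ * B1 := by
      calc ‖η k‖ = ‖η k * b⁻¹ * b‖ := by rw [mul_assoc, mul_comm b⁻¹, hbb, mul_one]
        _ ≤ ‖η k * b⁻¹‖ * ‖b‖ := norm_mulV_le _ _
        _ ≤ _ := by gcongr; exact hbB.trans (le_max_left _ _)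
    have h2 : c1 * ‖iv k‖ ≤ ‖η k * b⁻¹‖ := by
      rw [hc1, inv_mul_le_iff₀ (by positivity)]
      calc ‖iv k‖ ≤ n * NA * ‖η k‖ := hηlow k
        _ ≤ n * NA * (‖η k * b⁻¹‖ * B1) := by gcongr
        _ = _ := by ring
    calc c1 * T * ‖iv k‖ = T * (c1 * ‖iv k‖) := by ring
      _ ≤ _ := by gcongr
  have hHb : ∀ k, k ≠ 0 → ‖ghat g k‖ ≤ cA * T ^ n * cF * BF * δ ^ (((n:ℝ) + 1) / 2) * phi1 n (δ * c1 * T * ‖iv k‖) := by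
    intro k hk
    have h5 := one_le_norm_iv hk
    have h6 := hlow k
    set ξ := T • (η k * b⁻¹)
    have h7 : c1 ≤ ‖ξ‖ := by
      refine le_trans ?_ h6
      rw [mul_assoc]
      exact le_mul_of_one_le_right hc10.le (one_le_mul_of_one_le_of_one_le hT h5)
    have h8 : 0 < ‖ξ‖ := hc10.trans_le h7
    have h9 := hfb α β δ hadm ξ h7
    have h10 : BF * ‖ξ‖ ^ (-((n : ℝ) + 1) / 2) * min 1 (1 / (δ * ‖ξ‖) ^ n) = BF * (δ ^ (((n:ℝ) + 1) / 2) * phi1 n (δ * ‖ξ‖)) := by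
      rw [phi1, Real.mul_rpow hd.le h8.le, ← mul_assoc (δ ^ _), ← mul_assoc (δ ^ _), ← Real.rpow_add hd]
      have : ((n:ℝ) + 1) / 2 + -((n:ℝ) + 1) / 2 = 0 := by ring
      rw [this, Real.rpow_zero, one_mul]; ring
    rw [hgh, norm_mul, norm_mul, norm_mul, norm_pow, Complex.norm_of_nonneg hcA, Complex.norm_of_nonneg hT0.le, Complex.norm_of_nonneg hcF]
    have h11 : phi1 n (δ * ‖ξ‖) ≤ phi1 n (δ * c1 * T * ‖iv k‖) := by
      refine phi1_anti n (by positivity) ?_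
      calc δ * c1 * T * ‖iv k‖ = δ * (c1 * T * ‖iv k‖) := by ring
        _ ≤ _ := by gcongr
    calc cA * T ^ n * (cF * ‖HH μ a α β δ ξ‖) ≤ cA * T ^ n * (cF * (BF * (δ ^ (((n:ℝ) + 1) / 2) * phi1 n (δ * ‖ξ‖)))) := by
          rw [← h10]; gcongr
      _ ≤ cA * T ^ n * (cF * (BF * (δ ^ (((n:ℝ) + 1) / 2) * phi1 n (δ * c1 * T * ‖iv k‖)))) := by gcongr
      _ = _ := by ring
  obtain ⟨hs1, hs2⟩ := hlat (δ * c1 * T) (by positivity)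
  set D := cA * T ^ n * cF * BF * δ ^ (((n:ℝ) + 1) / 2) with hD
  let G0 : (ι → ℤ) → ℂ := fun k => if k = 0 then 0 else ghat g k
  have hG0b : ∀ k, ‖G0 k‖ ≤ D * (if k = 0 then 0 else phi1 n (δ * c1 * T * ‖iv k‖)) := by
    intro k
    simp only [G0]
    split_ifs with hk
    · simp
    · exact hHb k hk
  have hG0s : Summable G0 := Summable.of_norm_bounded (hs1.mul_left D) hG0b
  have hG0t : ‖∑' k, G0 k‖ ≤ D * (Bs / (δ * c1 * T) ^ n) := by
    refine (tsum_of_norm_bounded (hs1.mul_left D).hasSum hG0b).trans ?_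
    rw [tsum_mul_left]
    gcongr
  have hsplit : ghat g = fun k => G0 k + (if k = 0 then ghat g 0 else 0) := by
    ext k
    simp only [G0]
    split_ifs with hk
    · simp [hk]
    · simp
  have hsum2 : HasSum (ghat g) (∑' k, G0 k + ghat g 0) := by
    have h1 := hG0s.hasSum.add (hasSum_ite_eq (0 : ι → ℤ) (ghat g 0))
    rwa [← hsplit] at h1
  have hP := (poisson hgc hgs hsum2.summable).unique hsum2
  have hfin : ∑ᶠ k : ι → ℤ, g (iv k) = ((∑ᶠ k : ι → ℤ, f0 a α β δ (T⁻¹ • (b * A (iv k))) : ℝ) : ℂ) := by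
    have hfs : (Function.support fun k : ι → ℤ => f0 a α β δ (T⁻¹ • (b * A (iv k)))).Finite := by
      obtain ⟨M, hM⟩ := hgs.isCompact.isBounded.exists_norm_le
      refine (finite_iv M).subset fun k hk => hM _ (subset_tsupport _ ?_)
      simpa [g] using hk
    exact (AddMonoidHom.map_finsum (Complex.ofRealHom : ℝ →+ ℂ) hfs).symm
  have hmain : ghat g 0 = ((cA * cF * (∫ p, a p ∂μ) * T ^ n * ∫ r : ℝ, r ^ (n - 1) * chi α β δ r : ℝ) : ℂ) := by
    have hη0 : η 0 = 0 := by
      obtain ⟨y, hy⟩ := A.surjective (vconj (η 0))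
      have h1 := hη 0 y
      simp only [Pi.zero_apply, Int.cast_zero, zero_mul, Finset.sum_const_zero, mul_zero, neg_zero, hy] at h1
      have h2 : ‖η 0‖ ^ 2 ≤ pair (η 0) (vconj (η 0)) := by
        refine (norm_sq_le_sum (η 0)).trans (le_of_eq ?_)
        simp only [pair, vconj]
        congr 1
        · exact Finset.sum_congr rfl fun w _ => sq _
        · refine Finset.sum_congr rfl fun w _ => ?_
          rw [Complex.mul_conj, Complex.normSq_eq_norm_sq]; simp [← Complex.ofReal_pow]
      rw [h1] at h2
      have : ‖η 0‖ = 0 := by nlinarith [norm_nonneg (η 0)]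
      exact norm_eq_zero.1 this
    have hp0 : ∀ y, pair (0 : VV R C) y = 0 := fun y => by simp [pair]
    rw [hgh, hη0, zero_mul, smul_zero, HH]
    simp only [hp0, Complex.ofReal_zero, mul_zero, Complex.exp_zero, mul_one]
    simp_rw [integral_const_mul]
    rw [integral_mul_const, integral_complex_ofReal]
    have : ∫ r : ℝ, GG (n - 1) α β δ r = ((∫ r : ℝ, r ^ (n - 1) * chi α β δ r : ℝ) : ℂ) := by
      rw [← integral_complex_ofReal]
      refine integral_congr_ae (Eventually.of_forall fun r => ?_)
      simp [GG, chic_eq]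
    rw [← hndef, this]
    push_cast
    ring
  rw [hfin, hmain] at hP
  have hfinal : ‖∑' k, G0 k‖ = |∑ᶠ k : ι → ℤ, f0 a α β δ (T⁻¹ • (b * A (iv k))) - (cA * cF * ∫ p, a p ∂μ) * T ^ n * ∫ r : ℝ, r ^ (n - 1) * chi α β δ r| := by
    rw [← Real.norm_eq_abs, ← Complex.norm_real]
    congr 1
    rw [Complex.ofReal_sub, hP]; push_cast; ring
  rw [← hfinal]
  refine hG0t.trans (le_of_eq ?_)
  have hpw : δ ^ (((n:ℝ) + 1) / 2) = δ ^ (-((n:ℝ) - 1) / 2) * δ ^ n := by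
    rw [← Real.rpow_natCast, ← Real.rpow_add hd]; congr 1; ring
  rw [hD, hpw, mul_pow, mul_pow]
  field_simp

end Landau

namespace Landau
open scoped ContDiff
open MeasureTheory

variable {R C : Type} [Fintype R] [Fintype C]

lemma nrmV_nonneg (x : VV R C) : 0 ≤ nrmV x := by unfold nrmV; positivity

lemma nrmV_mul (x y : VV R C) : nrmV (x * y) = nrmV x * nrmV y := by
  unfold nrmV
  simp only [Prod.fst_mul, Prod.snd_mul, Pi.mul_apply, abs_mul, norm_mul, mul_pow, Finset.prod_mul_distrib]
  ring

lemma nrmV_smul {r : ℝ} (hr : 0 ≤ r) (x : VV R C) : nrmV (r • x) = r ^ (dimV R C) * nrmV x := by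
  unfold nrmV dimV
  simp only [Prod.smul_fst, Prod.smul_snd, Pi.smul_apply, smul_eq_mul, abs_mul, norm_smul, mul_pow, Finset.prod_mul_distrib, 
    Real.norm_eq_abs, abs_of_nonneg hr, Finset.prod_const, Finset.card_univ]
  ring

lemma continuous_nrmV : Continuous (nrmV : VV R C → ℝ) := by
  unfold nrmV; fun_prop

/-- the n-th root of the norm -/
def rad (x : VV R C) : ℝ := nrmV x ^ (1 / (dimV R C : ℝ))

lemma rad_nonneg (x : VV R C) : 0 ≤ rad x := Real.rpow_nonneg (nrmV_nonneg x) _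

lemma rad_pow (hn : 1 ≤ dimV R C) (x : VV R C) : rad x ^ (dimV R C) = nrmV x := by
  unfold rad
  rw [one_div, Real.rpow_inv_natCast_pow (nrmV_nonneg x) (by omega)]

lemma rad_mul (x y : VV R C) : rad (x * y) = rad x * rad y := by
  unfold rad; rw [nrmV_mul, Real.mul_rpow (nrmV_nonneg x) (nrmV_nonneg y)]

lemma rad_smul (hn : 1 ≤ dimV R C) {r : ℝ} (hr : 0 ≤ r) (x : VV R C) : rad (r • x) = r * rad x := by
  unfold rad
  rw [nrmV_smul hr, Real.mul_rpow (by positivity) (nrmV_nonneg x), one_div, Real.pow_rpow_inv_natCast hr (by omega)]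

lemma rad_pos {x : VV R C} (h : nrmV x ≠ 0) : 0 < rad x := 
  Real.rpow_pos_of_pos (lt_of_le_of_ne (nrmV_nonneg x) h.symm) _

lemma continuous_rad : Continuous (rad : VV R C → ℝ) := 
  continuous_nrmV.rpow_const (fun _ => Or.inr (by positivity))

lemma measurePreserving_mulV {b : VV R C} (hb : nrmV b = 1) : MeasurePreserving (mulV b) (volume : Measure (VV R C)) volume := by
  refine ⟨(mulV b).continuous.measurable, ?_⟩
  have hdet : |(mulV b).det| = 1 := by rw [det_mulV, hb]
  have h0 : LinearMap.det ((mulV b : VV R C →L[ℝ] VV R C) : VV R C →ₗ[ℝ] VV R C) ≠ 0 := by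
    intro h
    have : (mulV b).det = 0 := h
    rw [this] at hdet; simp at hdet
  have := Measure.map_linearMap_addHaar_eq_smul_addHaar (volume : Measure (VV R C)) h0
  rw [abs_inv] at this
  have h2 : |LinearMap.det ((mulV b : VV R C →L[ℝ] VV R C) : VV R C →ₗ[ℝ] VV R C)| = 1 := hdet
  rw [h2] at this
  simpa using this

lemma Psi_smul (hn : 1 ≤ dimV R C) (a : VV R C → ℝ) {r : ℝ} (hr : 0 < r) (y : VV R C) : Psi a (r • y) = Psi a y := by
  unfold Psi
  have hO : r • y ∈ Om R C ↔ y ∈ Om R C := by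
    simp only [Om, Set.mem_setOf_eq, Prod.smul_fst, Prod.smul_snd, Pi.smul_apply, smul_eq_mul, Complex.mem_slitPlane_iff]
    refine and_congr (forall_congr' fun w => mul_pos_iff_of_pos_left hr) (forall_congr' fun w => ?_)
    simp [hr, hr.ne']
  by_cases h : y ∈ Om R C
  · rw [Set.indicator_of_mem h, Set.indicator_of_mem (hO.2 h)]
    have : logV (r • y) = logV y + Real.log r • (1 : VV R C) := by
      ext w
      · have := h.1 w
        simp only [logV, Prod.smul_fst, Pi.smul_apply, smul_eq_mul, Prod.fst_add, Pi.add_apply, Prod.fst_one, Pi.one_apply, mul_one]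
        rw [Real.log_mul hr.ne' this.ne', add_comm]
      · have := Complex.slitPlane_ne_zero (h.2 w)
        simp only [logV, Prod.smul_snd, Pi.smul_apply, Complex.real_smul, Prod.snd_add, Pi.add_apply, Prod.snd_one, Pi.one_apply, mul_one]
        rw [Complex.log_ofReal_mul hr this, add_comm]
    rw [this, prE_add_smul hn]
  · rw [Set.indicator_of_notMem h, Set.indicator_of_notMem (fun h' => h (hO.1 h'))]

lemma Psi_measurable {a : VV R C → ℝ} (ha : Continuous a) : Measurable (Psi a) := by
  unfold Psi
  refine Measurable.indicator ?_ isOpen_Om.measurableSet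
  refine ha.measurable.comp (continuous_prE.measurable.comp ?_)
  unfold logV
  refine Measurable.prodMk ?_ ?_
  · exact measurable_pi_lambda _ fun w => Real.measurable_log.comp ((measurable_pi_apply w).comp measurable_fst)
  · exact measurable_pi_lambda _ fun w => Complex.measurable_log.comp ((measurable_pi_apply w).comp measurable_snd)

lemma Psi_nonneg {a : VV R C → ℝ} (ha : ∀ p, 0 ≤ a p) (y : VV R C) : 0 ≤ Psi a y := 
  Set.indicator_nonneg (fun _ _ => ha _) y

/-- shell of radius in [1/2,1] -/
def shell (R C : Type) [Fintype R] [Fintype C] : Set (VV R C) := {y | rad y ∈ Set.Icc (1/2:ℝ) 1}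

lemma shell_meas : MeasurableSet (shell R C) := continuous_rad.measurable measurableSet_Icc

def psiS (a : VV R C → ℝ) (x y : VV R C) : ENNReal := (shell R C).indicator (fun y => ENNReal.ofReal (Psi a (x * y))) y

def Cpsi (a : VV R C → ℝ) : ENNReal := ∫⁻ y, psiS a 1 y

lemma psiS_measurable {a : VV R C → ℝ} (ha : Continuous a) (x : VV R C) : Measurable (psiS a x) := by
  unfold psiS
  refine Measurable.indicator ?_ shell_meas
  refine ENNReal.measurable_ofReal.comp ((Psi_measurable ha).comp ?_)
  have : Continuous fun y : VV R C => x * y := by fun_prop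
  exact this.measurable

lemma lintegral_psiS (hn : 1 ≤ dimV R C) {a : VV R C → ℝ} (ha : Continuous a) {x : VV R C} (hx : nrmV x ≠ 0) : 
    ∫⁻ y, psiS a x y = Cpsi a := by
  have hr := rad_pos hx
  set x1 := (rad x)⁻¹ • x with hx1
  have hn1 : rad x1 = 1 := by rw [hx1, rad_smul hn (by positivity), inv_mul_cancel₀ hr.ne']
  have hn2 : nrmV x1 = 1 := by rw [← rad_pow hn, hn1, one_pow]
  have h1 : ∀ y, psiS a x y = psiS a 1 (mulV x1 y) := by
    intro y
    rw [mulV_apply]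
    unfold psiS
    have hs : x1 * y ∈ shell R C ↔ y ∈ shell R C := by simp only [shell, Set.mem_setOf_eq, rad_mul, hn1, one_mul]
    have hP : Psi a (1 * (x1 * y)) = Psi a (x * y) := by
      rw [one_mul, hx1, smul_mul_assoc, Psi_smul hn a (by positivity)]
    by_cases h : y ∈ shell R C
    · rw [Set.indicator_of_mem h, Set.indicator_of_mem (hs.2 h), hP]
    · rw [Set.indicator_of_notMem h, Set.indicator_of_notMem (fun h' => h (hs.1 h'))]
  simp_rw [h1]
  exact (measurePreserving_mulV hn2).lintegral_comp (psiS_measurable ha 1)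

lemma Cpsi_bounds (hn : 1 ≤ dimV R C) {ρ : ℝ} (hρ1 : ρ ≤ 1) {a : VV R C → ℝ} (ha : Continuous a) 
    (has : ∀ p, ρ < ‖p‖ → a p = 0) (ha0 : ∀ p, 0 ≤ a p) (ha1 : 0 < a 0) : Cpsi a ≠ 0 ∧ Cpsi a ≠ ⊤ := by
  have adm1 : Adm (1/2) (3/4) (1/4) := by constructor <;> norm_num
  have adm2 : Adm (1/4) 1 (1/4) := by constructor <;> norm_num
  constructor
  · have hc := f0_continuous ha hρ1 has adm1
    have hcs := f0_hcs has adm1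
    have hle : ∀ y, ENNReal.ofReal (f0 a (1/2) (3/4) (1/4) y) ≤ psiS a 1 y := by
      intro y
      unfold psiS
      by_cases h : y ∈ shell R C
      · rw [Set.indicator_of_mem h, one_mul]
        refine ENNReal.ofReal_le_ofReal ?_
        unfold f0
        exact mul_le_of_le_one_right (Psi_nonneg ha0 y) (chi_le_one _ _ _ _)
      · rw [Set.indicator_of_notMem h]
        have : chi (1/2) (3/4) (1/4) (rad y) = 0 := by
          refine chi_zero adm1 fun h' => h ?_
          have e : (3/4 + 1/4 : ℝ) = 1 := by norm_num
          rw [e] at h'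
          exact h'
        unfold f0
        unfold rad at this
        rw [this]; simp
    have hpos : 0 < ∫ y, f0 a (1/2) (3/4) (1/4) y := by
      refine hc.integral_pos_of_hasCompactSupport_nonneg_nonzero hcs (fun y => mul_nonneg (Psi_nonneg ha0 y) (chi_nonneg adm1 _)) 
        (x := vexp (Real.log (3/4) • (1 : VV R C))) ?_
      have hst : Real.log (3/4) • (1 : VV R C) ∈ strip R C := by
        intro w
        simp [Real.pi_pos]
      rw [f0_vexp _ _ _ _ hst, F1]
      have h1 : prE (Real.log (3/4) • (1 : VV R C)) = 0 := by
        have := prE_add_smul hn (0 : VV R C) (Real.log (3/4))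
        rw [zero_add] at this
        rw [this]
        exact prE_of_mem (Submodule.zero_mem _)
      have h2 : trL (Real.log (3/4) • (1 : VV R C)) / dimV R C = Real.log (3/4) := by
        have : (dimV R C : ℝ) ≠ 0 := by positivity
        rw [map_smul, trL_one, smul_eq_mul]; field_simp
      rw [h1, h2, Real.exp_log (by norm_num)]
      have h3 : chi (1/2) (3/4) (1/4) (3/4) = 1 := by
        unfold chi
        rw [Real.smoothTransition.one_of_one_le (by norm_num), Real.smoothTransition.zero_of_nonpos (by norm_num)]
        norm_num
      rw [h3, mul_one]
      exact ha1.ne'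
    have h4 : ENNReal.ofReal (∫ y, f0 a (1/2) (3/4) (1/4) y) = ∫⁻ y, ENNReal.ofReal (f0 a (1/2) (3/4) (1/4) y) :=
      ofReal_integral_eq_lintegral_ofReal (hc.integrable_of_hasCompactSupport hcs) 
        (Eventually.of_forall fun y => mul_nonneg (Psi_nonneg ha0 y) (chi_nonneg adm1 _))
    have h5 : 0 < Cpsi a := by
      refine lt_of_lt_of_le ?_ (lintegral_mono hle)
      rw [← h4]
      exact ENNReal.ofReal_pos.2 hpos
    exact h5.ne'
  · have hc := f0_continuous ha hρ1 has adm2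
    have hcs := f0_hcs has adm2
    have hle : ∀ y, psiS a 1 y ≤ ENNReal.ofReal (f0 a (1/4) 1 (1/4) y) := by
      intro y
      unfold psiS
      by_cases h : y ∈ shell R C
      · rw [Set.indicator_of_mem h, one_mul]
        refine ENNReal.ofReal_le_ofReal (le_of_eq ?_)
        have h3 : chi (1/4) 1 (1/4) (rad y) = 1 := by
          unfold chi
          rw [Real.smoothTransition.one_of_one_le, Real.smoothTransition.zero_of_nonpos, sub_zero]
          · linarith [h.2]
          · linarith [h.1]
        unfold rad at h3
        unfold f0
        rw [h3, mul_one]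
      · rw [Set.indicator_of_notMem h]
        exact bot_le
    refine ((lintegral_mono hle).trans_lt ?_).ne
    exact (hc.integrable_of_hasCompactSupport hcs).lintegral_lt_top

/-- f0 along normalised multipliers -/
lemma f0_scaled (hn : 1 ≤ dimV R C) (a : VV R C → ℝ) (α β δ : ℝ) {T : ℝ} (hT : 0 < T) {b x : VV R C} (hb : 0 < rad b) :
    f0 a α β δ (T⁻¹ • ((rad b)⁻¹ • b * x)) = Psi a (x * b) * chi α β δ (rad x / T) := by
  unfold f0
  congr 1
  · rw [Psi_smul hn a (by positivity), smul_mul_assoc, Psi_smul hn a (by positivity), mul_comm]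
  · congr 1
    change rad _ = _
    rw [rad_smul hn (by positivity), rad_mul, rad_smul hn (by positivity), inv_mul_cancel₀ hb.ne', one_mul]
    field_simp

lemma exists_bump {ρ : ℝ} (hρ : 0 < ρ) : ∃ a : VV R C → ℝ, ContDiff ℝ ∞ a ∧ (∀ p, ρ < ‖p‖ → a p = 0) ∧ (∀ p, 0 ≤ a p) ∧ 0 < a 0 := by
  let f : ContDiffBump (0 : VV R C) := ⟨ρ / 2, ρ, by positivity, by linarith⟩
  refine ⟨f, f.contDiff, fun p hp => ?_, fun p => f.nonneg, ?_⟩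
  · refine f.zero_of_le_dist ?_
    rw [dist_zero_right]; exact hp.le
  · exact f.pos_of_mem_ball (Metric.mem_ball_self hρ)

end Landau

namespace Landau
open scoped ContDiff Classical
open MeasureTheory NumberField NumberField.mixedEmbedding NumberField.InfinitePlace

variable (K : Type) [Field K] [NumberField K]

abbrev RK := {w : InfinitePlace K // IsReal w}
abbrev CK := {w : InfinitePlace K // IsComplex w}

lemma dimV_K : dimV (RK K) (CK K) = Module.finrank ℚ K := by
  rw [← finrank_VV]
  exact mixedEmbedding.finrank K

variable {K}

lemma nrmV_K (x : VV (RK K) (CK K)) : nrmV x = mixedEmbedding.norm x := by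
  rw [mixedEmbedding.norm_apply, prod_eq_prod_mul_prod, nrmV]
  congr 1
  · refine Finset.prod_congr rfl fun w _ => ?_
    rw [normAtPlace_apply_of_isReal w.2, mult, if_pos w.2, pow_one]; rfl
  · refine Finset.prod_congr rfl fun w _ => ?_
    rw [normAtPlace_apply_of_isComplex w.2, mult, if_neg (not_isReal_iff_isComplex.2 w.2)]

/-- indicator of the fundamental cone -/
def coneI (x : VV (RK K) (CK K)) : ENNReal := (fundamentalCone K).indicator (fun _ => 1) x

lemma coneI_measurable : Measurable (coneI (K := K)) := 
  measurable_const.indicator (measurableSet_fundamentalCone K)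

lemma coneI_sum {x : VV (RK K) (CK K)} (hx : nrmV x ≠ 0) : 
    ∑' u : (𝓞 K)ˣ, coneI (u • x : mixedSpace K) = (Units.torsionOrder K : ENNReal) := by

  rw [nrmV_K] at hx
  obtain ⟨u0, hu0⟩ := fundamentalCone.exists_unit_smul_mem hx
  rw [← (Equiv.mulRight u0).tsum_eq]
  have h : ∀ u : (𝓞 K)ˣ, coneI ((Equiv.mulRight u0 u) • x : mixedSpace K) = 
      ((Units.torsion K : Set (𝓞 K)ˣ)).indicator (fun _ => (1 : ENNReal)) u := by
    intro u
    rw [Equiv.coe_mulRight, mul_smul, coneI]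
    have := fundamentalCone.unit_smul_mem_iff_mem_torsion hu0 u
    by_cases h : u ∈ Units.torsion K
    · rw [Set.indicator_of_mem (this.2 h), Set.indicator_of_mem (by exact h)]
    · rw [Set.indicator_of_notMem (fun h' => h (this.1 h')), Set.indicator_of_notMem (by exact h)]
  simp_rw [h]
  rw [← tsum_subtype, ENNReal.tsum_const, mul_one, Units.torsionOrder]
  haveI : Finite ((Units.torsion K : Set (𝓞 K)ˣ)) := inferInstanceAs (Finite (Units.torsion K))
  rw [ENat.card_eq_coe_natCard]
  simp

lemma unit_smul_eq (u : (𝓞 K)ˣ) (x : mixedSpace K) : u • x = mulV (R := RK K) (C := CK K) (mixedEmbedding K (u : K)) x := by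
  rw [mulV_apply]; rfl

lemma nrmV_unit (u : (𝓞 K)ˣ) : nrmV (R := RK K) (C := CK K) (mixedEmbedding K (u : K)) = 1 := by
  rw [nrmV_K, norm_unit]

lemma nrmV_unit_smul (u : (𝓞 K)ˣ) (x : mixedSpace K) : nrmV (R := RK K) (C := CK K) (u • x) = nrmV (R := RK K) (C := CK K) x := by
  rw [nrmV_K, nrmV_K, mixedEmbedding.norm_unit_smul]

/-- the units act on an ideal lattice -/
def latAct (I : (FractionalIdeal (nonZeroDivisors (𝓞 K)) K)ˣ) (u : (𝓞 K)ˣ) : idealLattice K I ≃ idealLattice K I where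
  toFun x := ⟨u • (x : mixedSpace K), by
    obtain ⟨y, hy, hx⟩ := (mem_idealLattice K I).1 x.2
    refine (mem_idealLattice K I).2 ⟨(u : 𝓞 K) • y, ?_, ?_⟩
    · exact Submodule.smul_mem (I : FractionalIdeal (nonZeroDivisors (𝓞 K)) K).coeToSubmodule _ hy
    · rw [← hx, Algebra.smul_def, map_mul]; rfl⟩
  invFun x := ⟨u⁻¹ • (x : mixedSpace K), by
    obtain ⟨y, hy, hx⟩ := (mem_idealLattice K I).1 x.2
    refine (mem_idealLattice K I).2 ⟨((u⁻¹ : (𝓞 K)ˣ) : 𝓞 K) • y, ?_, ?_⟩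
    · exact Submodule.smul_mem (I : FractionalIdeal (nonZeroDivisors (𝓞 K)) K).coeToSubmodule _ hy
    · rw [← hx, Algebra.smul_def, map_mul]; rfl⟩
  left_inv x := Subtype.ext (inv_smul_smul u _)
  right_inv x := Subtype.ext (smul_inv_smul u _)

theorem unfold_sum (I : (FractionalIdeal (nonZeroDivisors (𝓞 K)) K)ˣ) (F : mixedSpace K → mixedSpace K → ENNReal)
    (hFm : ∀ x, Measurable (F x)) (hF : ∀ (u : (𝓞 K)ˣ) x y, F (u • x) y = F x (u • y)) 
    (h1 : ∀ x y, nrmV (R := RK K) (C := CK K) x = 0 → F x y = 0) (h2 : ∀ x y, nrmV (R := RK K) (C := CK K) y = 0 → F x y = 0) :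
    ∑' x : idealLattice K I, ∫⁻ y, coneI y * F x y = ∑' x : idealLattice K I, coneI (x : mixedSpace K) * ∫⁻ y, F x y := by
  have hw0 : (Units.torsionOrder K : ENNReal) ≠ 0 := by
    simp [Units.torsionOrder, Nat.card_pos.ne']
  have hwt : (Units.torsionOrder K : ENNReal) ≠ ⊤ := ENNReal.natCast_ne_top _
  rw [← ENNReal.mul_right_inj hw0 hwt]
  haveI : Countable (𝓞 K) := (RingOfIntegers.basis K).equivFun.toEquiv.countable_iff.2 inferInstance
  haveI : Countable (𝓞 K)ˣ := Units.val_injective.countable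
  have hmu : ∀ u : (𝓞 K)ˣ, MeasurePreserving (fun y : mixedSpace K => u • y) volume volume := fun u => by
    have := measurePreserving_mulV (R := RK K) (C := CK K) (nrmV_unit u)
    exact this
  calc (Units.torsionOrder K : ENNReal) * ∑' x : idealLattice K I, ∫⁻ y, coneI y * F x y 
      = ∑' x : idealLattice K I, ∑' u : (𝓞 K)ˣ, coneI (u • (x : mixedSpace K) : mixedSpace K) * ∫⁻ y, coneI y * F x y := by
        rw [← ENNReal.tsum_mul_left]
        refine tsum_congr fun x => ?_
        rw [ENNReal.tsum_mul_right]
        by_cases hx : nrmV (R := RK K) (C := CK K) x = 0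
        · simp [h1 x _ hx]
        · rw [coneI_sum hx]
    _ = ∑' u : (𝓞 K)ˣ, ∑' x : idealLattice K I, coneI (u • (x : mixedSpace K) : mixedSpace K) * ∫⁻ y, coneI y * F x y := ENNReal.tsum_comm
    _ = ∑' u : (𝓞 K)ˣ, ∑' x : idealLattice K I, coneI (x : mixedSpace K) * ∫⁻ y, coneI (u • y : mixedSpace K) * F x y := by
        refine tsum_congr fun u => ?_
        rw [← (latAct I u).tsum_eq (fun x : idealLattice K I => coneI (x : mixedSpace K) * ∫⁻ y, coneI (u • y : mixedSpace K) * F x y)]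
        refine tsum_congr fun x => ?_
        congr 1
        have e : ∀ y, coneI (u • y : mixedSpace K) * F (latAct I u x) y = (fun z => coneI z * F x z) (u • y) := by
          intro y
          simp only [latAct, Equiv.coe_fn_mk]
          rw [hF]
        simp_rw [e]
        exact ((hmu u).lintegral_comp (coneI_measurable.mul (hFm x))).symm
    _ = ∑' x : idealLattice K I, ∑' u : (𝓞 K)ˣ, coneI (x : mixedSpace K) * ∫⁻ y, coneI (u • y : mixedSpace K) * F x y := ENNReal.tsum_comm
    _ = (Units.torsionOrder K : ENNReal) * ∑' x : idealLattice K I, coneI (x : mixedSpace K) * ∫⁻ y, F x y := by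
        rw [← ENNReal.tsum_mul_left]
        refine tsum_congr fun x => ?_
        rw [ENNReal.tsum_mul_left, mul_left_comm]
        congr 1
        have hm : ∀ u : (𝓞 K)ˣ, AEMeasurable (fun y : mixedSpace K => coneI (u • y : mixedSpace K) * F x y) volume := 
          fun u => ((coneI_measurable.comp (hmu u).measurable).mul (hFm x)).aemeasurable
        rw [← lintegral_tsum hm, ← lintegral_const_mul _ (hFm x)]
        refine lintegral_congr fun y => ?_
        rw [ENNReal.tsum_mul_right]
        by_cases hy : nrmV (R := RK K) (C := CK K) y = 0
        · rw [h2 _ _ hy]; simp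
        · rw [coneI_sum hy]

end Landau

namespace Landau
open scoped ContDiff Classical
open MeasureTheory NumberField NumberField.mixedEmbedding NumberField.InfinitePlace

variable {K : Type} [Field K] [NumberField K]

abbrev iotaI (I : (FractionalIdeal (nonZeroDivisors (𝓞 K)) K)ˣ) := Module.Free.ChooseBasisIndex ℤ I

def latA (I : (FractionalIdeal (nonZeroDivisors (𝓞 K)) K)ˣ) : (iotaI I → ℝ) ≃L[ℝ] VV (RK K) (CK K) :=
  (fractionalIdealLatticeBasis K I).equivFun.symm.toContinuousLinearEquiv

lemma latA_iv (I : (FractionalIdeal (nonZeroDivisors (𝓞 K)) K)ˣ) (k : iotaI I → ℤ) : 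
    latA I (iv k) = ∑ i, k i • fractionalIdealLatticeBasis K I i := by
  simp only [latA, LinearEquiv.coe_toContinuousLinearEquiv', Module.Basis.equivFun_symm_apply, iv]
  refine Finset.sum_congr rfl fun i _ => ?_
  rw [Int.cast_smul_eq_zsmul]

lemma latA_mem (I : (FractionalIdeal (nonZeroDivisors (𝓞 K)) K)ˣ) (k : iotaI I → ℤ) : 
    latA I (iv k) ∈ idealLattice K I := by
  rw [latA_iv, ← span_idealLatticeBasis]
  exact Submodule.sum_mem _ fun i _ => Submodule.smul_mem _ _ (Submodule.subset_span ⟨i, rfl⟩)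

def latE (I : (FractionalIdeal (nonZeroDivisors (𝓞 K)) K)ˣ) : (iotaI I → ℤ) ≃ idealLattice K I :=
  Equiv.ofBijective (fun k => ⟨latA I (iv k), latA_mem I k⟩) (by
    constructor
    · intro k k' h
      have h1 : iv k = iv k' := (latA I).injective (Subtype.ext_iff.1 h)
      funext i
      have := congrFun h1 i
      simpa [iv] using this
    · rintro ⟨x, hx⟩
      rw [← span_idealLatticeBasis] at hx
      obtain ⟨c, hc⟩ := (Submodule.mem_span_range_iff_exists_fun ℤ).1 hx
      exact ⟨c, Subtype.ext ((latA_iv I c).trans hc)⟩)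

lemma latE_apply (I : (FractionalIdeal (nonZeroDivisors (𝓞 K)) K)ˣ) (k : iotaI I → ℤ) : 
    (latE I k : mixedSpace K) = latA I (iv k) := rfl

variable (K) in
/-- the part of the cone in the shell -/
def DD : Set (VV (RK K) (CK K)) := fundamentalCone K ∩ shell (RK K) (CK K)

lemma DD_meas : MeasurableSet (DD K) := (measurableSet_fundamentalCone K).inter shell_meas

lemma dim_pos : 1 ≤ dimV (RK K) (CK K) := by
  rw [dimV_K]; exact Module.finrank_pos

lemma DD_sub : DD K ⊆ fundamentalCone.normLeOne K := by
  rintro x ⟨h1, h2⟩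
  refine ⟨h1, ?_⟩
  show mixedEmbedding.norm x ≤ 1
  rw [← nrmV_K, ← rad_pow dim_pos]
  exact pow_le_one₀ (rad_nonneg x) h2.2

lemma DD_vol : volume (DD K) ≠ ⊤ := 
  ((measure_mono DD_sub).trans_lt (fundamentalCone.isBounded_normLeOne K).measure_lt_top).ne

lemma DD_bdd : ∃ M : ℝ, ∀ x ∈ DD K, ‖x‖ ≤ M := by
  obtain ⟨M, hM⟩ := (fundamentalCone.isBounded_normLeOne K).exists_norm_le
  exact ⟨M, fun x hx => hM x (DD_sub hx)⟩

lemma tsum_ofReal_of_finite {ι : Type} {f : ι → ℝ} (hf : f.support.Finite) (h0 : ∀ i, 0 ≤ f i) : 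
    ∑' i, ENNReal.ofReal (f i) = ENNReal.ofReal (∑ᶠ i, f i) := by
  rw [finsum_eq_sum_of_support_subset f (s := hf.toFinset) (by simp), 
    ENNReal.ofReal_sum_of_nonneg (fun i _ => h0 i)]
  refine tsum_eq_sum fun i hi => ?_
  have : f i = 0 := by simpa using hi
  simp [this]

lemma rad_unit_smul (u : (𝓞 K)ˣ) (x : mixedSpace K) : rad (R := RK K) (C := CK K) (u • x) = rad (R := RK K) (C := CK K) x := by
  rw [rad, rad, nrmV_unit_smul]

theorem smooth_count (hn : 2 ≤ dimV (RK K) (CK K)) (I : (FractionalIdeal (nonZeroDivisors (𝓞 K)) K)ˣ) : 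
    ∃ c C : ℝ, 0 ≤ C ∧ ∀ α β δ, Adm α β δ → ∀ T : ℝ, 1 ≤ T → ∃ S : ℝ, 0 ≤ S ∧ 
      ∑' x : idealLattice K I, coneI (x : mixedSpace K) * ENNReal.ofReal (chi α β δ (rad (R := RK K) (C := CK K) x / T)) = ENNReal.ofReal S ∧
      |S - c * T ^ (dimV (RK K) (CK K)) * ∫ r : ℝ, r ^ (dimV (RK K) (CK K) - 1) * chi α β δ r| 
        ≤ C * δ ^ (-((dimV (RK K) (CK K) : ℝ) - 1) / 2) := by
  set n := dimV (RK K) (CK K) with hndef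
  have hn1 : 1 ≤ n := by omega
  have hnR : (2:ℝ) ≤ n := by exact_mod_cast hn
  obtain ⟨M, hM⟩ := DD_bdd (K := K)
  let ρ : ℝ := 1 / (1000 * (n:ℝ)^2)
  have hρ0 : 0 < ρ := by positivity
  have hρ : 1000 * (n:ℝ)^2 * ρ ≤ 1 := by
    simp only [ρ]; rw [mul_one_div_cancel (by positivity)]
  have hρ1 : ρ ≤ 1 := by
    refine le_trans ?_ hρ
    refine le_mul_of_one_le_left hρ0.le ?_
    nlinarith
  obtain ⟨a, ha, has, ha0, ha1⟩ := exists_bump (R := RK K) (C := CK K) hρ0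
  obtain ⟨cM, B, hB, hmain⟩ := lattice_main (latA I) hn hρ0 hρ ha has (2 * M)
  obtain ⟨hC0, hCt⟩ := Cpsi_bounds hn1 hρ1 ha.continuous has ha0 ha1
  set Cp : ℝ := (Cpsi a).toReal with hCp
  have hCp0 : 0 < Cp := ENNReal.toReal_pos hC0 hCt
  set V : ℝ := (volume (DD K)).toReal with hV
  have hV0 : 0 ≤ V := ENNReal.toReal_nonneg
  refine ⟨cM * V / Cp, B * V / Cp, by positivity, ?_⟩
  intro α β δ hadm T hT
  have hT0 : 0 < T := by linarith
  have hδ0 : 0 < δ := hadm.hd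
  set m : ℝ := cM * T ^ n * ∫ r : ℝ, r ^ (n - 1) * chi α β δ r with hm
  set E : ℝ := B * δ ^ (-((n : ℝ) - 1) / 2) with hE
  have hE0 : 0 ≤ E := by positivity
  let G : VV (RK K) (CK K) → ℝ := fun y => ∑ᶠ k : iotaI I → ℤ, f0 a α β δ (T⁻¹ • ((rad y)⁻¹ • y * latA I (iv k)))
  have hchi0 : chi α β δ 0 = 0 := chi_zero hadm (by
    intro h; have := h.1; linarith [hadm.ha])
  let F : mixedSpace K → mixedSpace K → ENNReal := fun x y => ENNReal.ofReal (chi α β δ (rad (R := RK K) (C := CK K) x / T)) * psiS a x y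
  have hunf := unfold_sum I F (fun x => (psiS_measurable ha.continuous x).const_mul _) ?_ ?_ ?_
  rotate_left
  · intro u x y
    simp only [F]
    rw [rad_unit_smul]
    congr 1
    have e : ((u • x : mixedSpace K) * y : VV (RK K) (CK K)) = x * (u • y : mixedSpace K) := by
      rw [unit_smul_eq, unit_smul_eq, mulV_apply, mulV_apply]; ring
    have e2 : y ∈ shell (RK K) (CK K) ↔ (u • y : mixedSpace K) ∈ shell (RK K) (CK K) := by
      simp only [shell, Set.mem_setOf_eq]
      rw [rad_unit_smul]
    simp only [psiS]
    by_cases hy : y ∈ shell (RK K) (CK K)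
    · rw [Set.indicator_of_mem hy, Set.indicator_of_mem (e2.1 hy), e]
    · rw [Set.indicator_of_notMem hy, Set.indicator_of_notMem (fun h => hy (e2.2 h))]
  · intro x y hx
    have : rad (R := RK K) (C := CK K) x = 0 := by
      rw [rad, hx, Real.zero_rpow]; positivity
    simp only [F, this, zero_div, hchi0, ENNReal.ofReal_zero, zero_mul]
  · intro x y hy
    have : rad (R := RK K) (C := CK K) y = 0 := by
      rw [rad, hy, Real.zero_rpow]; positivity
    have h2 : y ∉ shell (RK K) (CK K) := by
      intro h; have := h.1; linarith
    simp only [F, psiS, Set.indicator_of_notMem h2, mul_zero]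
  have hR : ∑' x : idealLattice K I, coneI (x : mixedSpace K) * ∫⁻ y, F x y = 
      (∑' x : idealLattice K I, coneI (x : mixedSpace K) * ENNReal.ofReal (chi α β δ (rad (R := RK K) (C := CK K) x / T))) * Cpsi a := by
    rw [← ENNReal.tsum_mul_right]
    refine tsum_congr fun x => ?_
    rw [mul_assoc]
    congr 1
    simp only [F]
    rw [lintegral_const_mul _ (psiS_measurable ha.continuous _)]
    by_cases hx : nrmV (R := RK K) (C := CK K) x = 0
    · have : rad (R := RK K) (C := CK K) x = 0 := by
        rw [rad, hx, Real.zero_rpow]; positivity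
      simp only [this, zero_div, hchi0, ENNReal.ofReal_zero, zero_mul]
    · rw [lintegral_psiS hn1 ha.continuous hx]
  have hradDD : ∀ y ∈ DD K, 0 < rad y := fun y hy => by have := hy.2.1; linarith
  have hfs : ∀ y : VV (RK K) (CK K), 0 < rad y → (fun k : iotaI I → ℤ => f0 a α β δ (T⁻¹ • ((rad y)⁻¹ • y * latA I (iv k)))).support.Finite := by
    intro y hy
    set b := (rad y)⁻¹ • y with hb
    have hb1 : nrmV b = 1 := by
      rw [hb, nrmV_smul (inv_nonneg.2 hy.le), ← rad_pow hn1, ← mul_pow, inv_mul_cancel₀ hy.ne', one_pow]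
    have hbi : b * b⁻¹ = 1 := mul_inv_of_nrm (by rw [hb1]; exact one_ne_zero)
    obtain ⟨M', hM'⟩ := (f0_hcs has hadm).isCompact.isBounded.exists_norm_le
    refine (finite_iv (‖((latA I).symm : VV (RK K) (CK K) →L[ℝ] (iotaI I → ℝ))‖ * (T * (‖b⁻¹‖ * M')))).subset fun k hk => ?_
    have h1 := hM' _ (subset_tsupport _ hk)
    have h2 : latA I (iv k) = T • (b⁻¹ * (T⁻¹ • (b * latA I (iv k)))) := by
      rw [mul_smul_comm, smul_smul, mul_inv_cancel₀ hT0.ne', one_smul, ← mul_assoc, mul_comm b⁻¹, hbi, one_mul]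
    have h3 : iv k = ((latA I).symm : VV (RK K) (CK K) →L[ℝ] (iotaI I → ℝ)) (latA I (iv k)) := by simp
    show ‖iv k‖ ≤ _
    rw [h3]
    refine (ContinuousLinearMap.le_opNorm _ _).trans ?_
    gcongr
    rw [h2, _root_.norm_smul, Real.norm_of_nonneg hT0.le]
    gcongr
    exact (norm_mulV_le _ _).trans (by gcongr)
  have hf0n : ∀ z : VV (RK K) (CK K), 0 ≤ f0 a α β δ z := fun z => mul_nonneg (Psi_nonneg ha0 _) (chi_nonneg hadm _)
  have hL : ∑' x : idealLattice K I, ∫⁻ y, coneI y * F x y = ∫⁻ y in DD K, ENNReal.ofReal (G y) := by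
    haveI : Countable (idealLattice K I) := (latE I).countable_iff.1 inferInstance
    have hmeas : ∀ x : idealLattice K I, AEMeasurable (fun y : mixedSpace K => coneI y * F x y) volume := fun x =>
      (coneI_measurable.mul ((psiS_measurable ha.continuous x).const_mul _)).aemeasurable
    rw [← lintegral_tsum hmeas, ← lintegral_indicator DD_meas]
    refine lintegral_congr fun y => ?_
    by_cases hy : y ∈ DD K
    · rw [Set.indicator_of_mem hy]
      have h1 : coneI y = 1 := by rw [coneI, Set.indicator_of_mem hy.1]
      rw [h1]
      simp only [one_mul, F, psiS, Set.indicator_of_mem hy.2, G]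
      rw [← tsum_ofReal_of_finite (hfs y (hradDD y hy)) (fun k => hf0n _), ← (latE I).tsum_eq]
      refine tsum_congr fun k => ?_
      rw [f0_scaled hn1 a α β δ hT0 (hradDD y hy), latE_apply, ← ENNReal.ofReal_mul (chi_nonneg hadm _), mul_comm (Psi _ _)]
    · rw [Set.indicator_of_notMem hy]
      refine ENNReal.tsum_eq_zero.2 fun x => ?_
      by_cases h1 : y ∈ fundamentalCone K
      · have h2 : y ∉ shell (RK K) (CK K) := fun h => hy ⟨h1, h⟩
        simp only [F, psiS, Set.indicator_of_notMem h2, mul_zero]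
      · simp only [coneI, Set.indicator_of_notMem h1, zero_mul]
  rw [hL, hR] at hunf
  have hG : ∀ y ∈ DD K, |G y - m| ≤ E := by
    intro y hy
    have hr := hradDD y hy
    refine hmain α β δ hadm T hT ((rad y)⁻¹ • y) ?_ ?_
    · rw [nrmV_smul (inv_nonneg.2 hr.le), ← rad_pow hn1, ← mul_pow, inv_mul_cancel₀ hr.ne', one_pow]
    · rw [_root_.norm_smul, norm_inv, Real.norm_of_nonneg hr.le]
      have h2 : (rad y)⁻¹ ≤ 2 := by
        rw [inv_le_comm₀ hr two_pos]; have := hy.2.1; linarith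
      exact mul_le_mul h2 (hM y hy) (norm_nonneg _) (by norm_num)
  have hG0 : ∀ y, 0 ≤ G y := fun y => finsum_nonneg fun k => hf0n _
  have hup : ∫⁻ y in DD K, ENNReal.ofReal (G y) ≤ ENNReal.ofReal (m + E) * volume (DD K) := by
    rw [← setLIntegral_const]
    refine setLIntegral_mono' DD_meas fun y hy => ENNReal.ofReal_le_ofReal ?_
    linarith [(abs_le.1 (hG y hy)).2]
  have hlow : ENNReal.ofReal (m - E) * volume (DD K) ≤ ∫⁻ y in DD K, ENNReal.ofReal (G y) := by
    rw [← setLIntegral_const]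
    refine setLIntegral_mono' DD_meas fun y hy => ENNReal.ofReal_le_ofReal ?_
    linarith [(abs_le.1 (hG y hy)).1]
  rw [hunf] at hup hlow
  set Sg := ∑' x : idealLattice K I, coneI (x : mixedSpace K) * ENNReal.ofReal (chi α β δ (rad (R := RK K) (C := CK K) x / T)) with hSg
  have htop : Sg * Cpsi a ≠ ⊤ := (hup.trans_lt (ENNReal.mul_lt_top ENNReal.ofReal_lt_top DD_vol.lt_top)).ne
  have hSt : Sg ≠ ⊤ := by
    intro h; rw [h, ENNReal.top_mul hC0] at htop; exact htop rfl
  refine ⟨Sg.toReal, ENNReal.toReal_nonneg, (ENNReal.ofReal_toReal hSt).symm, ?_⟩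
  have hup' : Sg.toReal * Cp ≤ max (m + E) 0 * V := by
    have := ENNReal.toReal_mono (ENNReal.mul_ne_top ENNReal.ofReal_ne_top DD_vol) hup
    rwa [ENNReal.toReal_mul, ENNReal.toReal_mul, ENNReal.toReal_ofReal'] at this
  have hlow' : (m - E) * V ≤ Sg.toReal * Cp := by
    have := ENNReal.toReal_mono htop hlow
    rw [ENNReal.toReal_mul, ENNReal.toReal_mul, ENNReal.toReal_ofReal'] at this
    exact (mul_le_mul_of_nonneg_right (le_max_left _ _) hV0).trans this
  have hup2 : Sg.toReal * Cp ≤ (m + E) * V := by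
    rcases (DD K).eq_empty_or_nonempty with h | ⟨y, hy⟩
    · have : V = 0 := by rw [hV, h]; simp
      rw [this] at hup' ⊢; simpa using hup'
    · have := (abs_le.1 (hG y hy)).2
      have := hG0 y
      rwa [max_eq_left (by linarith)] at hup'
  have e1 : Sg.toReal - cM * V / Cp * T ^ n * ∫ r : ℝ, r ^ (n - 1) * chi α β δ r = (Sg.toReal * Cp - m * V) / Cp := by
    rw [hm]; field_simp
  have e2 : B * V / Cp * δ ^ (-((n : ℝ) - 1) / 2) = (E * V) / Cp := by rw [hE]; ring
  rw [e1, e2, abs_div, abs_of_pos hCp0]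
  refine div_le_div_of_nonneg_right (abs_le.2 ⟨by linarith, by linarith⟩) hCp0.le

end Landau

namespace Landau
open scoped ContDiff Classical
open MeasureTheory NumberField NumberField.mixedEmbedding NumberField.InfinitePlace

lemma chi_ind_int {α β δ : ℝ} (h : Adm α β δ) (n : ℕ) (hα : |α - 1/2| + |β - 1| ≤ δ) 
    (h1 : ∀ r, 1/2 + δ < r → r < 1 - δ → chi α β δ r = 1) (h2 : ∀ r, r < 1/2 - δ ∨ 1 + δ < r → chi α β δ r = 0) :
    |(∫ r : ℝ, r ^ (n - 1) * chi α β δ r) - ∫ r in Set.Ioc (1/2:ℝ) 1, r ^ (n - 1)| ≤ 4 * 2 ^ n * δ := by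
  have hd := h.hd
  have hcont : Continuous (chi α β δ) := by
    unfold chi
    have := Real.smoothTransition.continuous
    fun_prop
  have hi1 : Integrable (fun r : ℝ => r ^ (n - 1) * chi α β δ r) := by
    refine Continuous.integrable_of_hasCompactSupport (by fun_prop) ?_
    refine HasCompactSupport.intro (isCompact_Icc (a := α) (b := β + δ)) fun r hr => ?_
    rw [chi_zero h hr, mul_zero]
  have hi2 : Integrable (fun r : ℝ => (Set.Ioc (1/2:ℝ) 1).indicator (fun r => r ^ (n - 1)) r) := by
    rw [integrable_indicator_iff measurableSet_Ioc]
    exact (Continuous.integrableOn_Icc (by fun_prop)).mono_set Set.Ioc_subset_Icc_self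
  rw [← integral_indicator measurableSet_Ioc, ← integral_sub hi1 hi2]
  let E : Set ℝ := Set.Icc (1/2 - δ) (1/2 + δ) ∪ Set.Icc (1 - δ) (1 + δ)
  have hE : MeasurableSet E := measurableSet_Icc.union measurableSet_Icc
  have hEv : volume E ≤ ENNReal.ofReal (4 * δ) := by
    refine (measure_union_le _ _).trans ?_
    rw [Real.volume_Icc, Real.volume_Icc, ← ENNReal.ofReal_add (by linarith) (by linarith)]
    exact ENNReal.ofReal_le_ofReal (by linarith)
  have hEt : volume E ≠ ⊤ := (hEv.trans_lt ENNReal.ofReal_lt_top).ne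
  have hi3 : Integrable (fun r : ℝ => E.indicator (fun _ => (2:ℝ)^n) r) := by
    rw [integrable_indicator_iff hE]
    exact integrableOn_const hEt
  rw [← Real.norm_eq_abs]
  refine (norm_integral_le_of_norm_le hi3 (ae_of_all _ fun r => ?_)).trans ?_
  · by_cases hr : r ∈ E
    · rw [Set.indicator_of_mem hr]
      have hc0 := chi_nonneg h r
      have hc1 := chi_le_one α β δ r
      have hr0 : -1/2 ≤ r ∧ r ≤ 2 := by
        have := h.hd1
        rcases hr with hr | hr
        · constructor <;> linarith [hr.1, hr.2]
        · constructor <;> linarith [hr.1, hr.2]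
      have hp : |r ^ (n-1)| ≤ 2 ^ n := by
        rw [abs_pow]
        have : |r| ≤ 2 := abs_le.2 ⟨by linarith, by linarith⟩
        calc |r| ^ (n-1) ≤ 2 ^ (n-1) := by gcongr
          _ ≤ 2 ^ n := pow_le_pow_right₀ (by norm_num) (by omega)
      by_cases hm : r ∈ Set.Ioc (1/2:ℝ) 1
      · rw [Set.indicator_of_mem hm, ← mul_sub_one, norm_mul, Real.norm_eq_abs, Real.norm_eq_abs]
        have : |chi α β δ r - 1| ≤ 1 := abs_le.2 ⟨by linarith, by linarith⟩
        calc _ ≤ (2:ℝ)^n * 1 := mul_le_mul hp this (abs_nonneg _) (by positivity)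
          _ = _ := mul_one _
      · rw [Set.indicator_of_notMem hm, sub_zero, norm_mul, Real.norm_eq_abs, Real.norm_eq_abs, abs_of_nonneg hc0]
        calc _ ≤ (2:ℝ)^n * 1 := mul_le_mul hp hc1 hc0 (by positivity)
          _ = _ := mul_one _
    · rw [Set.indicator_of_notMem hr]
      have hr1 : ¬ (r ∈ Set.Icc (1/2 - δ) (1/2 + δ)) := fun h => hr (Or.inl h)
      have hr2 : ¬ (r ∈ Set.Icc (1 - δ) (1 + δ)) := fun h => hr (Or.inr h)
      rw [Set.mem_Icc, not_and_or, not_le, not_le] at hr1 hr2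
      by_cases hm : r ∈ Set.Ioc (1/2:ℝ) 1
      · rw [Set.indicator_of_mem hm, h1 r, mul_one, sub_self, norm_zero]
        · rcases hr1 with h' | h'
          · linarith [hm.1]
          · exact h'
        · rcases hr2 with h' | h'
          · exact h'
          · linarith [hm.2]
      · rw [Set.indicator_of_notMem hm, h2 r, mul_zero, sub_zero, norm_zero]
        by_contra hcon
        push Not at hcon
        rcases hr1 with h' | h'
        · linarith [hcon.1]
        rcases hr2 with h'' | h''
        · exact hm ⟨by linarith, by linarith⟩
        · linarith [hcon.2]
  · rw [integral_indicator hE, setIntegral_const, smul_eq_mul]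
    have : volume.real E ≤ 4 * δ := ENNReal.toReal_le_of_le_ofReal (by linarith) hEv
    have h2n : (0:ℝ) ≤ 2^n := by positivity
    nlinarith

variable {K : Type} [Field K] [NumberField K]

def NS (I : (FractionalIdeal (nonZeroDivisors (𝓞 K)) K)ˣ) (T : ℝ) : Set (idealLattice K I) :=
  {x | (x : mixedSpace K) ∈ fundamentalCone K ∧ rad (R := RK K) (C := CK K) x ≤ T}

lemma NS_finite (I : (FractionalIdeal (nonZeroDivisors (𝓞 K)) K)ˣ) (T : ℝ) : (NS I T).Finite := by
  wlog hT : 0 < T generalizing T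
  · refine (this 1 one_pos).subset fun x hx => ⟨hx.1, hx.2.trans ?_⟩
    linarith
  obtain ⟨M, hM⟩ := (fundamentalCone.isBounded_normLeOne K).exists_norm_le
  have hsub : NS I T ⊆ latE I '' {k | ‖iv k‖ ≤ ‖((latA I).symm : VV (RK K) (CK K) →L[ℝ] (iotaI I → ℝ))‖ * (T * M)} := by
    intro x hx
    obtain ⟨k, rfl⟩ := (latE I).surjective x
    refine ⟨k, ?_, rfl⟩
    have h3 : iv k = ((latA I).symm : VV (RK K) (CK K) →L[ℝ] (iotaI I → ℝ)) (latA I (iv k)) := by simp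
    show ‖iv k‖ ≤ _
    rw [h3]
    refine (ContinuousLinearMap.le_opNorm _ _).trans ?_
    gcongr
    rw [← latE_apply]
    have h4 : T⁻¹ • (latE I k : mixedSpace K) ∈ fundamentalCone.normLeOne K := by
      refine ⟨fundamentalCone.smul_mem_of_mem hx.1 (inv_ne_zero hT.ne'), ?_⟩
      show mixedEmbedding.norm _ ≤ 1
      rw [← nrmV_K, ← rad_pow dim_pos, rad_smul dim_pos (inv_nonneg.2 hT.le)]
      refine pow_le_one₀ (mul_nonneg (inv_nonneg.2 hT.le) (rad_nonneg _)) ?_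
      rw [inv_mul_le_iff₀ hT, mul_one]
      exact hx.2
    have := hM _ h4
    rwa [_root_.norm_smul, norm_inv, Real.norm_of_nonneg hT.le, inv_mul_le_iff₀ hT] at this
  exact ((finite_iv _).image _).subset hsub

lemma NS_mono (I : (FractionalIdeal (nonZeroDivisors (𝓞 K)) K)ˣ) {T T' : ℝ} (h : T ≤ T') : NS I T ⊆ NS I T' := 
  fun _ hx => ⟨hx.1, hx.2.trans h⟩

def NT (I : (FractionalIdeal (nonZeroDivisors (𝓞 K)) K)ˣ) (T : ℝ) : ℝ := (NS I T).ncard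

lemma NT_diff (I : (FractionalIdeal (nonZeroDivisors (𝓞 K)) K)ˣ) {T : ℝ} (hT : 0 < T) : 
    ENNReal.ofReal (NT I T - NT I (T/2)) = ∑' x : idealLattice K I, coneI (x : mixedSpace K) * 
      ENNReal.ofReal ((Set.Ioc (1/2 : ℝ) 1).indicator (fun _ => 1) (rad (R := RK K) (C := CK K) x / T)) := by
  have hsub : NS I (T/2) ⊆ NS I T := fun x hx => ⟨hx.1, hx.2.trans (by linarith)⟩
  have h1 : NT I T - NT I (T/2) = ((NS I T \ NS I (T/2)).ncard : ℝ) := by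
    rw [NT, NT, Set.ncard_sdiff hsub (NS_finite I _), Nat.cast_sub (Set.ncard_le_ncard hsub (NS_finite I _))]
  rw [h1, ENNReal.ofReal_natCast]
  have h2 : ((NS I T \ NS I (T/2)).ncard : ENNReal) = ∑' x : idealLattice K I, (NS I T \ NS I (T/2)).indicator (fun _ => (1:ENNReal)) x := by
    rw [← tsum_subtype, ENNReal.tsum_set_one, ← ((NS_finite I T).sdiff).cast_ncard_eq]
    simp
  rw [h2]
  refine tsum_congr fun x => ?_
  have hi : rad (R := RK K) (C := CK K) x / T ∈ Set.Ioc (1/2:ℝ) 1 ↔ T / 2 < rad (R := RK K) (C := CK K) x ∧ rad (R := RK K) (C := CK K) x ≤ T := by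
    rw [Set.mem_Ioc, lt_div_iff₀ hT, div_le_one hT]
    constructor <;> rintro ⟨h, h'⟩ <;> exact ⟨by linarith, h'⟩
  by_cases hc : (x : mixedSpace K) ∈ fundamentalCone K
  · have hc1 : coneI (x : mixedSpace K) = 1 := by rw [coneI, Set.indicator_of_mem hc]
    rw [hc1, one_mul]
    by_cases hx : rad (R := RK K) (C := CK K) x / T ∈ Set.Ioc (1/2:ℝ) 1
    · rw [Set.indicator_of_mem hx, ENNReal.ofReal_one, Set.indicator_of_mem]
      have := hi.1 hx
      exact ⟨⟨hc, this.2⟩, fun h => by linarith [h.2]⟩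
    · rw [Set.indicator_of_notMem hx, ENNReal.ofReal_zero, Set.indicator_of_notMem]
      rintro ⟨h1, h2⟩
      exact hx (hi.2 ⟨by by_contra h; exact h2 ⟨hc, by linarith⟩, h1.2⟩)
  · rw [coneI, Set.indicator_of_notMem hc, zero_mul, Set.indicator_of_notMem]
    exact fun h => hc h.1.1

theorem shell_count (hn : 2 ≤ dimV (RK K) (CK K)) (I : (FractionalIdeal (nonZeroDivisors (𝓞 K)) K)ˣ) : 
    ∃ c C : ℝ, 0 ≤ C ∧ ∀ T : ℝ, 4 ≤ T → |(NT I T - NT I (T/2)) - c * T ^ (dimV (RK K) (CK K))| 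
      ≤ C * T ^ ((dimV (RK K) (CK K) : ℝ) * (dimV (RK K) (CK K) - 1) / (dimV (RK K) (CK K) + 1)) := by
  obtain ⟨c, C, hC, hsm⟩ := smooth_count hn I
  set n := dimV (RK K) (CK K) with hndef
  have hnR : (2:ℝ) ≤ n := by exact_mod_cast hn
  set J0 : ℝ := ∫ r in Set.Ioc (1/2:ℝ) 1, r ^ (n - 1) with hJ0
  refine ⟨c * J0, |c| * (4 * 2 ^ n) + C, by positivity, fun T hT => ?_⟩
  have hT0 : 0 < T := by linarith
  set δ : ℝ := T ^ (-(2 * (n:ℝ) / (n + 1))) with hδ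
  set γ : ℝ := (n:ℝ) * (n - 1) / (n + 1) with hγ
  have hδ0 : 0 < δ := Real.rpow_pos_of_pos hT0 _
  have hδ4 : δ ≤ 1/4 := by
    have h1 : δ ≤ T ^ (-1:ℝ) := by
      refine Real.rpow_le_rpow_of_exponent_le (by linarith) (neg_le_neg ?_)
      rw [le_div_iff₀ (by linarith)]; linarith
    rw [Real.rpow_neg_one] at h1
    refine h1.trans ?_
    rw [inv_le_comm₀ hT0 (by norm_num)]; norm_num; exact hT
  have e1 : T ^ n * δ = T ^ γ := by
    rw [hδ, ← Real.rpow_natCast, ← Real.rpow_add hT0]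
    congr 1; rw [hγ]; field_simp; ring
  have e2 : δ ^ (-((n:ℝ) - 1) / 2) = T ^ γ := by
    rw [hδ, ← Real.rpow_mul hT0.le]
    congr 1; rw [hγ]; field_simp
  have adm1 : Adm (1/2 - δ) 1 δ := ⟨by linarith, by linarith, by linarith, hδ0, by linarith⟩
  have adm2 : Adm (1/2) (1 - δ) δ := ⟨by linarith, by linarith, by linarith, hδ0, by linarith⟩
  have sT1 : ∀ {u v : ℝ}, v + δ ≤ u → Real.smoothTransition ((u - v) / δ) = 1 := fun h => 
    Real.smoothTransition.one_of_one_le (by rw [le_div_iff₀ hδ0]; linarith)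
  have sT0 : ∀ {u v : ℝ}, u ≤ v → Real.smoothTransition ((u - v) / δ) = 0 := fun h => 
    Real.smoothTransition.zero_of_nonpos (div_nonpos_of_nonpos_of_nonneg (by linarith) hδ0.le)
  have key : ∀ α β, Adm α β δ → |α - 1/2| + |β - 1| ≤ δ → (∀ r, 1/2 + δ < r → r < 1 - δ → chi α β δ r = 1) → 
      (∀ r, r < 1/2 - δ ∨ 1 + δ < r → chi α β δ r = 0) → ∃ S : ℝ, 0 ≤ S ∧ 
      ∑' x : idealLattice K I, coneI (x : mixedSpace K) * ENNReal.ofReal (chi α β δ (rad (R := RK K) (C := CK K) x / T)) = ENNReal.ofReal S ∧ 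
      |S - c * J0 * T ^ n| ≤ (|c| * (4 * 2 ^ n) + C) * T ^ γ := by
    intro α β hadm h1 h2 h3
    obtain ⟨S, hS0, hS, hb⟩ := hsm α β δ hadm T (by linarith)
    refine ⟨S, hS0, hS, ?_⟩
    have hI := chi_ind_int hadm n h1 h2 h3
    rw [e2] at hb
    rw [← hJ0] at hI
    set Q := ∫ r : ℝ, r ^ (n - 1) * chi α β δ r
    calc |S - c * J0 * T ^ n| = |(S - c * T ^ n * Q) + c * T ^ n * (Q - J0)| := by congr 1; ring
      _ ≤ |S - c * T ^ n * Q| + |c * T ^ n * (Q - J0)| := abs_add_le _ _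
      _ ≤ C * T ^ γ + |c| * T ^ n * (4 * 2 ^ n * δ) := by
        refine add_le_add hb ?_
        rw [abs_mul, abs_mul, abs_of_pos (pow_pos hT0 n)]
        gcongr
      _ = (|c| * (4 * 2 ^ n) + C) * T ^ γ := by rw [← e1]; ring
  obtain ⟨S1, hS10, hS1, hb1⟩ := key _ _ adm1 
    (by rw [sub_self, abs_zero, add_zero, show (1/2 - δ - 1/2:ℝ) = -δ by ring, abs_neg, abs_of_pos hδ0]) 
    (fun r h1 h2 => by rw [chi, sT1 (by linarith), sT0 (by linarith), sub_zero])
    (fun r h => chi_zero adm1 (by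
      intro h'
      rcases h with h | h
      · linarith [h'.1]
      · linarith [h'.2]))
  obtain ⟨S2, hS20, hS2, hb2⟩ := key _ _ adm2
    (by rw [sub_self, abs_zero, zero_add, show (1 - δ - 1:ℝ) = -δ by ring, abs_neg, abs_of_pos hδ0]) 
    (fun r h1 h2 => by rw [chi, sT1 (by linarith), sT0 (by linarith), sub_zero])
    (fun r h => chi_zero adm2 (by
      intro h'
      rcases h with h | h
      · linarith [h'.1]
      · linarith [h'.2]))
  have hD0 : 0 ≤ NT I T - NT I (T/2) := by
    rw [sub_nonneg, NT, NT]
    exact_mod_cast Set.ncard_le_ncard (NS_mono I (by linarith)) (NS_finite I _)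
  have hup : NT I T - NT I (T/2) ≤ S1 := by
    rw [← ENNReal.ofReal_le_ofReal_iff hS10, NT_diff I hT0, ← hS1]
    refine ENNReal.tsum_le_tsum fun x => ?_
    gcongr
    by_cases hx : rad (R := RK K) (C := CK K) x / T ∈ Set.Ioc (1/2:ℝ) 1
    · rw [Set.indicator_of_mem hx, chi, sT1 (by linarith [hx.1]), sT0 hx.2, sub_zero]
    · rw [Set.indicator_of_notMem hx]; exact chi_nonneg adm1 _
  have hlow : S2 ≤ NT I T - NT I (T/2) := by
    rw [← ENNReal.ofReal_le_ofReal_iff hD0, NT_diff I hT0, ← hS2]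
    refine ENNReal.tsum_le_tsum fun x => ?_
    gcongr
    by_cases hx : rad (R := RK K) (C := CK K) x / T ∈ Set.Ioc (1/2:ℝ) 1
    · rw [Set.indicator_of_mem hx]; exact chi_le_one _ _ _ _
    · rw [Set.indicator_of_notMem hx]
      rw [Set.mem_Ioc, not_and_or, not_lt, not_le] at hx
      rcases hx with hx | hx
      · rw [chi, sT0 hx, sT0 (by linarith), sub_zero]
      · rw [chi, sT1 (by linarith), sT1 (by linarith), sub_self]
  rw [abs_le] at hb1 hb2 ⊢
  constructor <;> linarith [hb1.1, hb1.2, hb2.1, hb2.2]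

lemma dyadic_sum {N : ℝ → ℝ} (h0 : ∀ T, 0 ≤ N T) (hmono : Monotone N) {n : ℕ} (hn : 1 ≤ n) {γ c C : ℝ} (hγ : 0 < γ) (hC : 0 ≤ C)
    (h : ∀ T, 4 ≤ T → |(N T - N (T/2)) - c * T ^ n| ≤ C * T ^ γ) : 
    ∃ c' C' : ℝ, 0 ≤ C' ∧ ∀ T, 1 ≤ T → |N T - c' * T ^ n| ≤ C' * T ^ γ := by
  have h2n : ((1:ℝ)/2) ^ n < 1 := pow_lt_one₀ (by norm_num) (by norm_num) (by omega)
  have h2g : ((1:ℝ)/2) ^ γ < 1 := Real.rpow_lt_one (by norm_num) (by norm_num) hγ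
  set c' := c / (1 - (1/2)^n) with hc'
  set C' := N 4 + |c'| * 4 ^ n + C / (1 - (1/2)^γ) with hC'
  have hCd : 0 ≤ C / (1 - (1/2:ℝ)^γ) := div_nonneg hC (by linarith)
  have hC'0 : 0 ≤ C' := by have := h0 4; positivity
  refine ⟨c', C', hC'0, ?_⟩
  have hind : ∀ k : ℕ, ∀ T, 1 ≤ T → T < 4 * 2 ^ k → |N T - c' * T ^ n| ≤ C' * T ^ γ := by
    intro k
    induction k with
    | zero =>
      intro T hT hT4
      have hT4' : T ≤ 4 := by simpa using hT4.le
      have h1 : N T ≤ N 4 := hmono hT4'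
      have h3 : |N T - c' * T ^ n| ≤ N 4 + |c'| * 4 ^ n := by
        refine (abs_sub _ _).trans ?_
        rw [abs_of_nonneg (h0 T), abs_mul, abs_of_nonneg (pow_nonneg (by linarith : (0:ℝ) ≤ T) n)]
        gcongr
      refine h3.trans ((by linarith : _ ≤ C').trans ?_)
      exact le_mul_of_one_le_right hC'0 (Real.one_le_rpow hT hγ.le)
    | succ k ih =>
      intro T hT hTk
      by_cases hT4 : T < 4 * 2 ^ k
      · exact ih T hT hT4
      have hT4' : 4 ≤ T := by
        rw [not_lt] at hT4
        refine le_trans ?_ hT4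
        have : (1:ℝ) ≤ 2 ^ k := one_le_pow₀ (by norm_num)
        linarith
      have hi := ih (T/2) (by linarith) (by rw [pow_succ] at hTk; linarith)
      have hh := h T hT4'
      have e1 : c' * T ^ n - c' * (T/2) ^ n = c * T ^ n := by
        rw [show T / 2 = (1/2) * T by ring, mul_pow, hc']
        have : (1 - (1/2:ℝ)^n) ≠ 0 := by linarith
        field_simp
      have e2 : (T/2) ^ γ = (1/2) ^ γ * T ^ γ := by
        rw [show T / 2 = (1/2) * T by ring, Real.mul_rpow (by norm_num) (by linarith)]
      have hTγ : 0 < T ^ γ := Real.rpow_pos_of_pos (by linarith) _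
      have e3 : C + C' * (1/2) ^ γ ≤ C' := by
        have : C / (1 - (1/2)^γ) * (1 - (1/2:ℝ)^γ) = C := div_mul_cancel₀ _ (by linarith)
        have h5 : C / (1 - (1/2:ℝ)^γ) ≤ C' := by
          have := h0 4
          have : 0 ≤ |c'| * 4 ^ n := by positivity
          linarith
        nlinarith
      calc |N T - c' * T ^ n| = |((N T - N (T/2)) - c * T ^ n) + (N (T/2) - c' * (T/2) ^ n)| := by
            congr 1; linarith
        _ ≤ C * T ^ γ + C' * (T/2) ^ γ := (abs_add_le _ _).trans (add_le_add hh hi)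
        _ = (C + C' * (1/2) ^ γ) * T ^ γ := by rw [e2]; ring
        _ ≤ C' * T ^ γ := by gcongr
  intro T hT
  obtain ⟨k, hk⟩ := pow_unbounded_of_one_lt T (by norm_num : (1:ℝ) < 2)
  exact hind k T hT (by linarith [pow_pos (by norm_num : (0:ℝ) < 2) k])

theorem cone_count (hn : 2 ≤ dimV (RK K) (CK K)) (I : (FractionalIdeal (nonZeroDivisors (𝓞 K)) K)ˣ) : 
    ∃ c C : ℝ, 0 ≤ C ∧ ∀ s : ℝ, 1 ≤ s → |((Nat.card {x : idealLattice K I // (x : mixedSpace K) ∈ fundamentalCone K ∧ mixedEmbedding.norm (x : mixedSpace K) ≤ s} : ℕ) : ℝ) - c * s| 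
      ≤ C * s ^ (((dimV (RK K) (CK K) : ℝ) - 1) / (dimV (RK K) (CK K) + 1)) := by
  obtain ⟨c, C, hC, h⟩ := shell_count hn I
  set n := dimV (RK K) (CK K) with hndef
  have hnR : (2:ℝ) ≤ n := by exact_mod_cast hn
  obtain ⟨c', C', hC', h'⟩ := dyadic_sum (N := NT I) (fun T => by rw [NT]; positivity) (fun T T' hTT => by
    rw [NT, NT]
    exact_mod_cast Set.ncard_le_ncard (NS_mono I hTT) (NS_finite I _)) (by omega : 1 ≤ n) 
    (γ := (n:ℝ) * (n - 1) / (n + 1)) (div_pos (mul_pos (by linarith) (by linarith)) (by linarith)) hC h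
  refine ⟨c', C', hC', fun s hs => ?_⟩
  have hs0 : 0 ≤ s := by linarith
  have hT := h' (s ^ (1 / (n:ℝ))) (Real.one_le_rpow hs (by positivity))
  have e1 : (s ^ (1 / (n:ℝ))) ^ n = s := by
    rw [one_div, Real.rpow_inv_natCast_pow hs0 (by omega)]
  have e2 : (s ^ (1 / (n:ℝ))) ^ ((n:ℝ) * (n - 1) / (n + 1)) = s ^ (((n:ℝ) - 1) / (n + 1)) := by
    rw [← Real.rpow_mul hs0]; congr 1; field_simp
  rw [e1, e2] at hT
  have e3 : NT I (s ^ (1 / (n:ℝ))) = ((Nat.card {x : idealLattice K I // (x : mixedSpace K) ∈ fundamentalCone K ∧ mixedEmbedding.norm (x : mixedSpace K) ≤ s} : ℕ) : ℝ) := by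
    rw [NT, ← Nat.card_coe_set_eq]
    congr 1
    refine Nat.card_congr (Equiv.subtypeEquivRight fun x => ?_)
    show _ ∧ _ ↔ _
    refine and_congr_right fun _ => ?_
    rw [← nrmV_K, rad]
    exact Real.rpow_le_rpow_iff (nrmV_nonneg _) hs0 (by positivity)
  rwa [e3] at hT

end Landau

namespace Landau
open scoped ContDiff Classical nonZeroDivisors
open MeasureTheory NumberField NumberField.mixedEmbedding NumberField.InfinitePlace Ideal

variable (K : Type) [Field K] [NumberField K]

/-- number of nonzero ideals of norm at most `s` -/
def IC (s : ℝ) : ℕ := Nat.card {I : (Ideal (𝓞 K))⁰ // (absNorm (I : Ideal (𝓞 K)) : ℝ) ≤ s}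

variable {K}

lemma class_aux {C : ClassGroup (𝓞 K)} {J : (Ideal (𝓞 K))⁰} (s : ℝ) (hJ : ClassGroup.mk0 J = C⁻¹) :
    Nat.card {I : (Ideal (𝓞 K))⁰ // absNorm (I : Ideal (𝓞 K)) ≤ s ∧ ClassGroup.mk0 I = C}
      = Nat.card {I : (Ideal (𝓞 K))⁰ // (J : Ideal (𝓞 K)) ∣ I ∧ Submodule.IsPrincipal (I : Ideal (𝓞 K)) ∧
        absNorm (I : Ideal (𝓞 K)) ≤ s * absNorm (J : Ideal (𝓞 K))} := by
  simp_rw [← nonZeroDivisors_dvd_iff_dvd_coe]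
  refine Nat.card_congr ?_
  refine ((Equiv.dvd J).subtypeEquiv fun I ↦ ?_).trans
    (Equiv.subtypeSubtypeEquivSubtypeInter (fun I : (Ideal (𝓞 K))⁰ ↦ J ∣ I) _)
  rw [← ClassGroup.mk0_eq_one_iff (SetLike.coe_mem _)]
  simp_rw [Equiv.dvd_apply, Submonoid.coe_mul, ← Submonoid.mul_def, _root_.map_mul, hJ,
    inv_mul_eq_one, Nat.cast_mul, mul_comm s, eq_comm, and_comm, and_congr_left_iff]
  exact fun _ ↦
    (mul_le_mul_iff_of_pos_left (Nat.cast_pos.mpr (absNorm_pos_of_nonZeroDivisors J))).symm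

lemma IC_sum {s : ℝ} (hs : 0 ≤ s) : (IC K s : ℝ) = ∑ C : ClassGroup (𝓞 K), 
    (Nat.card {I : (Ideal (𝓞 K))⁰ // absNorm (I : Ideal (𝓞 K)) ≤ s ∧ ClassGroup.mk0 I = C} : ℝ) := by
  have : Fintype {I : (Ideal (𝓞 K))⁰ // absNorm (I : Ideal (𝓞 K)) ≤ s} := by
    simp_rw [← Nat.le_floor_iff hs]
    refine @Fintype.ofFinite _ (finite_setOfPred_absNorm_le₀ ⌊s⌋₊)
  let e := fun C : ClassGroup (𝓞 K) ↦ Equiv.subtypeSubtypeEquivSubtypeInter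
    (fun I : (Ideal (𝓞 K))⁰ ↦ absNorm I.1 ≤ s) (fun I ↦ ClassGroup.mk0 I = C)
  rw [IC]
  simp_rw [← Nat.card_congr (e _), Nat.card_eq_fintype_card, Fintype.subtype_card]
  rw [Fintype.card, Finset.card_eq_sum_card_fiberwise (f := fun I ↦ ClassGroup.mk0 I.1)
    (t := Finset.univ) (fun _ _ ↦ Finset.mem_univ _), Nat.cast_sum]

lemma class_count (hn : 2 ≤ dimV (RK K) (CK K)) (C : ClassGroup (𝓞 K)) : ∃ c B : ℝ, 0 ≤ B ∧ ∀ s : ℝ, 1 ≤ s → 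
    |(Nat.card {I : (Ideal (𝓞 K))⁰ // absNorm (I : Ideal (𝓞 K)) ≤ s ∧ ClassGroup.mk0 I = C} : ℝ) - c * s| ≤ 
      B * s ^ (((dimV (RK K) (CK K) : ℝ) - 1) / (dimV (RK K) (CK K) + 1)) := by
  obtain ⟨J, hJ⟩ := ClassGroup.mk0_surjective C⁻¹
  obtain ⟨c, B, hB, h⟩ := cone_count hn (FractionalIdeal.mk0 K J)
  set α := ((dimV (RK K) (CK K) : ℝ) - 1) / (dimV (RK K) (CK K) + 1) with hα
  set w : ℝ := (Units.torsionOrder K : ℝ) with hw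
  have hw0 : 0 < w := by
    rw [hw]; exact_mod_cast Nat.pos_of_ne_zero (Units.torsionOrder_ne_zero K)
  set N : ℝ := ((absNorm (J : Ideal (𝓞 K)) : ℕ) : ℝ) with hN
  have hN1 : 1 ≤ N := by rw [hN]; exact_mod_cast absNorm_pos_of_nonZeroDivisors J
  refine ⟨c * N / w, B * N ^ α / w, by positivity, fun s hs => ?_⟩
  have h1 := h (s * N) (by nlinarith)
  have e : Nat.card {x : idealLattice K (FractionalIdeal.mk0 K J) // (x : mixedSpace K) ∈ fundamentalCone K ∧ mixedEmbedding.norm (x : mixedSpace K) ≤ s * N} 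
      = Nat.card {a : fundamentalCone.idealSet K J // mixedEmbedding.norm (a : mixedSpace K) ≤ s * N} := by
    refine Nat.card_congr 
      { toFun := fun x => ⟨⟨x.1.1, x.2.1, x.1.2⟩, x.2.2⟩
        invFun := fun x => ⟨⟨x.1.1, x.1.2.2⟩, x.1.2.1, x.2⟩
        left_inv := fun x => rfl
        right_inv := fun x => rfl }
  rw [e, ← fundamentalCone.card_isPrincipal_dvd_norm_le, ← class_aux s hJ, Nat.cast_mul, ← hw] at h1
  set X := (Nat.card {I : (Ideal (𝓞 K))⁰ // absNorm (I : Ideal (𝓞 K)) ≤ s ∧ ClassGroup.mk0 I = C} : ℝ)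
  have e2 : X - c * N / w * s = (X * w - c * (s * N)) / w := by field_simp
  have e3 : B * N ^ α / w * s ^ α = B * (s * N) ^ α / w := by
    rw [Real.mul_rpow (by linarith) (by linarith)]; ring
  rw [e2, e3, abs_div, abs_of_pos hw0]
  gcongr

lemma int_surj (h1 : Module.finrank ℚ K = 1) (x : 𝓞 K) : ∃ n : ℤ, (n : 𝓞 K) = x := by
  have hb := (bijective_algebraMap_of_linearEquiv (LinearEquiv.ofFinrankEq ℚ K (by rw [h1, Module.finrank_self])))
  obtain ⟨q, hq⟩ := hb.2 (x : K)
  have hx : IsIntegral ℤ (x : K) := x.isIntegral_coe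
  rw [← hq, isIntegral_algebraMap_iff hb.1] at hx
  obtain ⟨n, hn⟩ := IsIntegrallyClosed.isIntegral_iff.1 hx
  refine ⟨n, RingOfIntegers.ext ?_⟩
  rw [← hq, ← hn]; simp

lemma IC_one (h1 : Module.finrank ℚ K = 1) {s : ℝ} (hs : 0 ≤ s) : IC K s = ⌊s⌋₊ := by
  have hN : ∀ n : ℕ, absNorm (span {(n : 𝓞 K)}) = n := by
    intro n
    rw [absNorm_span_singleton]
    have : ((n:ℕ) : 𝓞 K) = algebraMap ℤ (𝓞 K) n := by simp
    rw [this, Algebra.norm_algebraMap, RingOfIntegers.rank, h1]; simp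
  have hI : ∀ I : Ideal (𝓞 K), ∃ n : ℕ, I = span {(n : 𝓞 K)} := by
    intro I
    have hsurj : Function.Surjective (algebraMap ℤ (𝓞 K)) := fun x => by
      obtain ⟨n, hn⟩ := int_surj h1 x
      exact ⟨n, by simpa using hn⟩
    obtain ⟨g, hg⟩ := (IsPrincipalIdealRing.principal (I.comap (algebraMap ℤ (𝓞 K)))).principal
    refine ⟨g.natAbs, ?_⟩
    rw [← map_comap_of_surjective _ hsurj I, hg, ← Ideal.span, ← Int.span_natAbs, map_span]
    simp
  have hpos : ∀ I : (Ideal (𝓞 K))⁰, 1 ≤ absNorm (I : Ideal (𝓞 K)) := fun I => absNorm_pos_of_nonZeroDivisors I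
  have e : Nat.card {I : (Ideal (𝓞 K))⁰ // (absNorm (I : Ideal (𝓞 K)) : ℝ) ≤ s} = Nat.card (Finset.Icc 1 ⌊s⌋₊) := by
    refine Nat.card_congr (Equiv.ofBijective (fun I => ⟨absNorm (I.1 : Ideal (𝓞 K)), Finset.mem_Icc.2 ⟨hpos _, Nat.le_floor I.2⟩⟩) ⟨?_, ?_⟩)
    · rintro ⟨⟨I, hI0⟩, hIs⟩ ⟨⟨J, hJ0⟩, hJs⟩ h
      obtain ⟨n, hn⟩ := hI I
      obtain ⟨m, hm⟩ := hI J
      have h' : absNorm I = absNorm J := Subtype.ext_iff.1 h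
      rw [hn, hm, hN, hN] at h'
      refine Subtype.ext (Subtype.ext ?_)
      show I = J
      rw [hn, hm, h']
    · rintro ⟨k, hk⟩
      rw [Finset.mem_Icc] at hk
      refine ⟨⟨⟨span {(k : 𝓞 K)}, ?_⟩, ?_⟩, ?_⟩
      · rw [mem_nonZeroDivisors_iff_ne_zero]
        intro h
        have := hN k
        rw [h, Ideal.zero_eq_bot, absNorm_bot] at this; omega
      · show ((absNorm (span {(k : 𝓞 K)}) : ℕ) : ℝ) ≤ s
        rw [hN]; exact (Nat.le_floor_iff hs).1 hk.2
      · exact Subtype.ext (hN k)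
  rw [IC, e, Nat.card_eq_fintype_card, Fintype.card_coe, Nat.card_Icc]; omega

variable (K) in
def kap : ℝ := (2 ^ nrRealPlaces K * (2 * Real.pi) ^ nrComplexPlaces K * Units.regulator K * classNumber K) /
            (Units.torsionOrder K * Real.sqrt |discr K|)

lemma landau_c : ∃ c B : ℝ, 0 ≤ B ∧ ∀ s : ℝ, 1 ≤ s → |(IC K s : ℝ) - c * s| ≤ B * s ^ (1 - 2 / ((Module.finrank ℚ K : ℝ) + 1)) := by
  by_cases h1 : Module.finrank ℚ K = 1
  · refine ⟨1, 1, zero_le_one, fun s hs => ?_⟩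
    rw [IC_one h1 (by linarith), h1]
    norm_num
    have h2 := Nat.floor_le (by linarith : 0 ≤ s)
    have h3 := Nat.lt_floor_add_one s
    exact abs_le.2 ⟨by linarith, by linarith⟩
  · have hn : 2 ≤ dimV (RK K) (CK K) := by
      have := dimV_K K
      have := dim_pos (K := K)
      omega
    choose c B hB h using class_count hn
    refine ⟨∑ C, c C, ∑ C, B C, Finset.sum_nonneg fun C _ => hB C, fun s hs => ?_⟩
    have e : 1 - 2 / ((Module.finrank ℚ K : ℝ) + 1) = ((dimV (RK K) (CK K) : ℝ) - 1) / (dimV (RK K) (CK K) + 1) := by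
      rw [← dimV_K]; field_simp; ring
    rw [IC_sum (by linarith), e, Finset.sum_mul, Finset.sum_mul, ← Finset.sum_sub_distrib]
    exact (Finset.abs_sum_le_sum_abs _ _).trans (Finset.sum_le_sum fun C _ => h C s hs)

theorem landau : ∃ B : ℝ, 0 ≤ B ∧ ∀ s : ℝ, 1 ≤ s → |(IC K s : ℝ) - kap K * s| ≤ B * s ^ (1 - 2 / ((Module.finrank ℚ K : ℝ) + 1)) := by
  obtain ⟨c, B, hB, h⟩ := landau_c (K := K)
  refine ⟨B, hB, ?_⟩
  suffices hc : c = kap K by rwa [hc] at h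
  refine tendsto_nhds_unique ?_ (NumberField.Ideal.tendsto_norm_le_div_atTop₀ K)
  have hz : Tendsto (fun s : ℝ => B * s ^ (-(2 / ((Module.finrank ℚ K : ℝ) + 1)))) atTop (𝓝 0) := by
    rw [← mul_zero B]
    exact (tendsto_rpow_neg_atTop (by positivity)).const_mul B
  rw [← tendsto_sub_nhds_zero_iff]
  refine squeeze_zero_norm' ?_ hz
  filter_upwards [eventually_ge_atTop 1] with s hs
  have hs0 : 0 < s := by linarith
  have := h s hs
  have e : ((IC K s : ℝ)) / s - c = (IC K s - c * s) / s := by field_simp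
  have e2 : s ^ (-(2 / ((Module.finrank ℚ K : ℝ) + 1))) = s ^ (1 - 2 / ((Module.finrank ℚ K : ℝ) + 1)) / s := by
    rw [sub_eq_add_neg, Real.rpow_add hs0, Real.rpow_one]; field_simp
  show ‖(IC K s : ℝ) / s - c‖ ≤ _
  rw [e, Real.norm_eq_abs, abs_div, abs_of_pos hs0, e2, ← mul_div_assoc]
  gcongr

end Landau

namespace Landau
open scoped Classical nonZeroDivisors
open NumberField Ideal

variable (K : Type) [Field K] [NumberField K]

/-- the exponent in the Landau theorem -/
def al : ℝ := 1 - 2 / ((Module.finrank ℚ K : ℝ) + 1)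

lemma idfin (x : ℝ) : {m : Ideal (𝓞 K) | m ≠ 0 ∧ (absNorm m : ℝ) ≤ x}.Finite := by
  refine (finite_setOfPred_absNorm_le (S := 𝓞 K) ⌊x⌋₊).subset ?_
  rintro m ⟨hm, h⟩
  exact Nat.le_floor h

/-- nonzero ideals of norm at most `x` -/
def idF (x : ℝ) : Finset (Ideal (𝓞 K)) := (idfin K x).toFinset

variable {K}

lemma mem_idF {x : ℝ} {m : Ideal (𝓞 K)} : m ∈ idF K x ↔ m ≠ 0 ∧ (absNorm m : ℝ) ≤ x := by
  simp [idF]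

lemma al_nonneg : 0 ≤ al K := by
  have : (1 : ℝ) ≤ Module.finrank ℚ K := by exact_mod_cast Module.finrank_pos
  unfold al
  rw [sub_nonneg, div_le_one (by positivity)]; linarith

lemma al_lt : al K < 1 := by
  unfold al
  have : 0 < 2 / ((Module.finrank ℚ K : ℝ) + 1) := by positivity
  linarith

lemma card_idF (x : ℝ) : (idF K x).card = IC K x := by
  have e : Nat.card (idF K x) = (idF K x).card := by simp
  rw [IC, ← e]
  refine Nat.card_congr ⟨fun m => ⟨⟨m.1, mem_nonZeroDivisors_iff_ne_zero.2 (mem_idF.1 m.2).1⟩, (mem_idF.1 m.2).2⟩,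
    fun m => ⟨m.1.1, mem_idF.2 ⟨mem_nonZeroDivisors_iff_ne_zero.1 m.1.2, m.2⟩⟩, fun _ => rfl, fun _ => rfl⟩

lemma norm_ge_one {m : Ideal (𝓞 K)} (hm : m ≠ 0) : 1 ≤ absNorm m := by
  rw [Nat.one_le_iff_ne_zero, Ne, absNorm_eq_zero_iff]; exact hm

lemma landau' : ∃ B : ℝ, 0 ≤ B ∧ ∀ y : ℝ, 0 < y → |((idF K y).card : ℝ) - kap K * y| ≤ B * y ^ al K := by
  obtain ⟨B, hB, h⟩ := landau (K := K)
  refine ⟨B + |kap K|, by positivity, fun y hy => ?_⟩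
  have h0 : 0 ≤ y ^ al K := by positivity
  rw [add_mul]
  rcases le_or_gt 1 y with h1 | h1
  · rw [card_idF]
    have := h y h1
    have : 0 ≤ |kap K| * y ^ al K := by positivity
    unfold al at *
    linarith
  · have : idF K y = ∅ := by
      ext m
      simp only [mem_idF, Finset.notMem_empty, iff_false, not_and, not_le]
      intro hm
      have : (1 : ℝ) ≤ absNorm m := by exact_mod_cast norm_ge_one hm
      linarith
    rw [this, Finset.card_empty, Nat.cast_zero, zero_sub, abs_neg, abs_mul, abs_of_pos hy]
    have h2 : y ≤ y ^ al K := by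
      have := Real.rpow_le_rpow_of_exponent_ge hy h1.le (al_lt (K := K)).le
      rwa [Real.rpow_one] at this
    have h3 : |kap K| * y ≤ |kap K| * y ^ al K := by gcongr
    have : 0 ≤ B * y ^ al K := by positivity
    linarith

lemma card_le : ∃ A : ℝ, 0 ≤ A ∧ ∀ y : ℝ, 1 ≤ y → ((idF K y).card : ℝ) ≤ A * y := by
  obtain ⟨B, hB, h⟩ := landau' (K := K)
  refine ⟨B + |kap K|, by positivity, fun y hy => ?_⟩
  have h1 := (abs_le.1 (h y (by linarith))).2
  have h2 : y ^ al K ≤ y := by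
    have := Real.rpow_le_rpow_of_exponent_le hy (al_lt (K := K)).le
    rwa [Real.rpow_one] at this
  have h3 : B * y ^ al K ≤ B * y := by gcongr
  have h4 : kap K * y ≤ |kap K| * y := by gcongr; exact le_abs_self _
  linarith

lemma dyadic : ∃ A : ℝ, 0 ≤ A ∧ ∀ θ : ℝ, 0 ≤ θ → ∀ a b : ℕ, ∀ F : Finset (Ideal (𝓞 K)),
    (∀ m ∈ F, m ≠ 0 ∧ Nat.log 2 (absNorm m) ∈ Finset.Ico a b) →
    ∑ m ∈ F, (absNorm m : ℝ) ^ (-θ) ≤ A * ∑ k ∈ Finset.Ico a b, ((2 : ℝ) ^ (1 - θ)) ^ k := by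
  obtain ⟨A, hA, h⟩ := card_le (K := K)
  refine ⟨2 * A, by positivity, fun θ hθ a b F hF => ?_⟩
  rw [← Finset.sum_fiberwise_of_maps_to (fun m hm => (hF m hm).2), Finset.mul_sum]
  refine Finset.sum_le_sum fun k _ => ?_
  have h1 : ∀ m ∈ F.filter (fun m => Nat.log 2 (absNorm m) = k), (absNorm m : ℝ) ^ (-θ) ≤ ((2 : ℝ) ^ k) ^ (-θ) := by
    intro m hm
    rw [Finset.mem_filter] at hm
    have h1 : 2 ^ k ≤ absNorm m := by
      rw [← hm.2]; exact Nat.pow_log_le_self 2 (by have := norm_ge_one (hF m hm.1).1; omega)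
    refine Real.rpow_le_rpow_of_nonpos (by positivity) ?_ (by linarith)
    exact_mod_cast h1
  refine (Finset.sum_le_card_nsmul _ _ _ h1).trans ?_
  have h2 : (F.filter (fun m => Nat.log 2 (absNorm m) = k)) ⊆ idF K ((2 : ℝ) ^ (k + 1)) := by
    intro m hm
    rw [Finset.mem_filter] at hm
    refine mem_idF.2 ⟨(hF m hm.1).1, ?_⟩
    have h1 : absNorm m < 2 ^ (k + 1) := by
      rw [← hm.2]; exact Nat.lt_pow_succ_log_self (by norm_num) _
    exact_mod_cast h1.le
  have h3 : ((F.filter (fun m => Nat.log 2 (absNorm m) = k)).card : ℝ) ≤ A * 2 ^ (k + 1) :=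
    (by exact_mod_cast Finset.card_le_card h2 : _ ≤ ((idF K ((2 : ℝ) ^ (k + 1))).card : ℝ)).trans
      (h _ (one_le_pow₀ (by norm_num)))
  rw [nsmul_eq_mul]
  calc _ ≤ (A * 2 ^ (k + 1)) * ((2 : ℝ) ^ k) ^ (-θ) := by gcongr
    _ = _ := by
      rw [← Real.rpow_natCast (2 ^ (1 - θ)) k, ← Real.rpow_mul (by norm_num), mul_comm (1 - θ), Real.rpow_mul (by norm_num),
        Real.rpow_natCast, sub_eq_add_neg, Real.rpow_add (by positivity), Real.rpow_one, pow_succ]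
      ring

lemma head_log {Y : ℝ} {m : Ideal (𝓞 K)} (hm : m ∈ idF K Y) :
    Nat.log 2 (absNorm m) ∈ Finset.Ico 0 (Nat.log 2 ⌊Y⌋₊ + 1) := by
  rw [Finset.mem_Ico]
  refine ⟨Nat.zero_le _, Nat.lt_succ_of_le (Nat.log_mono_right (Nat.le_floor (mem_idF.1 hm).2))⟩

lemma pow_log_floor {Y : ℝ} (hY : 1 ≤ Y) : (2 : ℝ) ^ (Nat.log 2 ⌊Y⌋₊) ≤ Y ∧ Y < (2 : ℝ) ^ (Nat.log 2 ⌊Y⌋₊ + 1) := by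
  have h1 : 1 ≤ ⌊Y⌋₊ := Nat.le_floor (by simpa using hY)
  constructor
  · have : 2 ^ (Nat.log 2 ⌊Y⌋₊) ≤ ⌊Y⌋₊ := Nat.pow_log_le_self 2 (by omega)
    have h2 : ((2 ^ (Nat.log 2 ⌊Y⌋₊) : ℕ) : ℝ) ≤ Y := (Nat.cast_le.2 this).trans (Nat.floor_le (by linarith))
    exact_mod_cast h2
  · have : ⌊Y⌋₊ < 2 ^ (Nat.log 2 ⌊Y⌋₊ + 1) := Nat.lt_pow_succ_log_self (by norm_num) _
    have h2 : Y < ((2 ^ (Nat.log 2 ⌊Y⌋₊ + 1) : ℕ) : ℝ) :=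
      (Nat.lt_floor_add_one Y).trans_le (by exact_mod_cast this)
    exact_mod_cast h2

/-- tail bound -/
lemma tail_bound (h : ℕ) (hh : 2 ≤ h) : ∃ T : ℝ, 0 ≤ T ∧ ∀ Y : ℝ, 1 ≤ Y → ∀ F : Finset (Ideal (𝓞 K)),
    (∀ m ∈ F, m ≠ 0 ∧ Y ≤ absNorm m) → ∑ m ∈ F, (absNorm m : ℝ) ^ (-(h : ℝ)) ≤ T * Y ^ (1 - (h : ℝ)) := by
  obtain ⟨A, hA, hd⟩ := dyadic (K := K)
  have hh' : (2 : ℝ) ≤ h := by exact_mod_cast hh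
  set r : ℝ := 2 ^ (1 - (h : ℝ)) with hr
  have hr0 : 0 < r := by positivity
  have hr1 : r < 1 := Real.rpow_lt_one_of_one_lt_of_neg (by norm_num) (by linarith)
  refine ⟨A * ((1 - r)⁻¹ * r⁻¹), by have : 0 < 1 - r := by linarith
                                    positivity, fun Y hY F hF => ?_⟩
  set a := Nat.log 2 ⌊Y⌋₊ with ha
  have := hd h (by positivity) a (F.sup (fun m => Nat.log 2 (absNorm m)) + 1) F (fun m hm => ⟨(hF m hm).1, ?_⟩)
  · refine this.trans ?_
    rw [mul_assoc]
    refine mul_le_mul_of_nonneg_left ?_ hA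
    have h1 := geom_sum_Ico_le_of_lt_one hr0.le hr1 (m := a) (n := F.sup (fun m => Nat.log 2 (absNorm m)) + 1)
    refine h1.trans ?_
    have h2 : r ^ (a + 1) ≤ Y ^ (1 - (h : ℝ)) := by
      rw [hr, ← Real.rpow_natCast (2 ^ (1 - (h : ℝ))), ← Real.rpow_mul (by norm_num), mul_comm (1 - (h : ℝ)), Real.rpow_mul (by norm_num), Real.rpow_natCast]
      exact Real.rpow_le_rpow_of_nonpos (by linarith) (pow_log_floor hY).2.le (by linarith)
    have : r ^ a = r⁻¹ * r ^ (a + 1) := by rw [pow_succ]; field_simp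
    rw [div_eq_mul_inv, this, mul_assoc, mul_comm _ (1 - r)⁻¹, mul_left_comm]
    have : 0 < 1 - r := by linarith
    rw [mul_assoc]
    gcongr
  · rw [Finset.mem_Ico]
    refine ⟨Nat.log_mono_right ?_, Nat.lt_succ_of_le (Finset.le_sup (f := fun m => Nat.log 2 (absNorm m)) hm)⟩
    exact Nat.floor_le_of_le (hF m hm).2

end Landau

namespace Landau
open scoped Classical nonZeroDivisors
open NumberField Ideal

variable {K : Type} [Field K] [NumberField K]

lemma RSh_eq (h : ℕ) (x : ℝ) : RSh K h x = if (1 : ℝ)/h < al K then x ^ al K else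
    if (1 : ℝ)/h = al K then x ^ al K * Real.log x else x ^ ((1 : ℝ)/h) := rfl

lemma RSh_ge (h : ℕ) : ∃ H : ℝ, 0 ≤ H ∧ ∀ x : ℝ, 2 ≤ x → x ^ ((1 : ℝ)/h) ≤ H * RSh K h x := by
  have h2 : 0 < Real.log 2 := Real.log_pos (by norm_num)
  have h3 : Real.log 2 ≤ 1 := by have := Real.log_two_lt_d9; linarith
  refine ⟨(Real.log 2)⁻¹, by positivity, fun x hx => ?_⟩
  have h4 : 1 ≤ (Real.log 2)⁻¹ := (one_le_inv₀ h2).2 h3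
  have hx0 : 0 < x := by linarith
  rw [RSh_eq]
  split_ifs with h5 h6
  · calc x ^ ((1 : ℝ)/h) ≤ 1 * x ^ al K := by
          rw [one_mul]; exact Real.rpow_le_rpow_of_exponent_le (by linarith) h5.le
      _ ≤ _ := by gcongr
  · rw [h6]
    have : Real.log 2 ≤ Real.log x := Real.log_le_log (by norm_num) hx
    calc x ^ al K = (Real.log 2)⁻¹ * (x ^ al K * Real.log 2) := by field_simp
      _ ≤ _ := by gcongr
  · calc x ^ ((1 : ℝ)/h) = 1 * x ^ ((1 : ℝ)/h) := by rw [one_mul]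
      _ ≤ _ := by gcongr

/-- head bound -/
lemma head_bound (h : ℕ) (hh : 2 ≤ h) : ∃ H : ℝ, 0 ≤ H ∧ ∀ x : ℝ, 2 ≤ x →
    ∑ d ∈ idF K (x ^ ((1 : ℝ)/h)), (x / (absNorm d : ℝ) ^ h) ^ al K ≤ H * RSh K h x := by
  obtain ⟨A, hA, hd⟩ := dyadic (K := K)
  have hh0 : (0 : ℝ) < h := by exact_mod_cast (by omega : 0 < h)
  set θ : ℝ := h * al K with hθ
  have hal := al_nonneg (K := K)
  have hθ0 : 0 ≤ θ := by positivity
  set r : ℝ := 2 ^ (1 - θ) with hr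
  have hr0 : 0 < r := by positivity
  have key : ∀ x : ℝ, 2 ≤ x → ∑ d ∈ idF K (x ^ ((1 : ℝ)/h)), (x / (absNorm d : ℝ) ^ h) ^ al K ≤
      x ^ al K * (A * ∑ k ∈ Finset.range (Nat.log 2 ⌊x ^ ((1 : ℝ)/h)⌋₊ + 1), r ^ k) := by
    intro x hx
    rw [Finset.range_eq_Ico]
    refine le_trans (le_of_eq ?_) (mul_le_mul_of_nonneg_left (hd θ hθ0 _ _ (idF K (x ^ ((1 : ℝ)/h)))
      (fun m hm => ⟨(mem_idF.1 hm).1, head_log hm⟩)) (by positivity))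
    rw [Finset.mul_sum]
    refine Finset.sum_congr rfl fun d hd => ?_
    rw [Real.div_rpow (by linarith) (by positivity), ← Real.rpow_natCast (absNorm d : ℝ), ← Real.rpow_mul (by positivity),
      div_eq_mul_inv, Real.rpow_neg (by positivity)]
  have hY : ∀ x : ℝ, 2 ≤ x → 1 ≤ x ^ ((1 : ℝ)/h) := fun x hx => Real.one_le_rpow (by linarith) (by positivity)
  rcases lt_trichotomy ((1 : ℝ)/h) (al K) with hc | hc | hc
  · have hr1 : r < 1 := by
      refine Real.rpow_lt_one_of_one_lt_of_neg (by norm_num) ?_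
      rw [div_lt_iff₀ hh0] at hc; rw [hθ]; linarith
    have : 0 < 1 - r := by linarith
    refine ⟨A * (1 - r)⁻¹, by positivity, fun x hx => (key x hx).trans ?_⟩
    rw [RSh_eq, if_pos hc, mul_comm]
    gcongr
    rw [Finset.range_eq_Ico]
    have h1 := geom_sum_Ico_le_of_lt_one hr0.le hr1 (m := 0) (n := Nat.log 2 ⌊x ^ ((1 : ℝ)/h)⌋₊ + 1)
    simpa using h1
  · have hr1 : r = 1 := by
      rw [hr, hθ, ← hc]; field_simp; simp
    have h2 : 0 < Real.log 2 := Real.log_pos (by norm_num)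
    refine ⟨A * (2 / Real.log 2), by positivity, fun x hx => (key x hx).trans ?_⟩
    rw [RSh_eq, if_neg (by rw [hc]; exact lt_irrefl _), if_pos hc, mul_comm (x ^ al K), mul_comm (x ^ al K), ← mul_assoc, mul_assoc A _ (Real.log x)]
    gcongr
    simp only [hr1, one_pow, Finset.sum_const, Finset.card_range, nsmul_eq_mul, mul_one, Nat.cast_add, Nat.cast_one]
    have h3 := (pow_log_floor (hY x hx)).1
    have h4 := Real.log_le_log (by positivity) h3
    rw [Real.log_pow, Real.log_rpow (by linarith)] at h4
    have h5 : Real.log 2 ≤ Real.log x := Real.log_le_log (by norm_num) hx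
    have h6 : (1 : ℝ)/h * Real.log x ≤ 1 * Real.log x := by
      have : (1 : ℝ)/h ≤ 1 := by rw [div_le_one hh0]; exact_mod_cast (by omega : 1 ≤ h)
      gcongr; linarith
    rw [div_mul_eq_mul_div, le_div_iff₀ h2]
    linarith
  · have hθ1 : 0 < 1 - θ := by
      rw [lt_div_iff₀ hh0] at hc; rw [hθ]; linarith
    have hr1 : 1 < r := Real.one_lt_rpow (by norm_num) hθ1
    have : 0 < r - 1 := by linarith
    refine ⟨A * (r / (r - 1)), by positivity, fun x hx => (key x hx).trans ?_⟩
    have hx0 : 0 < x := by linarith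
    rw [RSh_eq, if_neg (not_lt.2 hc.le), if_neg hc.ne']
    have e : x ^ ((1 : ℝ)/h) = x ^ al K * (x ^ ((1 : ℝ)/h)) ^ (1 - θ) := by
      rw [← Real.rpow_mul hx0.le, ← Real.rpow_add hx0]
      congr 1; rw [hθ]; field_simp; ring
    have h3 := (pow_log_floor (hY x hx)).1
    set a := Nat.log 2 ⌊x ^ ((1 : ℝ)/h)⌋₊
    have h4 : r ^ a ≤ (x ^ ((1 : ℝ)/h)) ^ (1 - θ) := by
      rw [hr, ← Real.rpow_natCast (2 ^ (1 - θ)), ← Real.rpow_mul (by norm_num), mul_comm (1 - θ), Real.rpow_mul (by norm_num), Real.rpow_natCast]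
      exact Real.rpow_le_rpow (by positivity) h3 hθ1.le
    have h5 : ∑ k ∈ Finset.range (a + 1), r ^ k ≤ (r / (r - 1)) * r ^ a := by
      rw [geom_sum_eq hr1.ne', pow_succ, div_mul_eq_mul_div]
      gcongr
      linarith
    calc x ^ al K * (A * ∑ k ∈ Finset.range (a + 1), r ^ k) ≤ x ^ al K * (A * ((r / (r - 1)) * (x ^ ((1 : ℝ)/h)) ^ (1 - θ))) := by
          gcongr; exact h5.trans (by gcongr)
      _ = A * (r / (r - 1)) * (x ^ al K * (x ^ ((1 : ℝ)/h)) ^ (1 - θ)) := by ring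
      _ = _ := by rw [← e]

end Landau

namespace Landau
open scoped Classical nonZeroDivisors
open NumberField Ideal IsDedekindDomain

variable {K : Type} [Field K] [NumberField K]

/-- the squarefree ideal attached to a finite set of primes -/
def sqP (S : Finset (HeightOneSpectrum (𝓞 K))) : Ideal (𝓞 K) := ∏ v ∈ S, v.asIdeal

lemma sqP_ne (S : Finset (HeightOneSpectrum (𝓞 K))) : sqP S ≠ 0 :=
  Finset.prod_ne_zero_iff.2 fun v _ => v.ne_bot

lemma v_dvd_v {v w : HeightOneSpectrum (𝓞 K)} (h : v.asIdeal ∣ w.asIdeal) : v = w := by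
  have := Ideal.dvd_iff_le.1 h
  exact HeightOneSpectrum.ext (w.isMaximal.eq_of_le v.isPrime.ne_top this).symm

lemma v_dvd_sqP {v : HeightOneSpectrum (𝓞 K)} {S : Finset (HeightOneSpectrum (𝓞 K))} : v.asIdeal ∣ sqP S ↔ v ∈ S := by
  constructor
  · intro h
    obtain ⟨w, hw, hd⟩ := (Prime.dvd_finsetProd_iff v.prime _).1 h
    rwa [v_dvd_v hd]
  · exact fun h => Finset.dvd_prod_of_mem _ h

lemma sqP_inj : Function.Injective (sqP (K := K)) := by
  intro S T h
  ext v
  rw [← v_dvd_sqP, h, v_dvd_sqP]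

lemma sqP_pow_dvd {S : Finset (HeightOneSpectrum (𝓞 K))} {k : ℕ} {m : Ideal (𝓞 K)} :
    sqP S ^ k ∣ m ↔ ∀ v ∈ S, v.asIdeal ^ k ∣ m := by
  constructor
  · intro h v hv
    exact (pow_dvd_pow_of_dvd (v_dvd_sqP.2 hv) k).trans h
  · intro h
    rw [sqP, ← Finset.prod_pow]
    refine Finset.prod_dvd_of_isRelPrime ?_ h
    intro v hv w hw hvw
    show IsRelPrime (v.asIdeal ^ k) (w.asIdeal ^ k)
    refine IsRelPrime.pow ?_
    refine (v.prime.irreducible.isRelPrime_iff_not_dvd).2 fun hd => hvw (v_dvd_v hd)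

lemma finP {m : Ideal (𝓞 K)} (hm : m ≠ 0) {k : ℕ} (hk : 1 ≤ k) : {v : HeightOneSpectrum (𝓞 K) | v.asIdeal ^ k ∣ m}.Finite :=
  (Ideal.finite_factors hm).subset fun v hv => (dvd_pow_self _ (by omega)).trans hv

lemma dvd_iff_subset {S : Finset (HeightOneSpectrum (𝓞 K))} {k : ℕ} {m : Ideal (𝓞 K)} (hm : m ≠ 0) (hk : 1 ≤ k) :
    sqP S ^ k ∣ m ↔ S ∈ (finP hm hk).toFinset.powerset := by
  rw [sqP_pow_dvd, Finset.mem_powerset, Finset.subset_iff]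
  simp

lemma mob {m : Ideal (𝓞 K)} (hm : m ≠ 0) {k : ℕ} (hk : 1 ≤ k) (T : Finset (Finset (HeightOneSpectrum (𝓞 K))))
    (hT : ∀ S, sqP S ^ k ∣ m → S ∈ T) :
    ∑ S ∈ T, (if sqP S ^ k ∣ m then (-1 : ℝ) ^ S.card else 0) =
      if ∀ v : HeightOneSpectrum (𝓞 K), ¬ v.asIdeal ^ k ∣ m then 1 else 0 := by
  rw [← Finset.sum_filter]
  have e : T.filter (fun S => sqP S ^ k ∣ m) = (finP hm hk).toFinset.powerset := by
    ext S
    rw [Finset.mem_filter, ← dvd_iff_subset hm hk]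
    exact ⟨fun h => h.2, fun h => ⟨hT S h, h⟩⟩
  rw [e]
  have := Finset.sum_powerset_neg_one_pow_card (x := (finP hm hk).toFinset)
  have h2 : ∑ S ∈ (finP hm hk).toFinset.powerset, (-1 : ℝ) ^ S.card = if (finP hm hk).toFinset = ∅ then 1 else 0 := by
    exact_mod_cast this
  rw [h2]
  have : (finP hm hk).toFinset = ∅ ↔ ∀ v : HeightOneSpectrum (𝓞 K), ¬ v.asIdeal ^ k ∣ m := by
    rw [Set.Finite.toFinset_eq_empty, Set.eq_empty_iff_forall_notMem]; rfl
  simp only [this]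

end Landau

namespace Landau
open scoped Classical nonZeroDivisors
open NumberField Ideal IsDedekindDomain

variable {K : Type} [Field K] [NumberField K]

/-- weight -/
def ww (h : ℕ) (l m : Ideal (𝓞 K)) : ℝ := if l ∣ m then 0 else (absNorm m : ℝ) ^ (-(h : ℝ))

lemma ww_nonneg (h : ℕ) (l m : Ideal (𝓞 K)) : 0 ≤ ww h l m := by
  unfold ww; split_ifs
  · exact le_rfl
  · positivity

lemma ww_le (h : ℕ) (l m : Ideal (𝓞 K)) : ww h l m ≤ (absNorm m : ℝ) ^ (-(h : ℝ)) := by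
  unfold ww; split_ifs
  · positivity
  · exact le_rfl

lemma ww_mul (h : ℕ) {l : Ideal (𝓞 K)} (hl : Prime l) (a b : Ideal (𝓞 K)) : ww h l (a * b) = ww h l a * ww h l b := by
  unfold ww
  rw [hl.dvd_mul]
  by_cases h1 : l ∣ a
  · simp [h1]
  by_cases h2 : l ∣ b
  · simp [h2]
  simp only [h1, h2, or_self, if_false]
  rw [_root_.map_mul, Nat.cast_mul, Real.mul_rpow (by positivity) (by positivity)]

lemma summ_N (h : ℕ) (hh : 2 ≤ h) : Summable (fun m : {m : Ideal (𝓞 K) // m ≠ 0} => (absNorm m.1 : ℝ) ^ (-(h : ℝ))) := by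
  obtain ⟨T, hT, hb⟩ := tail_bound (K := K) h hh
  refine summable_of_sum_le (c := T) (fun m => by simp only [Pi.zero_apply]; positivity) fun u => ?_
  have := hb 1 le_rfl (u.map (Function.Embedding.subtype _)) ?_
  · rw [Finset.sum_map, Real.one_rpow, mul_one] at this
    exact this
  · intro m hm
    rw [Finset.mem_map] at hm
    obtain ⟨a, ha, rfl⟩ := hm
    exact ⟨a.2, by exact_mod_cast norm_ge_one a.2⟩

lemma summ_w (h : ℕ) (hh : 2 ≤ h) (l : Ideal (𝓞 K)) : Summable (fun m : {m : Ideal (𝓞 K) // m ≠ 0} => ww h l m.1) :=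
  Summable.of_nonneg_of_le (fun m => ww_nonneg _ _ _) (fun m => ww_le _ _ _) (summ_N h hh)

lemma summ_S (h : ℕ) (hh : 2 ≤ h) (l : Ideal (𝓞 K)) :
    Summable (fun S : Finset (HeightOneSpectrum (𝓞 K)) => ww h l (sqP S)) := by
  have hi : Function.Injective (fun S : Finset (HeightOneSpectrum (𝓞 K)) => (⟨sqP S, sqP_ne S⟩ : {m : Ideal (𝓞 K) // m ≠ 0})) :=
    fun S T hST => sqP_inj (congrArg Subtype.val hST)
  have h1 := Summable.comp_injective (f := fun m : {m : Ideal (𝓞 K) // m ≠ 0} => ww h l m.1) (summ_w h hh l) hi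
  rw [Function.comp_def] at h1
  exact h1

lemma hasSum_dvd {d : Ideal (𝓞 K)} (hd : d ≠ 0) (f : Ideal (𝓞 K) → ℝ) {a : ℝ}
    (hf : HasSum (fun m : {m : Ideal (𝓞 K) // m ≠ 0} => f (d * m.1)) a) :
    HasSum (fun m : {m : Ideal (𝓞 K) // m ≠ 0} => if d ∣ m.1 then f m.1 else 0) a := by
  let g : {m : Ideal (𝓞 K) // m ≠ 0} → {m : Ideal (𝓞 K) // m ≠ 0} := fun m => ⟨d * m.1, mul_ne_zero hd m.2⟩
  have hg : Function.Injective g := fun a b hab => Subtype.ext (mul_left_cancel₀ hd (congrArg Subtype.val hab))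
  refine (hg.hasSum_iff ?_).1 ?_
  · intro m hm
    rw [if_neg]
    rintro ⟨c, hc⟩
    refine hm ⟨⟨c, ?_⟩, Subtype.ext hc.symm⟩
    rintro rfl
    exact m.2 (by rw [hc, mul_zero])
  · convert hf using 2 with m
    simp [g]

lemma zeta_split (h : ℕ) (hh : 2 ≤ h) {l : Ideal (𝓞 K)} (hl : Prime l) :
    zetaKR K h = ∑' m : {m : Ideal (𝓞 K) // m ≠ 0}, ww h l m.1 + (absNorm l : ℝ) ^ (-(h : ℝ)) * zetaKR K h := by
  have h1 : HasSum (fun m : {m : Ideal (𝓞 K) // m ≠ 0} => (absNorm (l * m.1) : ℝ) ^ (-(h : ℝ)))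
      ((absNorm l : ℝ) ^ (-(h : ℝ)) * zetaKR K h) := by
    have e : (fun m : {m : Ideal (𝓞 K) // m ≠ 0} => (absNorm (l * m.1) : ℝ) ^ (-(h : ℝ))) =
        fun m => (absNorm l : ℝ) ^ (-(h : ℝ)) * (absNorm m.1 : ℝ) ^ (-(h : ℝ)) := by
      funext m
      rw [_root_.map_mul, Nat.cast_mul, Real.mul_rpow (by positivity) (by positivity)]
    rw [e]
    exact ((summ_N (K := K) h hh).hasSum).mul_left ((absNorm l : ℝ) ^ (-(h : ℝ)))
  have h2 := hasSum_dvd hl.ne_zero (fun m => (absNorm m : ℝ) ^ (-(h : ℝ))) h1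
  have h3 := (summ_w (K := K) h hh l).hasSum.add h2
  rw [← h3.tsum_eq, zetaKR]
  refine tsum_congr fun m => ?_
  unfold ww
  split_ifs <;> simp

lemma eq_one_iff {m : Ideal (𝓞 K)} (hm : m ≠ 0) : (∀ v : HeightOneSpectrum (𝓞 K), ¬ v.asIdeal ^ 1 ∣ m) ↔ m = 1 := by
  constructor
  · intro h
    by_contra h1
    obtain ⟨P, hP, hle⟩ := Ideal.exists_le_maximal m (by rwa [← Ideal.one_eq_top])
    have hb : P ≠ ⊥ := by
      rintro rfl
      exact hm (le_bot_iff.1 hle)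
    refine h ⟨P, hP.isPrime, hb⟩ ?_
    rw [pow_one]
    exact Ideal.dvd_iff_le.2 hle
  · rintro rfl v hv
    rw [pow_one] at hv
    exact v.prime.not_unit (isUnit_of_dvd_one hv)

lemma w_inv (h : ℕ) (hh : 2 ≤ h) {l : Ideal (𝓞 K)} (hl : Prime l) :
    (∑' S : Finset (HeightOneSpectrum (𝓞 K)), (-1 : ℝ) ^ S.card * ww h l (sqP S)) *
      (∑' m : {m : Ideal (𝓞 K) // m ≠ 0}, ww h l m.1) = 1 := by
  set Z := ∑' m : {m : Ideal (𝓞 K) // m ≠ 0}, ww h l m.1 with hZ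
  let G : Finset (HeightOneSpectrum (𝓞 K)) → {m : Ideal (𝓞 K) // m ≠ 0} → ℝ := fun S t =>
    if sqP S ∣ t.1 then (-1 : ℝ) ^ S.card * ww h l t.1 else 0
  have hG0 : ∀ S : Finset (HeightOneSpectrum (𝓞 K)), ∀ c : ℝ, HasSum (fun t : {m : Ideal (𝓞 K) // m ≠ 0} =>
      if sqP S ∣ t.1 then c * ww h l t.1 else 0) (c * ww h l (sqP S) * Z) := by
    intro S c
    refine hasSum_dvd (sqP_ne S) (fun m => c * ww h l m) ?_
    have e : (fun m : {m : Ideal (𝓞 K) // m ≠ 0} => c * ww h l (sqP S * m.1)) =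
        fun m => (c * ww h l (sqP S)) * ww h l m.1 := by
      funext m
      rw [ww_mul h hl]; ring
    rw [e]
    exact (summ_w (K := K) h hh l).hasSum.mul_left (c * ww h l (sqP S))
  have hG1 : ∀ S, HasSum (G S) ((-1 : ℝ) ^ S.card * ww h l (sqP S) * Z) := fun S => hG0 S _
  have hGn : ∀ S t, ‖G S t‖ = if sqP S ∣ t.1 then 1 * ww h l t.1 else 0 := by
    intro S t
    simp only [G]
    split_ifs
    · rw [norm_mul, norm_pow, norm_neg, norm_one, one_pow, Real.norm_eq_abs, abs_of_nonneg (ww_nonneg _ _ _)]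
    · exact norm_zero
  have hGn1 : ∀ S, HasSum (fun t => ‖G S t‖) (1 * ww h l (sqP S) * Z) := by
    intro S
    simp only [hGn]
    exact hG0 S 1
  have hGs : Summable (Function.uncurry G) := by
    refine Summable.of_norm ?_
    rw [summable_prod_of_nonneg (fun _ => norm_nonneg _)]
    refine ⟨fun S => (hGn1 S).summable, ?_⟩
    have : (fun S => ∑' t, ‖Function.uncurry G (S, t)‖) = fun S => 1 * ww h l (sqP S) * Z := by
      funext S; exact (hGn1 S).tsum_eq
    rw [this]
    exact ((summ_S h hh l).mul_left 1).mul_right Z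
  have e1 : ∑' S, ∑' t, G S t = (∑' S : Finset (HeightOneSpectrum (𝓞 K)), (-1 : ℝ) ^ S.card * ww h l (sqP S)) * Z := by
    rw [← tsum_mul_right]
    exact tsum_congr fun S => (hG1 S).tsum_eq
  rw [← e1, ← hGs.tsum_comm]
  have e2 : ∀ t : {m : Ideal (𝓞 K) // m ≠ 0}, ∑' S, G S t = if t.1 = 1 then 1 else 0 := by
    intro t
    rw [tsum_eq_sum (s := (finP t.2 (le_refl 1)).toFinset.powerset)]
    · have := mob t.2 (le_refl 1) (finP t.2 (le_refl 1)).toFinset.powerset (fun S hS => (dvd_iff_subset t.2 (le_refl 1)).1 hS)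
      simp only [eq_one_iff t.2] at this
      have e3 : ∑ S ∈ (finP t.2 (le_refl 1)).toFinset.powerset, G S t =
          (∑ S ∈ (finP t.2 (le_refl 1)).toFinset.powerset, (if sqP S ^ 1 ∣ t.1 then (-1 : ℝ) ^ S.card else 0)) * ww h l t.1 := by
        rw [Finset.sum_mul]
        refine Finset.sum_congr rfl fun S _ => ?_
        simp only [G, pow_one]
        split_ifs
        · rfl
        · rw [zero_mul]
      rw [e3, this]
      split_ifs with ht
      · rw [ht, ww, if_neg]
        · simp
        · exact fun hd => hl.not_unit (isUnit_of_dvd_one hd)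
      · rw [zero_mul]
    · intro S hS
      rw [← dvd_iff_subset t.2 (le_refl 1), pow_one] at hS
      simp only [G, if_neg hS]
  simp only [e2]
  rw [tsum_eq_single ⟨1, one_ne_zero⟩]
  · simp
  · intro t ht
    rw [if_neg]
    exact fun h => ht (Subtype.ext h)

lemma two_le_norm {l : Ideal (𝓞 K)} (hl : Prime l) : 2 ≤ absNorm l := by
  have h1 := norm_ge_one hl.ne_zero
  have h2 : absNorm l ≠ 1 := by
    rw [Ne, absNorm_eq_one_iff, ← Ideal.one_eq_top]
    exact hl.ne_one
  omega

lemma const_eq (h : ℕ) (hh : 2 ≤ h) {l : Ideal (𝓞 K)} (hl : Prime l) (k : ℝ) :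
    (((absNorm l : ℝ) ^ h - (absNorm l : ℝ) ^ (h - 1)) / ((absNorm l : ℝ) ^ h - 1)) * (k / zetaKR K h) =
      k * (1 - 1 / (absNorm l : ℝ)) * (∑' S : Finset (HeightOneSpectrum (𝓞 K)), (-1 : ℝ) ^ S.card * ww h l (sqP S)) := by
  have h1 := w_inv h hh hl
  have h2 := zeta_split h hh hl
  set M := ∑' S : Finset (HeightOneSpectrum (𝓞 K)), (-1 : ℝ) ^ S.card * ww h l (sqP S)
  set W := ∑' m : {m : Ideal (𝓞 K) // m ≠ 0}, ww h l m.1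
  set Z := zetaKR K h
  have hq : (2 : ℝ) ≤ absNorm l := by exact_mod_cast two_le_norm hl
  set q : ℝ := ((absNorm l : ℕ) : ℝ)
  have hq0 : 0 < q := by linarith
  rw [Real.rpow_neg hq0.le, Real.rpow_natCast] at h2
  have hqh : 1 < q ^ h := one_lt_pow₀ (by linarith) (by omega)
  have hqh1 : q ^ h - 1 ≠ 0 := by linarith
  have hqh0 : q ^ h ≠ 0 := by positivity
  have hW : W = Z * ((q ^ h - 1) / q ^ h) := by
    field_simp
    field_simp at h2
    linarith
  have hZ : Z ≠ 0 := by
    intro h0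
    rw [hW, h0] at h1; simp at h1
  have hM : M = q ^ h / (Z * (q ^ h - 1)) := by
    rw [hW] at h1
    field_simp
    field_simp at h1
    linarith
  obtain ⟨j, rfl⟩ : ∃ j, h = j + 1 := ⟨h - 1, by omega⟩
  rw [hM, Nat.add_sub_cancel]
  field_simp
  ring

end Landau

namespace Landau
open scoped Classical nonZeroDivisors
open NumberField Ideal IsDedekindDomain

variable {K : Type} [Field K] [NumberField K]

lemma card_mult {e : Ideal (𝓞 K)} (he : e ≠ 0) (x : ℝ) (p : Ideal (𝓞 K) → Prop) :
    ((idF K x).filter (fun m => e ∣ m ∧ p m)).card =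
      ((idF K (x / absNorm e)).filter (fun t => p (e * t))).card := by
  have hN : (0 : ℝ) < absNorm e := by exact_mod_cast norm_ge_one he
  symm
  refine Finset.card_bij (fun t _ => e * t) ?_ ?_ ?_
  · intro t ht
    rw [Finset.mem_filter, mem_idF] at ht
    rw [Finset.mem_filter, mem_idF]
    refine ⟨⟨mul_ne_zero he ht.1.1, ?_⟩, dvd_mul_right _ _, ht.2⟩
    rw [_root_.map_mul, Nat.cast_mul, mul_comm]
    exact (le_div_iff₀ hN).1 ht.1.2
  · intro a _ b _ hab
    exact mul_left_cancel₀ he hab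
  · intro m hm
    rw [Finset.mem_filter, mem_idF] at hm
    obtain ⟨⟨h0, hx⟩, ⟨t, rfl⟩, hp⟩ := hm
    refine ⟨t, ?_, rfl⟩
    rw [Finset.mem_filter, mem_idF]
    refine ⟨⟨right_ne_zero_of_mul h0, ?_⟩, hp⟩
    rw [le_div_iff₀ hN, mul_comm]
    rw [_root_.map_mul, Nat.cast_mul] at hx
    exact hx

/-- ideals of norm at most `y` not divisible by `l` -/
def JJ (l : Ideal (𝓞 K)) (y : ℝ) : ℕ := ((idF K y).filter (fun t => ¬ l ∣ t)).card

lemma JJ_eq {l : Ideal (𝓞 K)} (hl : Prime l) (y : ℝ) :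
    (JJ l y : ℝ) = ((idF K y).card : ℝ) - ((idF K (y / absNorm l)).card : ℝ) := by
  have h1 := card_mult hl.ne_zero y (fun _ => True)
  simp only [and_true, Finset.filter_true] at h1
  have h2 := Finset.card_filter_add_card_filter_not (s := idF K y) (fun t => l ∣ t)
  rw [h1] at h2
  rw [JJ, eq_sub_iff_add_eq, add_comm]
  exact_mod_cast h2

lemma JJ_bound : ∃ B : ℝ, 0 ≤ B ∧ ∀ l : Ideal (𝓞 K), Prime l → ∀ y : ℝ, 0 < y →
    |(JJ l y : ℝ) - kap K * (1 - 1 / (absNorm l : ℝ)) * y| ≤ B * y ^ al K := by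
  obtain ⟨B, hB, h⟩ := landau' (K := K)
  refine ⟨2 * B, by positivity, fun l hl y hy => ?_⟩
  have hq : (2 : ℝ) ≤ absNorm l := by exact_mod_cast two_le_norm hl
  rw [JJ_eq hl]
  set q : ℝ := ((absNorm l : ℕ) : ℝ)
  have hq0 : 0 < q := by linarith
  have h1 := h y hy
  have h2 := h (y / q) (by positivity)
  have h3 : (y / q) ^ al K ≤ y ^ al K :=
    Real.rpow_le_rpow (by positivity) (div_le_self hy.le (by linarith)) al_nonneg
  have h4 : B * (y / q) ^ al K ≤ B * y ^ al K := by gcongr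
  have e : ((idF K y).card : ℝ) - ((idF K (y / q)).card : ℝ) - kap K * (1 - 1 / q) * y =
      (((idF K y).card : ℝ) - kap K * y) - (((idF K (y / q)).card : ℝ) - kap K * (y / q)) := by
    field_simp; ring
  rw [e]
  refine (abs_sub _ _).trans ?_
  linarith

/-- index set -/
def TT (h : ℕ) (x : ℝ) : Finset (Finset (HeightOneSpectrum (𝓞 K))) :=
  (idF K (x ^ ((1 : ℝ) / h))).preimage sqP sqP_inj.injOn

lemma le_root {h : ℕ} (hh : 2 ≤ h) {x N : ℝ} (hx : 0 ≤ x) (hN : 0 ≤ N) : N ≤ x ^ ((1 : ℝ) / h) ↔ N ^ h ≤ x := by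
  have hh0 : (0 : ℝ) < h := by exact_mod_cast (by omega : 0 < h)
  rw [one_div, Real.le_rpow_inv_iff_of_pos hN hx hh0, Real.rpow_natCast]

lemma mem_TT {h : ℕ} (hh : 2 ≤ h) {x : ℝ} (hx : 0 ≤ x) {S : Finset (HeightOneSpectrum (𝓞 K))} :
    S ∈ TT h x ↔ (absNorm (sqP S) : ℝ) ^ h ≤ x := by
  rw [TT, Finset.mem_preimage, mem_idF, le_root hh hx (by positivity)]
  exact ⟨fun h => h.2, fun h => ⟨sqP_ne S, h⟩⟩

lemma card_eq_filter (h : ℕ) (hh : 2 ≤ h) (l : Ideal (𝓞 K)) (x : ℝ) :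
    Nat.card {m : Ideal (𝓞 K) // IsHFree K h m ∧ (absNorm m : ℝ) ≤ x ∧ ¬ l ∣ m} =
      ((idF K x).filter (fun m => ¬ l ∣ m ∧ ∀ v : HeightOneSpectrum (𝓞 K), ¬ v.asIdeal ^ h ∣ m)).card := by
  refine Nat.subtype_card _ fun m => ?_
  rw [Finset.mem_filter, mem_idF, IsHFree]
  constructor
  · rintro ⟨⟨h0, hx⟩, hl, hv⟩
    refine ⟨⟨h0, fun p hp hd => ?_⟩, hx, hl⟩
    by_cases hb : p = ⊥
    · rw [hb, ← Ideal.zero_eq_bot, zero_pow (by omega), zero_dvd_iff] at hd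
      exact h0 hd
    · exact hv ⟨p, hp, hb⟩ hd
  · rintro ⟨⟨h0, hp⟩, hx, hl⟩
    exact ⟨⟨h0, hx⟩, hl, fun v => hp v.asIdeal v.isPrime⟩

lemma count_eq (h : ℕ) (hh : 2 ≤ h) {l : Ideal (𝓞 K)} (hl : Prime l) {x : ℝ} (hx : 2 ≤ x) :
    (Nat.card {m : Ideal (𝓞 K) // IsHFree K h m ∧ (absNorm m : ℝ) ≤ x ∧ ¬ l ∣ m} : ℝ) =
      ∑ S ∈ TT (K := K) h x, if l ∣ sqP S then 0 else (-1 : ℝ) ^ S.card * (JJ l (x / (absNorm (sqP S) : ℝ) ^ h) : ℝ) := by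
  have hx0 : 0 ≤ x := by linarith
  rw [card_eq_filter h hh, ← Finset.filter_filter, Finset.card_filter]
  push_cast
  have h1 : ∀ m ∈ (idF K x).filter (fun m => ¬ l ∣ m),
      (if ∀ v : HeightOneSpectrum (𝓞 K), ¬ v.asIdeal ^ h ∣ m then (1 : ℝ) else 0) =
      ∑ S ∈ TT (K := K) h x, (if sqP S ^ h ∣ m then (-1 : ℝ) ^ S.card else 0) := by
    intro m hm
    rw [Finset.mem_filter, mem_idF] at hm
    refine (mob hm.1.1 (by omega) _ fun S hS => ?_).symm
    rw [mem_TT hh hx0]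
    refine le_trans ?_ hm.1.2
    have h2 := Nat.le_of_dvd (norm_ge_one hm.1.1) (_root_.map_dvd absNorm hS)
    rw [map_pow] at h2
    exact_mod_cast h2
  rw [Finset.sum_congr rfl h1, Finset.sum_comm]
  refine Finset.sum_congr rfl fun S hS => ?_
  rw [← Finset.sum_filter, Finset.sum_const, nsmul_eq_mul, Finset.filter_filter]
  have cm := card_mult (pow_ne_zero h (sqP_ne S)) x (fun m => ¬ l ∣ m)
  have e : ((idF K x).filter (fun m => ¬ l ∣ m ∧ sqP S ^ h ∣ m)).card =
      ((idF K (x / (absNorm (sqP S ^ h) : ℕ))).filter (fun t => ¬ l ∣ sqP S ^ h * t)).card := by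
    refine Eq.trans ?_ (cm.trans ?_)
    · congr 1
      ext m
      simp only [Finset.mem_filter]
      tauto
    · congr 1
      ext m
      simp only [Finset.mem_filter]
  rw [e]
  split_ifs with hd
  · have : (idF K (x / (absNorm (sqP S ^ h) : ℕ))).filter (fun t => ¬ l ∣ sqP S ^ h * t) = ∅ := by
      refine Finset.filter_eq_empty_iff.2 fun t _ => ?_
      rw [not_not]
      exact ((hd.trans (dvd_pow_self _ (by omega))).trans (dvd_mul_right _ _))
    rw [this]; simp
  · rw [mul_comm, JJ, map_pow, Nat.cast_pow]
    congr 3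
    refine Finset.filter_congr fun t _ => ?_
    rw [hl.dvd_mul, or_iff_right]
    exact fun h' => hd (hl.dvd_of_dvd_pow h')

lemma sum_TT_le (h : ℕ) {x : ℝ} (f : Ideal (𝓞 K) → ℝ) (hf : ∀ m, 0 ≤ f m) :
    ∑ S ∈ TT (K := K) h x, f (sqP S) ≤ ∑ d ∈ idF K (x ^ ((1 : ℝ)/h)), f d := by
  rw [← Finset.sum_image (f := f) (s := TT (K := K) h x) (g := sqP) (fun a _ b _ hab => sqP_inj hab)]
  refine Finset.sum_le_sum_of_subset_of_nonneg ?_ fun m _ _ => hf m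
  intro m hm
  obtain ⟨S, hS, rfl⟩ := Finset.mem_image.1 hm
  exact Finset.mem_preimage.1 hS

lemma tail_S (h : ℕ) (hh : 2 ≤ h) : ∃ T : ℝ, 0 ≤ T ∧ ∀ l : Ideal (𝓞 K), ∀ x : ℝ, 2 ≤ x →
    |(∑' S : Finset (HeightOneSpectrum (𝓞 K)), (-1 : ℝ) ^ S.card * ww h l (sqP S)) -
      ∑ S ∈ TT (K := K) h x, (-1 : ℝ) ^ S.card * ww h l (sqP S)| * x ≤ T * x ^ ((1 : ℝ) / h) := by
  obtain ⟨T, hT, hb⟩ := tail_bound (K := K) h hh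
  have hh0 : (0 : ℝ) < h := by exact_mod_cast (by omega : 0 < h)
  refine ⟨T, hT, fun l x hx => ?_⟩
  have hx0 : 0 < x := by linarith
  have hn : ∀ S : Finset (HeightOneSpectrum (𝓞 K)), ‖(-1 : ℝ) ^ S.card * ww h l (sqP S)‖ = ww h l (sqP S) := by
    intro S
    rw [norm_mul, norm_pow, norm_neg, norm_one, one_pow, one_mul, Real.norm_eq_abs, abs_of_nonneg (ww_nonneg _ _ _)]
  have hs : Summable (fun S : Finset (HeightOneSpectrum (𝓞 K)) => (-1 : ℝ) ^ S.card * ww h l (sqP S)) := by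
    refine Summable.of_norm ?_
    simp only [hn]
    exact summ_S h hh l
  rw [← hs.sum_add_tsum_compl (s := TT (K := K) h x), add_sub_cancel_left]
  set Y := x ^ ((1 : ℝ) / h) with hY
  have hY1 : 1 ≤ Y := Real.one_le_rpow (by linarith) (by positivity)
  have h1 : |∑' S : ((TT (K := K) h x : Set (Finset (HeightOneSpectrum (𝓞 K))))ᶜ : Set _), (-1 : ℝ) ^ S.1.card * ww h l (sqP S.1)| ≤ T * Y ^ (1 - (h : ℝ)) := by
    rw [← Real.norm_eq_abs]
    refine (norm_tsum_le_tsum_norm (hs.norm.subtype _)).trans ?_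
    simp only [hn]
    refine Real.tsum_le_of_sum_le (fun S => ww_nonneg _ _ _) fun u => ?_
    have hi : Function.Injective (fun S : ((TT (K := K) h x : Set (Finset (HeightOneSpectrum (𝓞 K))))ᶜ : Set _) => sqP S.1) :=
      fun a b hab => Subtype.ext (sqP_inj hab)
    refine le_trans ?_ (hb Y hY1 (u.map ⟨_, hi⟩) ?_)
    · rw [Finset.sum_map]
      exact Finset.sum_le_sum fun S _ => ww_le _ _ _
    · intro m hm
      obtain ⟨S, hS, rfl⟩ := Finset.mem_map.1 hm
      refine ⟨sqP_ne S.1, ?_⟩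
      have h2 := S.2
      rw [Set.mem_compl_iff, Finset.mem_coe, mem_TT hh hx0.le, ← le_root hh hx0.le (by positivity), not_le] at h2
      exact h2.le
  have e : Y ^ (1 - (h : ℝ)) * x = Y := by
    have : x = Y ^ (h : ℝ) := by rw [hY, ← Real.rpow_mul hx0.le]; field_simp; simp
    have hY0 : 0 < Y := by linarith
    calc Y ^ (1 - (h : ℝ)) * x = Y ^ (1 - (h : ℝ)) * Y ^ (h : ℝ) := by rw [← this]
      _ = Y := by rw [← Real.rpow_add hY0]; simp
  calc _ ≤ T * Y ^ (1 - (h : ℝ)) * x := by gcongr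
    _ = T * Y := by rw [mul_assoc, e]

lemma kap_eq : kappa K = kap K := by
  unfold kappa kap
  rw [mul_assoc _ (Units.regulator K), mul_comm (Units.regulator K), ← mul_assoc]

theorem count_main (K : Type) [Field K] [NumberField K] (h : ℕ) (hh : 2 ≤ h) :
    ∃ C : ℝ, ∀ ℓ : Ideal (NumberField.RingOfIntegers K), ℓ.IsPrime → ℓ ≠ ⊥ →
      ∀ x : ℝ, 2 ≤ x →
      |(Nat.card {m : Ideal (NumberField.RingOfIntegers K) //
          IsHFree K h m ∧ (Ideal.absNorm m : ℝ) ≤ x ∧ ¬ ℓ ∣ m} : ℝ) -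
        (((Ideal.absNorm ℓ : ℝ) ^ h - (Ideal.absNorm ℓ : ℝ) ^ (h - 1)) /
            ((Ideal.absNorm ℓ : ℝ) ^ h - 1)) * (kappa K / zetaKR K h) * x| ≤
      C * RSh K h x := by
  classical
  obtain ⟨B, hB, hJ⟩ := JJ_bound (K := K)
  obtain ⟨H, hH, hhead⟩ := head_bound (K := K) h hh
  obtain ⟨T, hT, htail⟩ := tail_S (K := K) h hh
  obtain ⟨R, hR, hRS⟩ := RSh_ge (K := K) h
  refine ⟨B * H + |kap K| * T * R, fun l hp hb x hx => ?_⟩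
  have hl : Prime l := Ideal.prime_of_isPrime hb hp
  have hx0 : 0 < x := by linarith
  rw [count_eq h hh hl hx, const_eq h hh hl, kap_eq]
  have hq : (2 : ℝ) ≤ Ideal.absNorm l := by exact_mod_cast two_le_norm hl
  have ht := htail l x hx
  set M := ∑' S : Finset (IsDedekindDomain.HeightOneSpectrum (NumberField.RingOfIntegers K)), (-1 : ℝ) ^ S.card * ww h l (sqP S)
  set P := ∑ S ∈ TT (K := K) h x, (-1 : ℝ) ^ S.card * ww h l (sqP S) with hP
  have hJ' := hJ l hl
  set q : ℝ := ((Ideal.absNorm l : ℕ) : ℝ)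
  have hq0 : 0 < q := by linarith
  set c := kap K * (1 - 1 / q) with hc
  have hc1 : |c| ≤ |kap K| := by
    rw [hc, abs_mul]
    have h1 : 0 < 1 / q := by positivity
    have h2 : 1 / q ≤ 1 := by rw [div_le_one hq0]; linarith
    have : |1 - 1 / q| ≤ 1 := abs_le.2 ⟨by linarith, by linarith⟩
    exact mul_le_of_le_one_right (abs_nonneg _) this
  set Q := ∑ S ∈ TT (K := K) h x, (if l ∣ sqP S then 0 else (-1 : ℝ) ^ S.card * (JJ l (x / (Ideal.absNorm (sqP S) : ℝ) ^ h) : ℝ)) with hQ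
  have hdiff : |Q - c * P * x| ≤ B * (H * RSh K h x) := by
    have e : c * P * x = ∑ S ∈ TT (K := K) h x, c * ((-1 : ℝ) ^ S.card * ww h l (sqP S)) * x := by
      rw [hP, Finset.mul_sum, Finset.sum_mul]
    rw [e, hQ, ← Finset.sum_sub_distrib]
    refine (Finset.abs_sum_le_sum_abs _ _).trans ?_
    refine le_trans ?_ (mul_le_mul_of_nonneg_left (hhead x hx) hB)
    refine le_trans ?_ (mul_le_mul_of_nonneg_left (sum_TT_le h (fun d => (x / (Ideal.absNorm d : ℝ) ^ h) ^ al K)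
      (fun m => by positivity)) hB)
    rw [Finset.mul_sum]
    refine Finset.sum_le_sum fun S _ => ?_
    have hN : (0 : ℝ) < Ideal.absNorm (sqP S) := by exact_mod_cast norm_ge_one (sqP_ne S)
    unfold ww
    split_ifs with hd
    · simp only [mul_zero, zero_mul, sub_zero, abs_zero]
      positivity
    · have h1 := hJ' (x / (Ideal.absNorm (sqP S) : ℝ) ^ h) (by positivity)
      have e2 : (-1 : ℝ) ^ S.card * (JJ l (x / (Ideal.absNorm (sqP S) : ℝ) ^ h) : ℝ) -
          c * ((-1 : ℝ) ^ S.card * (Ideal.absNorm (sqP S) : ℝ) ^ (-(h : ℝ))) * x =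
          (-1 : ℝ) ^ S.card * ((JJ l (x / (Ideal.absNorm (sqP S) : ℝ) ^ h) : ℝ) - c * (x / (Ideal.absNorm (sqP S) : ℝ) ^ h)) := by
        rw [Real.rpow_neg hN.le, Real.rpow_natCast]
        ring
      rw [e2, abs_mul, abs_pow, abs_neg, abs_one, one_pow, one_mul]
      exact h1
  have e : Q - c * M * x = (Q - c * P * x) - c * ((M - P) * x) := by ring
  rw [e]
  refine (abs_sub _ _).trans ?_
  have h3 : |c * ((M - P) * x)| ≤ |kap K| * (T * (R * RSh K h x)) := by
    rw [abs_mul c, abs_mul (M - P), abs_of_pos hx0]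
    refine mul_le_mul hc1 (ht.trans (mul_le_mul_of_nonneg_left (hRS x hx) hT)) (by positivity) (abs_nonneg _)
  calc _ ≤ B * (H * RSh K h x) + |kap K| * (T * (R * RSh K h x)) := add_le_add hdiff h3
    _ = _ := by ring

end Landau

/-- **Distribution of `h`-free ideals coprime to a fixed prime ideal `ℓ`**, uniformly
in `ℓ`:
`|S_{h,ℓ}(x)| = ((N(ℓ)^h - N(ℓ)^{h-1})/(N(ℓ)^h - 1)) ⋅ (κ/ζ_K(h)) ⋅ x + O_h(R_{S_h}(x))`. -/
theorem count_hFree_ideals_coprime (h : ℕ) (hh : 2 ≤ h) :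
    ∃ C : ℝ, ∀ ℓ : Ideal (NumberField.RingOfIntegers K), ℓ.IsPrime → ℓ ≠ ⊥ →
      ∀ x : ℝ, 2 ≤ x →
      |(Nat.card {m : Ideal (NumberField.RingOfIntegers K) //
          IsHFree K h m ∧ (Ideal.absNorm m : ℝ) ≤ x ∧ ¬ ℓ ∣ m} : ℝ) -
        (((Ideal.absNorm ℓ : ℝ) ^ h - (Ideal.absNorm ℓ : ℝ) ^ (h - 1)) /
            ((Ideal.absNorm ℓ : ℝ) ^ h - 1)) * (kappa K / zetaKR K h) * x| ≤
      C * RSh K h x := by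
  exact Landau.count_main K h hh

end
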